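/- Let H ⊆ ℝ² be a subset whose subspace topology is Polish. Then the path-connectedness equivalence relation ≈_H on H is Borel reducible to the eventual equality relation E₀ on 2^ℕ; that is, there is a Borel map f : H → 2^ℕ such that x ≈_H y if and only if f(x) and f(y) agree from some index on. -/

import Mathlib

namespace PathRed

open Set Filter Topology MeasureTheory


/-- A sequence of sets can be enlarged to a sequence of measurable sets with empty intersection. -/
def SeqSeparable {X : Type*} [MeasurableSpace X] (A : ℕ → Set X) : Prop :=
  ∃ B : ℕ → Set X, (∀ n, A n ⊆ B n) ∧ (∀ n, MeasurableSet (B n)) ∧ ⋂ n, B n = ∅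

lemma SeqSeparable.of_iUnion {X : Type*} [MeasurableSpace X] {A : ℕ → Set X} (k : ℕ)
    {S : ℕ → Set X} (hk : A k ⊆ ⋃ m, S m)
    (h : ∀ m, SeqSeparable (Function.update A k (S m))) : SeqSeparable A := by
  choose B hAB hB hE using h
  refine ⟨Function.update (fun n => ⋂ m, B m n) k (⋃ m, B m k), fun n => ?_, fun n => ?_, ?_⟩
  · by_cases hn : n = k
    · subst hn
      simp only [Function.update_self]
      refine hk.trans (iUnion_mono fun m => ?_)
      simpa using hAB m n
    · simp only [ne_eq, hn, not_false_eq_true, Function.update_of_ne]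
      refine subset_iInter fun m => ?_
      simpa [hn] using hAB m n
  · by_cases hn : n = k
    · subst hn
      simp only [Function.update_self]
      exact MeasurableSet.iUnion fun m => hB m n
    · simp only [ne_eq, hn, not_false_eq_true, Function.update_of_ne]
      exact MeasurableSet.iInter fun m => hB m n
  · refine eq_empty_of_forall_notMem fun x hx => ?_
    rw [mem_iInter] at hx
    have hxk := hx k
    simp only [Function.update_self, mem_iUnion] at hxk
    obtain ⟨m, hm⟩ := hxk
    have : x ∈ ⋂ n, B m n := by
      refine mem_iInter.2 fun n => ?_
      by_cases hn : n = k
      · subst hn; exact hm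
      · have hxn := hx n
        simp only [ne_eq, hn, not_false_eq_true, Function.update_of_ne, mem_iInter] at hxn
        exact hxn m
    rw [hE m] at this
    exact this

/-- Novikov separation for ranges of continuous maps on Baire space. -/
lemma seqSeparable_range {X : Type*} [TopologicalSpace X] [T2Space X] [MeasurableSpace X]
    [OpensMeasurableSpace X] {f : ℕ → (ℕ → ℕ) → X} (hf : ∀ n, Continuous (f n))
    (h : ⋂ n, range (f n) = ∅) : SeqSeparable fun n => range (f n) := by
  by_contra hns
  let A : ℕ → (ℕ → ℕ) → ℕ → Set X := fun i c n =>
    f n '' {α | ∀ l, Nat.pair n l < i → α l = c (Nat.pair n l)}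
  have step : ∀ i c, ¬ SeqSeparable (A i c) →
      ∃ m, ¬ SeqSeparable (A (i + 1) (Function.update c i m)) := by
    intro i c hQ
    by_contra! hcon
    refine hQ (SeqSeparable.of_iUnion (i.unpair.1)
      (S := fun m => A (i + 1) (Function.update c i m) i.unpair.1) ?_ fun m => ?_)
    · rintro _ ⟨α, hα, rfl⟩
      refine mem_iUnion.2 ⟨α i.unpair.2, α, fun l hl => ?_, rfl⟩
      rcases Nat.lt_succ_iff_lt_or_eq.1 hl with h1 | h1
      · rw [hα l h1, Function.update_of_ne h1.ne]
      · rw [h1, Function.update_self]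
        have := congrArg Nat.unpair h1
        rw [Nat.unpair_pair] at this
        rw [← this]
    · convert hcon m using 1
      funext n
      by_cases hn : n = i.unpair.1
      · subst hn; simp
      · rw [Function.update_of_ne hn]
        have hne : ∀ l, Nat.pair n l ≠ i := by
          intro l hl
          apply hn
          rw [← hl, Nat.unpair_pair]
        have : {α : ℕ → ℕ | ∀ l, Nat.pair n l < i → α l = c (Nat.pair n l)} =
          {α | ∀ l, Nat.pair n l < i + 1 → α l = Function.update c i m (Nat.pair n l)} := by
          ext α
          refine forall_congr' fun l => ?_
          rw [Function.update_of_ne (hne l), Nat.lt_succ_iff_lt_or_eq]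
          simp [hne l]
        simp only [A, this]
  let Q : ℕ → Type _ := fun i => {c : ℕ → ℕ // ¬ SeqSeparable (A i c)}
  choose m hm using step
  let s : ∀ i, Q i := fun i => Nat.rec (motive := Q) ⟨fun _ => 0, by
    simpa [A] using hns⟩
    (fun i c => ⟨Function.update c.1 i (m i c.1 c.2), hm i c.1 c.2⟩) i
  have hs : ∀ i, (s (i + 1)).1 = Function.update (s i).1 i (m i (s i).1 (s i).2) := fun i => rfl
  let c : ℕ → ℕ := fun j => (s (j + 1)).1 j
  have hsc : ∀ i j, j < i → (s i).1 j = c j := by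
    intro i j hij
    induction i, hij using Nat.le_induction with
    | base => rfl
    | succ i hi ih => rw [hs, Function.update_of_ne (by omega), ih]
  have hQ : ∀ i, ¬ SeqSeparable (A i c) := by
    intro i
    convert! (s i).2 using 1
    have : A i c = A i (s i).1 := by
      funext n
      simp only [A]
      congr 1
      ext α
      refine forall_congr' fun l => forall_congr' fun hl => ?_
      rw [hsc i _ hl]
    rw [this]
  let α : ℕ → ℕ → ℕ := fun n l => c (Nat.pair n l)
  obtain ⟨p, q, hpq⟩ : ∃ p q, f p (α p) ≠ f q (α q) := by
    by_contra! hall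
    have : f 0 (α 0) ∈ ⋂ n, range (f n) := mem_iInter.2 fun n => ⟨α n, hall _ _⟩
    rw [h] at this
    exact this
  obtain ⟨U, V, hU, hV, hpU, hqV, hUV⟩ := t2_separation hpq
  have key : ∀ n (W : Set X), IsOpen W → f n (α n) ∈ W →
      ∃ N, ∀ β : ℕ → ℕ, (∀ l < N, β l = α n l) → f n β ∈ W := by
    intro n W hW hn
    have : f n ⁻¹' W ∈ 𝓝 (α n) := (hW.preimage (hf n)).mem_nhds hn
    rw [nhds_pi, Filter.mem_pi'] at this
    obtain ⟨I, t, ht, hI⟩ := this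
    refine ⟨I.sup id + 1, fun β hβ => hI fun l hl => ?_⟩
    rw [hβ l (Nat.lt_succ_of_le (Finset.le_sup (f := id) hl))]
    exact mem_of_mem_nhds (ht l)
  obtain ⟨N₁, hN₁⟩ := key p U hU hpU
  obtain ⟨N₂, hN₂⟩ := key q V hV hqV
  obtain ⟨i, hi⟩ : ∃ i, ∀ l, (l < N₁ → Nat.pair p l < i) ∧ (l < N₂ → Nat.pair q l < i) := by
    refine ⟨(Finset.range N₁).sup (Nat.pair p) + (Finset.range N₂).sup (Nat.pair q) + 1,
      fun l => ⟨fun hl => ?_, fun hl => ?_⟩⟩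
    · have := Finset.le_sup (f := Nat.pair p) (Finset.mem_range.2 hl)
      omega
    · have := Finset.le_sup (f := Nat.pair q) (Finset.mem_range.2 hl)
      omega
  have hpq' : p ≠ q := by rintro rfl; exact hpq rfl
  refine hQ i ⟨Function.update (Function.update (fun _ => univ) p U) q V, fun n => ?_,
    fun n => ?_, ?_⟩
  · by_cases hq : n = q
    · subst hq
      rw [Function.update_self]
      rintro _ ⟨β, hβ, rfl⟩
      exact hN₂ β fun l hl => hβ l ((hi l).2 hl)
    · rw [Function.update_of_ne hq]
      by_cases hp : n = p
      · subst hp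
        rw [Function.update_self]
        rintro _ ⟨β, hβ, rfl⟩
        exact hN₁ β fun l hl => hβ l ((hi l).1 hl)
      · rw [Function.update_of_ne hp]; exact subset_univ _
  · by_cases hq : n = q
    · subst hq; rw [Function.update_self]; exact hV.measurableSet
    · rw [Function.update_of_ne hq]
      by_cases hp : n = p
      · subst hp; rw [Function.update_self]; exact hU.measurableSet
      · rw [Function.update_of_ne hp]; exact MeasurableSet.univ
  · refine eq_empty_of_forall_notMem fun x hx => ?_
    rw [mem_iInter] at hx
    have h1 := hx p
    have h2 := hx q
    rw [Function.update_of_ne hpq', Function.update_self] at h1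
    rw [Function.update_self] at h2
    exact hUV.le_bot ⟨h1, h2⟩

/-- **Novikov's separation theorem**. -/
theorem seqSeparable_of_analyticSet {X : Type*} [TopologicalSpace X] [T2Space X]
    [MeasurableSpace X] [OpensMeasurableSpace X] {A : ℕ → Set X} (hA : ∀ n, AnalyticSet (A n))
    (h : ⋂ n, A n = ∅) : SeqSeparable A := by
  classical
  by_cases hne : ∃ n, A n = ∅
  · obtain ⟨k, hk⟩ := hne
    refine ⟨fun n => if n = k then ∅ else univ, fun n => ?_, fun n => ?_, ?_⟩
    · by_cases hn : n = k
      · subst hn; simp [hk]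
      · simp [hn]
    · by_cases hn : n = k <;> simp [hn]
    · refine eq_empty_of_forall_notMem fun x hx => ?_
      simpa using mem_iInter.1 hx k
  · push Not at hne
    have : ∀ n, ∃ f : (ℕ → ℕ) → X, Continuous f ∧ range f = A n := fun n => by
      have := hA n
      rw [AnalyticSet] at this
      exact this.resolve_left (hne n).ne_empty
    choose f hf hfA using this
    have := seqSeparable_range hf (by simpa [hfA] using h)
    simpa [hfA] using this

/-- The projection of a Borel set with compact sections is Borel. -/
theorem measurableSet_proj_of_isClosed {X Y : Type*} [MeasurableSpace X] [StandardBorelSpace X]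
    [TopologicalSpace Y] [CompactSpace Y] [T2Space Y] [SecondCountableTopology Y]
    [MeasurableSpace Y] [BorelSpace Y] {W : Set (X × Y)} (hW : MeasurableSet W)
    (hc : ∀ x, IsClosed {y | (x, y) ∈ W}) : MeasurableSet {x | ∃ y, (x, y) ∈ W} := by
  let := upgradeStandardBorel X
  have : PolishSpace Y := by
    let := TopologicalSpace.metrizableSpaceMetric Y
    infer_instance
  classical
  obtain ⟨b, hbc, -, hb⟩ := TopologicalSpace.exists_countable_basis Y
  let V : ℕ → Set Y := fun n => if h : b.Nonempty then (hbc.exists_eq_range h).choose n else ∅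
  have hV : ∀ s ∈ b, ∃ n, V n = s := by
    intro s hs
    have hne : b.Nonempty := ⟨s, hs⟩
    have := (hbc.exists_eq_range hne).choose_spec
    rw [this] at hs
    obtain ⟨n, hn⟩ := hs
    refine ⟨n, ?_⟩
    simp only [V, dif_pos hne]
    exact hn
  have hVo : ∀ n, IsOpen (V n) := by
    intro n
    by_cases hne : b.Nonempty
    · simp only [V, dif_pos hne]
      have := (hbc.exists_eq_range hne).choose_spec
      exact hb.isOpen (this.symm.subset (mem_range_self n))
    · simp only [V, dif_neg hne]; exact isOpen_empty
  let D : ℕ → Set X := fun n => Prod.fst '' (W ∩ univ ×ˢ V n)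
  have hD : ∀ n, AnalyticSet (D n) := fun n =>
    (hW.inter (MeasurableSet.univ.prod (hVo n).measurableSet)).analyticSet_image measurable_fst
  have hA : ∀ n, AnalyticSet (Wᶜ ∩ ((Prod.fst ⁻¹' D n) ∪ (univ ×ˢ V n)ᶜ)) := by
    intro n
    rw [inter_union_distrib_left, ← compl_union]
    have h1 : AnalyticSet (Wᶜ ∩ Prod.fst ⁻¹' D n) := by
      rw [inter_eq_iInter]
      refine AnalyticSet.iInter fun b => ?_
      cases b
      · exact (hD n).preimage continuous_fst
      · exact hW.compl.analyticSet
    have h2 : AnalyticSet ((W ∪ univ ×ˢ V n)ᶜ) :=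
      (hW.union (MeasurableSet.univ.prod (hVo n).measurableSet)).compl.analyticSet
    rw [union_eq_iUnion]
    refine AnalyticSet.iUnion fun b => ?_
    cases b
    · exact h2
    · exact h1
  obtain ⟨B, hAB, hB, hE⟩ := seqSeparable_of_analyticSet hA (by
    refine eq_empty_of_forall_notMem fun ⟨x, y⟩ hx => ?_
    rw [mem_iInter] at hx
    have hy : y ∈ {y | (x, y) ∈ W}ᶜ := (hx 0).1
    obtain ⟨s, hs, hys, hsW⟩ := hb.exists_subset_of_mem_open hy (hc x).isOpen_compl
    obtain ⟨n, rfl⟩ := hV s hs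
    rcases (hx n).2 with h | h
    · obtain ⟨⟨x', y'⟩, ⟨h1, -, h2⟩, rfl⟩ := h
      exact hsW h2 h1
    · exact h ⟨mem_univ _, hys⟩)
  have hsep : ∀ n, ∃ u, D n ⊆ u ∧ Disjoint (Prod.fst '' (Wᶜ \ B n)) u ∧ MeasurableSet u := by
    intro n
    refine (hD n).measurablySeparable ((hW.compl.diff (hB n)).analyticSet_image measurable_fst) ?_
    rw [Set.disjoint_left]
    rintro x hx ⟨⟨x', y⟩, ⟨h1, h2⟩, rfl⟩
    exact h2 (hAB n ⟨h1, Or.inl hx⟩)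
  choose u hDu hdu hu using hsep
  have hcompl : {x | ∃ y, (x, y) ∈ W}ᶜ =
      ⋃ F ∈ {F : Finset ℕ | ⋃ n ∈ F, V n = univ}, ⋂ n ∈ F, (u n)ᶜ := by
    ext x
    simp only [mem_compl_iff, mem_ofPred_eq, not_exists, mem_iUnion, mem_iInter, exists_prop]
    constructor
    · intro hx
      have hcov : (univ : Set Y) ⊆ ⋃ n : {n // x ∉ u n}, V n.1 := by
        intro y _
        have : (x, y) ∉ ⋂ n, B n := by rw [hE]; simp
        rw [mem_iInter] at this
        push Not at this
        obtain ⟨n, hn⟩ := this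
        refine mem_iUnion.2 ⟨⟨n, fun hxu => ?_⟩, ?_⟩
        · exact (Set.disjoint_left.1 (hdu n)) ⟨(x, y), ⟨hx y, hn⟩, rfl⟩ hxu
        · by_contra hy
          exact hn (hAB n ⟨hx y, Or.inr fun h => hy h.2⟩)
      obtain ⟨t, ht⟩ := isCompact_univ.elim_finite_subcover _
        (fun n : {n // x ∉ u n} => hVo n.1) hcov
      refine ⟨t.map (Function.Embedding.subtype _), ?_, ?_⟩
      · rw [← univ_subset_iff]
        refine ht.trans ?_
        simp only [Finset.mem_map]
        intro y hy
        simp only [mem_iUnion] at hy ⊢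
        obtain ⟨i, hi, hy⟩ := hy
        exact ⟨i, ⟨i, hi, rfl⟩, hy⟩
      · intro n hn
        obtain ⟨i, -, rfl⟩ := Finset.mem_map.1 hn
        exact i.2
    · rintro ⟨F, hF, hx⟩ y hy
      have : y ∈ ⋃ n ∈ F, V n := by rw [hF]; trivial
      simp only [mem_iUnion] at this
      obtain ⟨n, hn, hyn⟩ := this
      exact hx n hn (hDu n ⟨(x, y), ⟨hy, mem_univ _, hyn⟩, rfl⟩)
  have : MeasurableSet ({x | ∃ y, (x, y) ∈ W}ᶜ) := by
    rw [hcompl]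
    refine MeasurableSet.biUnion (Set.to_countable _) fun F _ => ?_
    exact MeasurableSet.biInter (Set.to_countable _) fun n _ => (hu n).compl
  simpa using this.compl

/-- The projection of a Borel set with finite sections is Borel. -/
theorem measurableSet_proj_of_finite {X Y : Type*} [MeasurableSpace X] [StandardBorelSpace X]
    [MeasurableSpace Y] [StandardBorelSpace Y] {W : Set (X × Y)} (hW : MeasurableSet W)
    (hc : ∀ x, {y | (x, y) ∈ W}.Finite) : MeasurableSet {x | ∃ y, (x, y) ∈ W} := by
  obtain ⟨g, hgm, hgi⟩ := MeasurableSpace.measurable_injection_nat_bool_of_countablySeparated Y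
  have hg : MeasurableEmbedding g := hgm.measurableEmbedding hgi
  have hemb : MeasurableEmbedding (Prod.map id g : X × Y → X × (ℕ → Bool)) :=
    MeasurableEmbedding.id.prodMap hg
  have := measurableSet_proj_of_isClosed (hemb.measurableSet_image.2 hW) (fun x => by
    have : {y | (x, y) ∈ Prod.map id g '' W} = g '' {y | (x, y) ∈ W} := by
      ext y
      constructor
      · rintro ⟨⟨a, b⟩, h, h'⟩
        obtain ⟨rfl, rfl⟩ := Prod.mk.inj h'
        exact ⟨b, h, rfl⟩
      · rintro ⟨b, h, rfl⟩
        exact ⟨(x, b), h, rfl⟩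
    rw [this]
    exact ((hc x).image g).isClosed)
  convert this using 1
  ext x
  constructor
  · rintro ⟨y, hy⟩; exact ⟨g y, (x, y), hy, rfl⟩
  · rintro ⟨_, ⟨a, b⟩, h, h'⟩
    obtain ⟨rfl, rfl⟩ := Prod.mk.inj h'
    exact ⟨b, h⟩

/-! ### Reducing to eventual equality through increasing finite sets of invariants -/

section FiniteInvariants

variable {X : Type*} (g : X → ℝ) (S : ℕ → Set (X × X))

/-- The rank of `s` within the finite section of `S n` at `x`, ordered through `g`. -/
noncomputable def sectionRank (n : ℕ) (p : X × X) : ℕ :=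
  {t | (p.1, t) ∈ S n ∧ g t < g p.2}.ncard

/-- The codes used to describe the section of `S M` at `x` up to precision `2⁻ᴹ`. -/
def HasCode (M : ℕ) (c : ℕ × ℕ × ℤ) (x : X) : Prop :=
  ∃ s, (x, s) ∈ S M ∧ sectionRank g S M (x, s) = c.1 ∧ sectionRank g S (M + 1) (x, s) = c.2.1 ∧
    ⌊2 ^ M * g s⌋ = c.2.2

variable {g S}

lemma sectionRank_lt (hfin : ∀ n x, {s | (x, s) ∈ S n}.Finite) {n : ℕ} {x s t : X}
    (hs : (x, s) ∈ S n) (hst : g s < g t) :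
    sectionRank g S n (x, s) < sectionRank g S n (x, t) := by
  refine Set.ncard_lt_ncard ⟨fun u hu => ⟨hu.1, hu.2.trans hst⟩, fun h => ?_⟩
    ((hfin n x).subset fun u hu => hu.1)
  exact lt_irrefl _ (h (⟨hs, hst⟩ : s ∈ {t_1 | (x, t_1) ∈ S n ∧ g t_1 < g t})).2

lemma sectionRank_injOn (hg : Function.Injective g) (hfin : ∀ n x, {s | (x, s) ∈ S n}.Finite)
    {n : ℕ} {x s t : X} (hs : (x, s) ∈ S n) (ht : (x, t) ∈ S n)
    (h : sectionRank g S n (x, s) = sectionRank g S n (x, t)) : s = t := by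
  rcases lt_trichotomy (g s) (g t) with h1 | h1 | h1
  · exact absurd h (sectionRank_lt hfin hs h1).ne
  · exact hg h1
  · exact absurd h (sectionRank_lt hfin ht h1).ne'

lemma succ_le_sectionRank (hg : Function.Injective g) (hfin : ∀ n x, {s | (x, s) ∈ S n}.Finite)
    {n k : ℕ} {x s : X} : k + 1 ≤ sectionRank g S n (x, s) ↔
      ∃ t, (x, t) ∈ S n ∧ g t < g s ∧ k ≤ sectionRank g S n (x, t) := by
  have hf : ∀ s, {t | (x, t) ∈ S n ∧ g t < g s}.Finite := fun s =>
    (hfin n x).subset fun u hu => hu.1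
  constructor
  · intro h
    have hne : {t | (x, t) ∈ S n ∧ g t < g s}.Nonempty := by
      rw [← Set.ncard_pos (hf s)]
      exact Nat.lt_of_lt_of_le (Nat.succ_pos k) h
    obtain ⟨t, ht, hmax⟩ := (hf s).exists_maximalFor g _ hne
    refine ⟨t, ht.1, ht.2, ?_⟩
    have hsub : {t | (x, t) ∈ S n ∧ g t < g s} ⊆ insert t {u | (x, u) ∈ S n ∧ g u < g t} := by
      intro u hu
      by_cases hut : u = t
      · exact Or.inl hut
      · refine Or.inr ⟨hu.1, lt_of_le_of_ne ?_ fun h => hut (hg h)⟩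
        by_contra! hlt
        exact absurd (hmax hu hlt.le) (not_le.2 hlt)
    have h1 := Set.ncard_le_ncard hsub ((hf t).insert t)
    have h2 := Set.ncard_insert_le t {u | (x, u) ∈ S n ∧ g u < g t}
    simp only [sectionRank] at h ⊢
    omega
  · rintro ⟨t, ht, hts, hk⟩
    have := sectionRank_lt (g := g) hfin ht hts
    omega

variable [MeasurableSpace X] [StandardBorelSpace X]

lemma measurable_sectionRank (hgm : Measurable g) (hg : Function.Injective g)
    (hS : ∀ n, MeasurableSet (S n)) (hfin : ∀ n x, {s | (x, s) ∈ S n}.Finite) (n : ℕ) :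
    Measurable (sectionRank g S n) := by
  have key : ∀ k, MeasurableSet {p | k ≤ sectionRank g S n p} := by
    intro k
    induction k with
    | zero => simp
    | succ k ih =>
      have : MeasurableSet {q : (X × X) × X | (q.1.1, q.2) ∈ S n ∧ g q.2 < g q.1.2 ∧
          (q.1.1, q.2) ∈ {p | k ≤ sectionRank g S n p}} := by
        have hm : Measurable fun q : (X × X) × X => (q.1.1, q.2) := by fun_prop
        refine (hm (hS n)).inter (MeasurableSet.inter ?_ (hm ih))
        exact measurableSet_lt (hgm.comp measurable_snd)
          (hgm.comp (measurable_snd.comp measurable_fst))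
      have := measurableSet_proj_of_finite this fun p =>
        (hfin n p.1).subset fun t ht => ht.1
      convert this using 1
      ext ⟨x, s⟩
      exact succ_le_sectionRank hg hfin
  exact measurable_of_Ici key

lemma measurableSet_hasCode (hgm : Measurable g) (hg : Function.Injective g)
    (hS : ∀ n, MeasurableSet (S n)) (hfin : ∀ n x, {s | (x, s) ∈ S n}.Finite) (M : ℕ)
    (c : ℕ × ℕ × ℤ) : MeasurableSet {x | HasCode g S M c x} := by
  refine measurableSet_proj_of_finite (W := {p : X × X | (p.1, p.2) ∈ S M ∧
    sectionRank g S M (p.1, p.2) = c.1 ∧ sectionRank g S (M + 1) (p.1, p.2) = c.2.1 ∧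
    ⌊2 ^ M * g p.2⌋ = c.2.2}) ?_ fun x => (hfin M x).subset fun s hs => hs.1
  refine (hS M).inter (MeasurableSet.inter ?_ (MeasurableSet.inter ?_ ?_))
  · exact measurable_sectionRank hgm hg hS hfin M (measurableSet_singleton c.1)
  · exact measurable_sectionRank hgm hg hS hfin (M + 1) (measurableSet_singleton c.2.1)
  · exact (show Measurable fun p : X × X => ⌊2 ^ M * g p.2⌋ by fun_prop)
      (measurableSet_singleton c.2.2)

omit [MeasurableSpace X] [StandardBorelSpace X] in
lemma mem_of_hasCode (hg : Function.Injective g) (hfin : ∀ n x, {s | (x, s) ∈ S n}.Finite)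
    (hmono : ∀ n x s, (x, s) ∈ S n → (x, s) ∈ S (n + 1)) {N : ℕ} {x y s : X}
    (h : ∀ M ≥ N, ∀ c, HasCode g S M c x → HasCode g S M c y) (hs : (x, s) ∈ S N) :
    (y, s) ∈ S N := by
  have hmono' : ∀ M ≥ N, ∀ x s, (x, s) ∈ S N → (x, s) ∈ S M := by
    intro M hM x s hs
    induction M, hM using Nat.le_induction with
    | base => exact hs
    | succ M _ ih => exact hmono _ _ _ ih
  obtain ⟨t, ht, ht1, -, -⟩ := h N le_rfl (_, _, _) ⟨s, hs, rfl, rfl, rfl⟩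
  have key : ∀ M ≥ N, sectionRank g S M (y, t) = sectionRank g S M (x, s) ∧
      ⌊2 ^ M * g t⌋ = ⌊2 ^ M * g s⌋ := by
    have step : ∀ M ≥ N, sectionRank g S M (y, t) = sectionRank g S M (x, s) →
        sectionRank g S (M + 1) (y, t) = sectionRank g S (M + 1) (x, s) ∧
        ⌊2 ^ M * g t⌋ = ⌊2 ^ M * g s⌋ := by
      intro M hM hr
      obtain ⟨t', ht', h1, h2, h3⟩ := h M hM (_, _, _) ⟨s, hmono' M hM _ _ hs, rfl, rfl, rfl⟩
      have : t' = t := sectionRank_injOn hg hfin ht' (hmono' M hM _ _ ht) (h1.trans hr.symm)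
      subst this
      exact ⟨h2, h3⟩
    have hr : ∀ M ≥ N, sectionRank g S M (y, t) = sectionRank g S M (x, s) := by
      intro M hM
      induction M, hM using Nat.le_induction with
      | base => exact ht1
      | succ M hM ih => exact (step M hM ih).1
    exact fun M hM => ⟨hr M hM, (step M hM (hr M hM)).2⟩
  suffices s = t by rwa [this]
  apply hg
  by_contra hne
  have hpos : 0 < |g s - g t| := abs_pos.2 (sub_ne_zero.2 hne)
  obtain ⟨k, hk⟩ := exists_nat_gt (1 / |g s - g t|)
  have h2 := (key (max N k) (le_max_left _ _)).2
  have h3 := Int.abs_sub_lt_one_of_floor_eq_floor h2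
  rw [← mul_sub, abs_mul, abs_sub_comm, abs_of_pos (by positivity)] at h3
  have h4 : (k : ℝ) ≤ 2 ^ (max N k) := by
    have : k ≤ 2 ^ (max N k) := (Nat.lt_two_pow_self).le.trans
      (Nat.pow_le_pow_right (by norm_num) (le_max_right _ _))
    exact_mod_cast this
  rw [div_lt_iff₀ hpos] at hk
  nlinarith

/-- An equivalence relation which can be decided from increasing, eventually invariant and
eventually nonempty finite sets reduces to eventual equality. -/
theorem exists_reduction_of_finite (E : X → X → Prop) (S : ℕ → Set (X × X))
    (hS : ∀ n, MeasurableSet (S n)) (hfin : ∀ n x, {s | (x, s) ∈ S n}.Finite)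
    (hmono : ∀ n x s, (x, s) ∈ S n → (x, s) ∈ S (n + 1)) (hne : ∀ x, ∃ n s, (x, s) ∈ S n)
    (hinv : ∀ x y, E x y → ∃ N, ∀ n ≥ N, ∀ s, (x, s) ∈ S n ↔ (y, s) ∈ S n)
    (hE : ∀ n x y s, (x, s) ∈ S n → (y, s) ∈ S n → E x y) :
    ∃ f : X → ℕ → Bool, Measurable f ∧ ∀ x y, E x y ↔ ∃ n, ∀ m ≥ n, f x m = f y m := by
  classical
  obtain ⟨g, hge⟩ := exists_measurableEmbedding_real X
  have hg := hge.injective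
  have hgm := hge.measurable
  let e : ℕ × ℕ × ℤ ≃ ℕ := Denumerable.eqv _
  refine ⟨fun x m => decide (HasCode g S m.unpair.1 (e.symm m.unpair.2) x), ?_, fun x y => ?_⟩
  · refine measurable_pi_lambda _ fun m => ?_
    refine measurable_to_bool ?_
    convert measurableSet_hasCode hgm hg hS hfin m.unpair.1 (e.symm m.unpair.2) using 1
    ext x
    simp
  · simp only [decide_eq_decide]
    constructor
    · intro hxy
      obtain ⟨N, hN⟩ := hinv x y hxy
      have hcode : ∀ M ≥ N, ∀ c, HasCode g S M c x ↔ HasCode g S M c y := by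
        intro M hM c
        have hr : ∀ n ≥ N, ∀ s, sectionRank g S n (x, s) = sectionRank g S n (y, s) := by
          intro n hn s
          simp only [sectionRank, hN n hn]
        simp only [HasCode, hN M hM, hr M hM, hr (M + 1) (by omega)]
      have hfc : ∀ x M, {c | HasCode g S M c x}.Finite := by
        intro x M
        refine ((hfin M x).image fun s => (sectionRank g S M (x, s),
          sectionRank g S (M + 1) (x, s), ⌊2 ^ M * g s⌋)).subset ?_
        rintro ⟨a, b, d⟩ ⟨s, hs, h1, h2, h3⟩
        exact ⟨s, hs, by simp only at h1 h2 h3 ⊢; rw [h1, h2, h3]⟩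
      have hF : (⋃ M ∈ Finset.range N, (fun c => Nat.pair M (e c)) ''
          ({c | HasCode g S M c x} ∪ {c | HasCode g S M c y})).Finite :=
        Set.Finite.biUnion (Finset.finite_toSet _) fun M _ => ((hfc x M).union (hfc y M)).image _
      obtain ⟨b, hb⟩ := hF.bddAbove
      refine ⟨b + 1, fun m hm => ?_⟩
      by_cases hmN : N ≤ m.unpair.1
      · exact hcode _ hmN _
      · have hmem : ∀ c, c = e.symm m.unpair.2 →
            c ∉ {c | HasCode g S m.unpair.1 c x} ∪ {c | HasCode g S m.unpair.1 c y} := by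
          rintro c rfl hc
          have : m ≤ b := hb (by
            simp only [mem_iUnion]
            refine ⟨m.unpair.1, by simpa using hmN, _, hc, ?_⟩
            simp)
          omega
        have := hmem _ rfl
        simp only [mem_union, mem_ofPred_eq, not_or] at this
        exact iff_of_false this.1 this.2
    · rintro ⟨n, hn⟩
      have hcode : ∀ M ≥ n, ∀ c, HasCode g S M c x ↔ HasCode g S M c y := by
        intro M hM c
        have := hn (Nat.pair M (e c)) (hM.trans (Nat.left_le_pair _ _))
        simpa using this
      obtain ⟨k, s, hs⟩ := hne x
      have hs' : (x, s) ∈ S (max n k) := by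
        have : ∀ M ≥ k, (x, s) ∈ S M := by
          intro M hM
          induction M, hM using Nat.le_induction with
          | base => exact hs
          | succ M _ ih => exact hmono _ _ _ ih
        exact this _ (le_max_right _ _)
      exact hE _ x y s hs' (mem_of_hasCode hg hfin hmono
        (fun M hM c => (hcode M ((le_max_left _ _).trans hM) c).1) hs')

end FiniteInvariants

/-! ### Crossing paths in a disc -/

open Complex in
lemma arg_one_sub_exp {ψ : ℝ} (h0 : 0 < ψ) (h1 : ψ < 2 * Real.pi) :
    arg (1 - exp (ψ * I)) = (ψ - Real.pi) / 2 := by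
  have hs : 0 < 2 * Real.sin (ψ / 2) := by
    have := Real.sin_pos_of_pos_of_lt_pi (x := ψ / 2) (by linarith) (by linarith)
    linarith
  have : 1 - exp (ψ * I) = ((2 * Real.sin (ψ / 2) : ℝ) : ℂ) *
      (cos (((ψ - Real.pi) / 2 : ℝ) : ℂ) + sin (((ψ - Real.pi) / 2 : ℝ) : ℂ) * I) := by
    obtain ⟨x, rfl⟩ : ∃ x, ψ = 2 * x := ⟨ψ / 2, by ring⟩
    have e1 : (2 * x - Real.pi) / 2 = x - Real.pi / 2 := by ring
    rw [← ofReal_cos, ← ofReal_sin, e1, Real.cos_sub_pi_div_two, Real.sin_sub_pi_div_two,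
      exp_mul_I, ← ofReal_cos, ← ofReal_sin, mul_div_cancel_left₀ x two_ne_zero,
      Real.cos_two_mul, Real.sin_two_mul]
    have e3 := Real.sin_sq_add_cos_sq x
    apply Complex.ext
    · simp only [sub_re, one_re, add_re, ofReal_re, mul_re, I_re, ofReal_im, I_im]
      nlinarith
    · simp only [sub_im, one_im, add_im, ofReal_re, mul_im, mul_re, I_re, ofReal_im, I_im, add_re]
      ring
  rw [this, arg_mul_cos_add_sin_mul_I hs ⟨by linarith [Real.pi_pos], by linarith [Real.pi_pos]⟩]

open Complex in
lemma arg_one_sub_exp_of_neg {ψ : ℝ} (h0 : -(2 * Real.pi) < ψ) (h1 : ψ < 0) :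
    arg (1 - exp (ψ * I)) = (ψ + Real.pi) / 2 := by
  have := arg_one_sub_exp (ψ := ψ + 2 * Real.pi) (by linarith) (by linarith)
  have e : exp (((ψ + 2 * Real.pi : ℝ) : ℂ) * I) = exp (ψ * I) := by
    push_cast
    rw [add_mul, exp_add, exp_two_pi_mul_I, mul_one]
  rw [e] at this
  rw [this]; ring

open Complex in
lemma im_sub_im_of_exp_eq {u w : unitInterval → ℂ} (hu : Continuous u) (hw : Continuous w)
    {A : ℂ} (hA : A ≠ 0) (h : ∀ t, exp (u t) = A * (1 - w t)) (hw1 : ∀ t, ‖w t‖ ≤ 1)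
    (hne : ∀ t, w t ≠ 1) : (u 1).im - (u 0).im = arg (1 - w 1) - arg (1 - w 0) := by
  have hslit : ∀ t, 1 - w t ∈ slitPlane := by
    intro t
    left
    have h1 : (w t).re ≤ 1 := (re_le_norm _).trans (hw1 t)
    rw [sub_re, one_re, sub_pos]
    refine lt_of_le_of_ne h1 fun h2 => hne t ?_
    have h3 := hw1 t
    have h4 := Complex.sq_norm (w t)
    rw [normSq_apply, h2] at h4
    have h5 : (w t).im = 0 := by
      have : ‖w t‖ ^ 2 ≤ 1 := by nlinarith [norm_nonneg (w t)]
      nlinarith [sq_nonneg (w t).im]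
    exact Complex.ext (by simpa using h2) (by simpa using h5)
  let v : unitInterval → ℂ := fun t => u t - log (1 - w t)
  have hv : Continuous v := hu.sub
    (Continuous.clog (continuous_const.sub hw) hslit)
  have hve : ∀ t, exp (v t) = A := by
    intro t
    rw [exp_sub, h, exp_log (slitPlane_ne_zero (hslit t))]
    field_simp [slitPlane_ne_zero (hslit t)]
  have hconst : v 1 = v 0 :=
    Complex.isCoveringMap_exp.const_of_comp (g := v) hv
      (fun t t' => Subtype.ext ((hve t).trans (hve t').symm)) 1 0
  have := congrArg Complex.im hconst
  simp only [v, sub_im, log_im] at this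
  linarith

open Complex in
/-- Two paths in the closed unit disc whose endpoints interlace on the circle meet. -/
lemma exists_eq_of_interlacing {f g : unitInterval → ℂ} (hf : Continuous f) (hg : Continuous g)
    (hf1 : ∀ s, ‖f s‖ ≤ 1) (hg1 : ∀ s, ‖g s‖ ≤ 1) {θ₁ θ₂ φ₁ φ₂ : ℝ}
    (hf0 : f 0 = exp (θ₁ * I)) (hfe : f 1 = exp (θ₂ * I))
    (hg0 : g 0 = exp (φ₁ * I)) (hge : g 1 = exp (φ₂ * I))
    (h1 : θ₁ < φ₁) (h2 : φ₁ < θ₂) (h3 : θ₂ < φ₂) (h4 : φ₂ < θ₁ + 2 * Real.pi) :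
    ∃ s t, f s = g t := by
  by_contra! hne
  let π : ℝ → unitInterval := projIcc 0 1 zero_le_one
  have hπ : Continuous π := continuous_projIcc
  let h : C(ℝ × ℝ, {z : ℂ // z ≠ 0}) :=
    ⟨fun p => ⟨f (π p.1) - g (π p.2), sub_ne_zero.2 (hne _ _)⟩, by fun_prop⟩
  obtain ⟨L, hLc, hL⟩ : ∃ L : unitInterval × unitInterval → ℂ, Continuous L ∧
      ∀ p, exp (L p) = f p.1 - g p.2 := by
    obtain ⟨L, ⟨-, hL⟩, -⟩ := Complex.isCoveringMap_exp.existsUnique_continuousMap_lifts h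
      (a₀ := (0, 0)) (e₀ := log (f (π 0) - g (π 0))) (by
        apply Subtype.ext
        simp only [h, ContinuousMap.coe_mk]
        rw [exp_log (sub_ne_zero.2 (hne _ _))])
    refine ⟨fun p => L (p.1, p.2), by fun_prop, fun p => ?_⟩
    have := congrArg Subtype.val (congrFun hL (p.1, p.2))
    simpa [h, π] using this
  have hexp : ∀ a b : ℝ, exp (b * I) / exp (a * I) = exp (((b - a : ℝ) : ℂ) * I) := by
    intro a b
    rw [← exp_sub]; push_cast; ring_nf
  have hnorm : ∀ (a : ℝ) (z : ℂ), ‖z‖ ≤ 1 → ‖z / exp (a * I)‖ ≤ 1 := by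
    intro a z hz
    rwa [norm_div, norm_exp_ofReal_mul_I, div_one]
  have e0 := im_sub_im_of_exp_eq (u := fun t => L (0, t)) (w := fun t => g t / exp (θ₁ * I))
    (by fun_prop) (by fun_prop) (exp_ne_zero (θ₁ * I)) (fun t => by
      rw [hL, mul_sub, mul_div_cancel₀ _ (exp_ne_zero _), ← hf0, mul_one])
    (fun t => hnorm _ _ (hg1 t)) (fun t ht => hne 0 t (by
      rw [hf0, ← (div_eq_one_iff_eq (exp_ne_zero _)).1 ht]))
  have e1 := im_sub_im_of_exp_eq (u := fun t => L (1, t)) (w := fun t => g t / exp (θ₂ * I))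
    (by fun_prop) (by fun_prop) (exp_ne_zero (θ₂ * I)) (fun t => by
      rw [hL, mul_sub, mul_div_cancel₀ _ (exp_ne_zero _), ← hfe, mul_one])
    (fun t => hnorm _ _ (hg1 t)) (fun t ht => hne 1 t (by
      rw [hfe, ← (div_eq_one_iff_eq (exp_ne_zero _)).1 ht]))
  have e2 := im_sub_im_of_exp_eq (u := fun t => L (t, 0)) (w := fun t => f t / exp (φ₁ * I))
    (by fun_prop) (by fun_prop) (neg_ne_zero.2 (exp_ne_zero (φ₁ * I))) (fun t => by
      rw [hL, neg_mul, mul_sub, mul_div_cancel₀ _ (exp_ne_zero _), ← hg0]; ring)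
    (fun t => hnorm _ _ (hf1 t)) (fun t ht => hne t 0 (by
      rw [hg0, ← (div_eq_one_iff_eq (exp_ne_zero _)).1 ht]))
  have e3 := im_sub_im_of_exp_eq (u := fun t => L (t, 1)) (w := fun t => f t / exp (φ₂ * I))
    (by fun_prop) (by fun_prop) (neg_ne_zero.2 (exp_ne_zero (φ₂ * I))) (fun t => by
      rw [hL, neg_mul, mul_sub, mul_div_cancel₀ _ (exp_ne_zero _), ← hge]; ring)
    (fun t => hnorm _ _ (hf1 t)) (fun t ht => hne t 1 (by
      rw [hge, ← (div_eq_one_iff_eq (exp_ne_zero _)).1 ht]))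
  simp only [hf0, hfe, hg0, hge, hexp] at e0 e1 e2 e3
  rw [arg_one_sub_exp (by linarith) (by linarith),
    arg_one_sub_exp (by linarith) (by linarith)] at e0
  rw [arg_one_sub_exp (by linarith) (by linarith),
    arg_one_sub_exp_of_neg (by linarith) (by linarith)] at e1
  rw [arg_one_sub_exp (by linarith) (by linarith),
    arg_one_sub_exp_of_neg (by linarith) (by linarith)] at e2
  rw [arg_one_sub_exp_of_neg (by linarith) (by linarith),
    arg_one_sub_exp_of_neg (by linarith) (by linarith)] at e3
  linarith [Real.pi_pos]

/-! ### Triods in the plane -/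

/-- A point from which three nontrivial paths start which pairwise meet only in that point. -/
def IsTriodPoint {X : Type*} [TopologicalSpace X] (x : X) : Prop :=
  ∃ (S : Fin 3 → Set X) (y : Fin 3 → X), (∀ i, y i ≠ x ∧ JoinedIn (S i) x (y i)) ∧
    ∀ i j, i ≠ j → S i ∩ S j ⊆ {x}

lemma exists_first_hit {X : Type*} [TopologicalSpace X] {γ : unitInterval → X}
    (hγ : Continuous γ) {F : Set X} (hF : IsClosed F) (h : ∃ t, γ t ∈ F) :
    ∃ t, γ t ∈ F ∧ ∀ s < t, γ s ∉ F := by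
  obtain ⟨t, ht, hmin⟩ := (hF.preimage hγ).isCompact.exists_isLeast h
  exact ⟨t, ht, fun s hs hsF => absurd (hmin hsF) (not_le.2 hs)⟩

lemma exists_first_eq {u : unitInterval → ℝ} (hu : Continuous u) {r : ℝ} (h0 : u 0 < r)
    (h : ∃ t, r ≤ u t) : ∃ t, 0 < t ∧ u t = r ∧ ∀ s < t, u s < r := by
  obtain ⟨t, ht, hmin⟩ := exists_first_hit hu (isClosed_Ici (a := r)) h
  have hlt : ∀ s < t, u s < r := fun s hs => not_le.1 (hmin s hs)
  have ht0 : 0 < t := by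
    refine lt_of_le_of_ne unitInterval.nonneg' fun h => ?_
    rw [← h] at ht
    exact absurd ht (not_le.2 h0)
  refine ⟨t, ht0, le_antisymm ?_ ht, hlt⟩
  have : t ∈ closure (Iio t) := by
    rw [closure_Iio' (a := t) ⟨0, ht0⟩]; exact self_mem_Iic
  exact closure_minimal (fun s hs => (hlt s hs).le) (isClosed_le hu continuous_const) this

lemma joinedIn_of_continuous {X : Type*} [TopologicalSpace X] {F : Set X} {γ : unitInterval → X}
    (hγ : Continuous γ) (a b : unitInterval) (h : ∀ t ∈ uIcc a b, γ t ∈ F) :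
    JoinedIn F (γ a) (γ b) := by
  have hp : IsPathConnected (uIcc a b) := by
    have h1 : IsPathConnected (uIcc (a : ℝ) b) := (convex_uIcc _ _).isPathConnected nonempty_uIcc
    have hsub : uIcc (a : ℝ) b ⊆ unitInterval := ordConnected_Icc.uIcc_subset a.2 b.2
    have h2 : uIcc a b = Set.inclusion hsub '' univ := by
      ext t
      simp only [image_univ, mem_range, Subtype.exists]
      constructor
      · intro ht
        refine ⟨t, ?_, rfl⟩
        rw [mem_uIcc] at ht ⊢
        exact_mod_cast ht
      · rintro ⟨r, hr, rfl⟩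
        rw [mem_uIcc] at hr ⊢
        exact_mod_cast hr
    rw [h2]
    have : PathConnectedSpace (uIcc (a : ℝ) b) := isPathConnected_iff_pathConnectedSpace.1 h1
    exact isPathConnected_univ.image (continuous_inclusion hsub)
  exact ((hp.image hγ).joinedIn _ (mem_image_of_mem _ left_mem_uIcc) _
    (mem_image_of_mem _ right_mem_uIcc)).mono (by rintro _ ⟨t, ht, rfl⟩; exact h t ht)

variable {X : Type*} [TopologicalSpace X] {φ : X → ℂ}

/-- The points joined within a round disc to three points on the boundary circle, with arguments
separated by two given rationals. -/
def IsDiscTripod (φ : X → ℂ) (c : ℂ) (r : ℝ) (p₁ p₂ : ℚ) (x : X) : Prop :=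
  ∃ a : Fin 3 → X, (∀ i, ‖φ (a i) - c‖ = r ∧ JoinedIn (φ ⁻¹' Metric.closedBall c r) x (a i)) ∧
    (φ (a 0) - c).arg < p₁ ∧ p₁ < (φ (a 1) - c).arg ∧ (φ (a 1) - c).arg < p₂ ∧
    p₂ < (φ (a 2) - c).arg

open Complex in
lemma joinedIn_of_interlacing (hφ : Continuous φ) (hi : Function.Injective φ) {c : ℂ} {r : ℝ}
    (hr : 0 < r) {a b a' b' : X} (ha : ‖φ a - c‖ = r) (hb : ‖φ b - c‖ = r)
    (ha' : ‖φ a' - c‖ = r) (hb' : ‖φ b' - c‖ = r)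
    (hab : JoinedIn (φ ⁻¹' Metric.closedBall c r) a b)
    (hab' : JoinedIn (φ ⁻¹' Metric.closedBall c r) a' b')
    (h1 : (φ a - c).arg < (φ a' - c).arg) (h2 : (φ a' - c).arg < (φ b - c).arg)
    (h3 : (φ b - c).arg < (φ b' - c).arg) :
    JoinedIn (φ ⁻¹' Metric.closedBall c r) a a' := by
  obtain ⟨f, hf⟩ := hab
  obtain ⟨g, hg⟩ := hab'
  have hr' : (r : ℂ) ≠ 0 := by exact_mod_cast hr.ne'
  have hmem : ∀ x, x ∈ φ ⁻¹' Metric.closedBall c r → ‖(φ x - c) / r‖ ≤ 1 := by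
    intro x hx
    rw [mem_preimage, mem_closedBall_iff_norm] at hx
    rw [norm_div, norm_real, Real.norm_of_nonneg hr.le]
    exact (div_le_one hr).2 hx
  have hexp : ∀ x, ‖φ x - c‖ = r → (φ x - c) / r = exp ((φ x - c).arg * I) := by
    intro x hx
    have := norm_mul_exp_arg_mul_I (φ x - c)
    rw [hx] at this
    rw [div_eq_iff hr', mul_comm, this]
  obtain ⟨s, t, hst⟩ := exists_eq_of_interlacing (f := fun s => (φ (f s) - c) / r)
    (g := fun s => (φ (g s) - c) / r) (by fun_prop) (by fun_prop)
    (fun s => hmem _ (hf s)) (fun s => hmem _ (hg s)) (by simp [hexp a ha])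
    (by simp [hexp b hb]) (by simp [hexp a' ha'])
    (by simp [hexp b' hb']) h1 h2 h3 (by
      linarith [arg_le_pi (φ b' - c), neg_pi_lt_arg (φ a - c)])
  have hst' : f s = g t := by
    apply hi
    have := (div_left_inj' hr').1 hst
    exact sub_left_injective this
  have j1 := joinedIn_of_continuous f.continuous 0 s fun t _ => hf t
  have j2 := joinedIn_of_continuous g.continuous t 0 fun t _ => hg t
  rw [Path.source] at j1 j2
  rw [hst'] at j1
  exact j1.trans j2

lemma IsDiscTripod.joinedIn (hφ : Continuous φ) (hi : Function.Injective φ) {c : ℂ} {r : ℝ}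
    (hr : 0 < r) {p₁ p₂ : ℚ} {x y : X} (hx : IsDiscTripod φ c r p₁ p₂ x)
    (hy : IsDiscTripod φ c r p₁ p₂ y) : JoinedIn (φ ⁻¹' Metric.closedBall c r) x y := by
  obtain ⟨a, ha, hx0, hx1, hx1', hx2⟩ := hx
  obtain ⟨b, hb, hy0, hy1, hy1', hy2⟩ := hy
  by_contra hxy
  have hnj : ∀ i j, ¬ JoinedIn (φ ⁻¹' Metric.closedBall c r) (a i) (b j) := fun i j h =>
    hxy (((ha i).2.trans h).trans (hb j).2.symm)
  have hne : ∀ i, (φ (a i) - c).arg ≠ (φ (b i) - c).arg := by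
    intro i h
    have h1 := Complex.ext_norm_arg ((ha i).1.trans (hb i).1.symm) h
    have h2 : a i = b i := hi (sub_left_injective h1)
    refine hnj i i ?_
    rw [← h2]
    exact JoinedIn.refl (ha i).2.target_mem
  have key : ∀ i j, (φ (a i) - c).arg < (φ (b i) - c).arg →
      (φ (b i) - c).arg < (φ (a j) - c).arg → ¬ (φ (a j) - c).arg < (φ (b j) - c).arg := by
    intro i j h1 h2 h3
    exact hnj i i (joinedIn_of_interlacing hφ hi hr (ha i).1 (ha j).1 (hb i).1 (hb j).1
      ((ha i).2.symm.trans (ha j).2) ((hb i).2.symm.trans (hb j).2) h1 h2 h3)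
  have key' : ∀ i j, (φ (b i) - c).arg < (φ (a i) - c).arg →
      (φ (a i) - c).arg < (φ (b j) - c).arg → ¬ (φ (b j) - c).arg < (φ (a j) - c).arg := by
    intro i j h1 h2 h3
    exact hnj i i (joinedIn_of_interlacing hφ hi hr (hb i).1 (hb j).1 (ha i).1 (ha j).1
      ((hb i).2.symm.trans (hb j).2) ((ha i).2.symm.trans (ha j).2) h1 h2 h3).symm
  rcases lt_or_gt_of_ne (hne 0) with h0 | h0 <;> rcases lt_or_gt_of_ne (hne 1) with h1 | h1 <;>
    rcases lt_or_gt_of_ne (hne 2) with h2 | h2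
  · exact key 0 1 h0 (by linarith) h1
  · exact key 0 1 h0 (by linarith) h1
  · exact key 0 2 h0 (by linarith) h2
  · exact key' 1 2 h1 (by linarith) h2
  · exact key 1 2 h1 (by linarith) h2
  · exact key' 0 2 h0 (by linarith) h2
  · exact key' 0 1 h0 (by linarith) h1
  · exact key' 0 1 h0 (by linarith) h1

lemma exists_isDiscTripod {c : ℂ} {r : ℝ} {x : X} (a : Fin 3 → X)
    (ha : ∀ i, ‖φ (a i) - c‖ = r ∧ JoinedIn (φ ⁻¹' Metric.closedBall c r) x (a i))
    (hφ : Function.Injective φ) (hne : Function.Injective a) :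
    ∃ p₁ p₂, IsDiscTripod φ c r p₁ p₂ x := by
  have harg : ∀ i j, i ≠ j → (φ (a i) - c).arg ≠ (φ (a j) - c).arg := by
    intro i j hij h
    have h1 := Complex.ext_norm_arg ((ha i).1.trans (ha j).1.symm) h
    exact hij (hne (hφ (sub_left_injective h1)))
  have key : ∀ i j k, (φ (a i) - c).arg < (φ (a j) - c).arg →
      (φ (a j) - c).arg < (φ (a k) - c).arg → ∃ p₁ p₂, IsDiscTripod φ c r p₁ p₂ x := by
    intro i j k h1 h2
    obtain ⟨p₁, h3, h4⟩ := exists_rat_btwn h1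
    obtain ⟨p₂, h5, h6⟩ := exists_rat_btwn h2
    refine ⟨p₁, p₂, ![a i, a j, a k], fun l => ?_, h3, h4, h5, h6⟩
    fin_cases l
    · exact ha i
    · exact ha j
    · exact ha k
  rcases lt_or_gt_of_ne (harg 0 1 (by decide)) with h0 | h0 <;>
  rcases lt_or_gt_of_ne (harg 1 2 (by decide)) with h1 | h1 <;>
  rcases lt_or_gt_of_ne (harg 0 2 (by decide)) with h2 | h2
  · exact key 0 1 2 h0 h1
  · exact key 0 1 2 h0 h1
  · exact key 0 2 1 h2 h1
  · exact key 2 0 1 h2 h0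
  · exact key 1 0 2 h0 h2
  · exact key 1 2 0 h1 h2
  · exact key 2 1 0 h1 h0
  · exact key 2 1 0 h1 h0

/-- **Moore's triod theorem**, local form: in a space embedded in the plane, countably many points
suffice to reach every triod point by arbitrarily small paths. -/
theorem exists_countable_joinedIn_of_isTriodPoint (hφ : IsEmbedding φ) :
    ∃ K : Set X, K.Countable ∧ ∀ x, IsTriodPoint x → ∀ U ∈ 𝓝 x, ∃ k ∈ K, JoinedIn U x k := by
  classical
  let ι := ℕ × ℚ × ℚ × ℚ
  let T : ι → X → Prop := fun i x =>
    IsDiscTripod φ (TopologicalSpace.denseSeq ℂ i.1) (i.2.1 : ℝ) i.2.2.1 i.2.2.2 x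
  refine ⟨{x | ∃ i, ∃ h : ∃ y, T i y, x = h.choose}, ?_, ?_⟩
  · have : {x | ∃ i, ∃ h : ∃ y, T i y, x = h.choose} ⊆
        range (fun i : {i // ∃ y, T i y} => i.2.choose) := by
      rintro x ⟨i, h, rfl⟩
      exact ⟨⟨i, h⟩, rfl⟩
    exact (countable_range _).mono this
  · rintro x ⟨S, y, hy, hS⟩ U hU
    choose hyx hj using hy
    choose γ hγ using hj
    rw [hφ.isInducing.nhds_eq_comap, mem_comap] at hU
    obtain ⟨t, ht, htU⟩ := hU
    obtain ⟨ε, hε, hεt⟩ := Metric.mem_nhds_iff.1 ht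
    obtain ⟨δ, hδ, hδε, hδy⟩ : ∃ δ > 0, 3 * δ ≤ ε ∧ ∀ i, 3 * δ ≤ dist (φ (y i)) (φ x) := by
      have h : ∀ i, 0 < dist (φ (y i)) (φ x) := fun i =>
        dist_pos.2 fun h => hyx i (hφ.injective h)
      refine ⟨(min ε (min (dist (φ (y 0)) (φ x)) (min (dist (φ (y 1)) (φ x))
        (dist (φ (y 2)) (φ x))))) / 3, ?_, ?_, ?_⟩
      · have := h 0; have := h 1; have := h 2
        positivity
      · rw [mul_div_cancel₀ _ (by norm_num)]
        exact min_le_left _ _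
      · intro i
        rw [mul_div_cancel₀ _ (by norm_num)]
        fin_cases i <;> simp
    obtain ⟨n, hn⟩ := Metric.denseRange_iff.1 (TopologicalSpace.denseRange_denseSeq ℂ) (φ x) δ hδ
    obtain ⟨q, hq1, hq2⟩ := exists_rat_btwn (show δ < 2 * δ by linarith)
    set c := TopologicalSpace.denseSeq ℂ n
    have hex : ∀ i, ∃ t, ‖φ (γ i t) - c‖ = q ∧ ∀ s ≤ t, ‖φ (γ i s) - c‖ ≤ q := by
      intro i
      have hc : Continuous fun t => ‖φ (γ i t) - c‖ := by
        have := hφ.continuous; fun_prop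
      have h0 : ‖φ (γ i 0) - c‖ < q := by
        rw [Path.source, ← dist_eq_norm]; linarith
      have h1 : (q : ℝ) < ‖φ (γ i 1) - c‖ := by
        rw [Path.target, ← dist_eq_norm]
        have := dist_triangle_right (φ (y i)) (φ x) c
        rw [← dist_comm c, dist_comm c, dist_comm (φ x) c] at this
        rw [dist_comm] at hn
        have := hδy i
        linarith
      obtain ⟨t, -, ht, hlt⟩ := exists_first_eq hc h0 ⟨1, h1.le⟩
      refine ⟨t, ht, fun s hs => ?_⟩
      rcases hs.eq_or_lt with rfl | h
      · exact ht.le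
      · exact (hlt s h).le
    choose t ht1 ht2 using hex
    have hxa : ∀ i, JoinedIn (φ ⁻¹' Metric.closedBall c q) x (γ i (t i)) := by
      intro i
      have := joinedIn_of_continuous (F := φ ⁻¹' Metric.closedBall c q) (γ i).continuous 0 (t i)
        (fun s hs => by
          rw [uIcc_of_le unitInterval.nonneg'] at hs
          rw [mem_preimage, mem_closedBall_iff_norm]
          exact ht2 i s hs.2)
      rwa [Path.source] at this
    have hinj : Function.Injective fun i => γ i (t i) := by
      intro i j hij
      by_contra hne
      have hmem : γ i (t i) ∈ S i ∩ S j := ⟨hγ i _, by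
        simp only at hij; rw [hij]; exact hγ j _⟩
      have hx : γ i (t i) = x := hS i j hne hmem
      have h1 := ht1 i
      rw [hx, ← dist_eq_norm] at h1
      linarith
    obtain ⟨p₁, p₂, hT⟩ := exists_isDiscTripod _ (fun i => ⟨ht1 i, hxa i⟩) hφ.injective hinj
    have hT' : ∃ y, T (n, q, p₁, p₂) y := ⟨x, hT⟩
    refine ⟨hT'.choose, ⟨_, hT', rfl⟩, ?_⟩
    refine (hT.joinedIn hφ.continuous hφ.injective (hδ.trans hq1) hT'.choose_spec).mono ?_
    refine Subset.trans ?_ htU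
    refine preimage_mono (Subset.trans ?_ hεt)
    intro z hz
    rw [Metric.mem_closedBall] at hz
    rw [Metric.mem_ball]
    have := dist_triangle z c (φ x)
    rw [dist_comm c] at this
    linarith

/-! ### Points reached by arbitrarily small paths from a countable set -/

/-- Infinite concatenation of paths contained in smaller and smaller neighbourhoods of a point. -/
lemma joinedIn_of_seq {X : Type*} [TopologicalSpace X] {x : X} {U : ℕ → Set X} (hU : Antitone U)
    (hxU : ∀ n, x ∈ U n) (hbasis : ∀ V ∈ 𝓝 x, ∃ n, U n ⊆ V) {k : ℕ → X}
    (hk : ∀ n, JoinedIn (U n) (k n) (k (n + 1))) : JoinedIn (U 0) x (k 0) := by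
  choose γ hγ using hk
  let f : ℝ → X := fun t => (γ ⌊t⌋₊).extend (t - ⌊t⌋₊)
  have hf : ∀ n : ℕ, ∀ t ∈ Icc (n : ℝ) (n + 1), f t = (γ n).extend (t - n) := by
    rintro n t ⟨h1, h2⟩
    rcases h2.eq_or_lt with rfl | h2
    · have : ⌊(n : ℝ) + 1⌋₊ = n + 1 := by exact_mod_cast Nat.floor_natCast (n + 1)
      simp [f, this]
    · have : ⌊t⌋₊ = n := (Nat.floor_eq_iff (n.cast_nonneg.trans h1)).2 ⟨h1, h2⟩
      simp only [f]
      rw [this]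
  have hc : ∀ n : ℕ, ContinuousOn f (Icc (0 : ℝ) n) := by
    intro n
    induction n with
    | zero => simp
    | succ n ih =>
      have h1 : ContinuousOn f (Icc (n : ℝ) (n + 1)) :=
        ContinuousOn.congr (by fun_prop) (hf n)
      have := ih.union_of_isClosed h1 isClosed_Icc isClosed_Icc
      rw [Icc_union_Icc_eq_Icc n.cast_nonneg (by linarith)] at this
      exact_mod_cast this
  have hfU : ∀ n : ℕ, ∀ t : ℝ, (n : ℝ) ≤ t → f t ∈ U n := by
    intro n t hnt
    have : n ≤ ⌊t⌋₊ := Nat.le_floor hnt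
    apply hU this
    obtain ⟨s, hs⟩ : (γ ⌊t⌋₊).extend (t - ⌊t⌋₊) ∈ range (γ ⌊t⌋₊) := by
      rw [← Path.extend_range]; exact mem_range_self _
    simp only [f]
    rw [← hs]
    exact hγ _ s
  let g : unitInterval → X := fun s => if s = 0 then x else f (1 / s - 1)
  have hg0 : g 0 = x := if_pos rfl
  have hg1 : g 1 = k 0 := by
    have := hf 0 0 (by simp)
    simp [g, this]
  have hpos : ∀ s : unitInterval, s ≠ 0 → 0 < (s : ℝ) := fun s hs =>
    lt_of_le_of_ne s.2.1 fun h => hs (Subtype.ext h.symm)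
  have hgU : ∀ n : ℕ, ∀ s : unitInterval, (s : ℝ) * (n + 1) ≤ 1 → g s ∈ U n := by
    intro n s hs
    by_cases h : s = 0
    · simp only [g, if_pos h]; exact hxU n
    · simp only [g, if_neg h]
      refine hfU n _ ?_
      rw [le_sub_iff_add_le, le_div_iff₀ (hpos s h), mul_comm]
      exact hs
  have hgc : Continuous g := by
    rw [continuous_iff_continuousAt]
    intro s
    by_cases h : s = 0
    · subst h
      rw [ContinuousAt, hg0]
      intro V hV
      obtain ⟨n, hn⟩ := hbasis V hV
      have : {s : unitInterval | (s : ℝ) * (n + 1) < 1} ∈ 𝓝 (0 : unitInterval) :=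
        IsOpen.mem_nhds (isOpen_lt (by fun_prop) (by fun_prop)) (by simp)
      exact mem_map.2 (mem_of_superset this fun s hs => hn (hgU n s (le_of_lt hs)))
    · have hs := hpos s h
      obtain ⟨n, hn⟩ := exists_nat_gt (1 / (s : ℝ))
      have hopen : IsOpen {t : unitInterval | 1 < (t : ℝ) * n} :=
        isOpen_lt (by fun_prop) (by fun_prop)
      have hsm : s ∈ {t : unitInterval | 1 < (t : ℝ) * n} := by
        rw [div_lt_iff₀ hs, mul_comm] at hn
        exact hn
      have hne : ∀ t ∈ {t : unitInterval | 1 < (t : ℝ) * n}, t ≠ 0 := by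
        rintro t ht rfl
        simp at ht
        linarith
      have : ContinuousOn g {t : unitInterval | 1 < (t : ℝ) * n} := by
        refine ContinuousOn.congr (f := fun t : unitInterval => f (1 / t - 1)) ?_
          fun t ht => if_neg (hne t ht)
        refine (hc n).comp ?_ ?_
        · refine ContinuousOn.sub (ContinuousOn.div (by fun_prop) (by fun_prop) ?_) (by fun_prop)
          exact fun t ht => (hpos t (hne t ht)).ne'
        · intro t ht
          have h0 := hpos t (hne t ht)
          refine ⟨?_, ?_⟩
          · rw [sub_nonneg, le_div_iff₀ h0, one_mul]; exact t.2.2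
          · rw [sub_le_iff_le_add, div_le_iff₀ h0]
            have : (1 : ℝ) < t * n := ht
            nlinarith
      exact this.continuousAt (hopen.mem_nhds hsm)
  have := joinedIn_of_continuous (F := U 0) hgc 0 1 fun t _ => hgU 0 t (by simpa using t.2.2)
  rwa [hg0, hg1] at this

lemma isOpen_joinedIn_ball {X : Type*} [MetricSpace X] (a b : X) (r : ℝ) :
    IsOpen {x | JoinedIn (Metric.ball x r) a b} := by
  rw [Metric.isOpen_iff]
  rintro x ⟨γ, hγ⟩
  obtain ⟨t, -, ht⟩ := isCompact_univ.exists_isMaxOn (univ_nonempty (α := unitInterval))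
    (f := fun t => dist (γ t) x) (by fun_prop)
  refine ⟨r - dist (γ t) x, sub_pos.2 (hγ t), fun y hy => ⟨γ, fun s => ?_⟩⟩
  have h1 : dist (γ s) x ≤ dist (γ t) x := ht (mem_univ s)
  have h2 := dist_triangle_right (γ s) y x
  rw [Metric.mem_ball] at hy ⊢
  linarith

/-- The points reached by arbitrarily small paths from points of the sequence `κ`. -/
def reachable {X : Type*} [TopologicalSpace X] (κ : ℕ → X) : Set X :=
  {x | ∀ U ∈ 𝓝 x, ∃ i, JoinedIn U x (κ i)}

variable {X : Type*} [MetricSpace X] (κ : ℕ → X)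

/-- The sequence `i` consists of the least indices of the small path classes around `x`. -/
def IsReach (x : X) (i : ℕ → ℕ) : Prop :=
  ∀ n, κ (i n) ∈ Metric.ball x ((1 / 2) ^ n) ∧
    JoinedIn (Metric.ball x ((1 / 2) ^ n)) (κ (i n)) (κ (i (n + 1))) ∧
    ∀ j < i n, ¬ JoinedIn (Metric.ball x ((1 / 2) ^ n)) (κ j) (κ (i n))

variable {κ}

lemma antitone_ball_pow (x : X) : Antitone fun n : ℕ => Metric.ball x ((1 / 2 : ℝ) ^ n) :=
  fun _ _ hmn => Metric.ball_subset_ball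
    (pow_le_pow_of_le_one (by norm_num) (by norm_num) hmn)

lemma exists_ball_pow_subset {x : X} {V : Set X} (hV : V ∈ 𝓝 x) :
    ∃ n : ℕ, Metric.ball x ((1 / 2 : ℝ) ^ n) ⊆ V := by
  obtain ⟨ε, hε, h⟩ := Metric.mem_nhds_iff.1 hV
  obtain ⟨n, hn⟩ := exists_pow_lt_of_lt_one hε (by norm_num : (1 / 2 : ℝ) < 1)
  exact ⟨n, (Metric.ball_subset_ball hn.le).trans h⟩

lemma IsReach.joinedIn {x : X} {i : ℕ → ℕ} (h : IsReach κ x i) (n : ℕ) :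
    JoinedIn (Metric.ball x ((1 / 2) ^ n)) x (κ (i n)) := by
  have := joinedIn_of_seq (x := x) (U := fun m => Metric.ball x ((1 / 2 : ℝ) ^ (n + m)))
    (k := fun m => κ (i (n + m))) (fun a b hab => antitone_ball_pow x (by omega))
    (fun m => Metric.mem_ball_self (by positivity)) (fun V hV => by
      obtain ⟨m, hm⟩ := exists_ball_pow_subset hV
      exact ⟨m, (antitone_ball_pow x (by omega : m ≤ n + m)).trans hm⟩) (fun m => (h (n + m)).2.1)
  simpa using this

lemma IsReach.unique {x : X} {i j : ℕ → ℕ} (hi : IsReach κ x i) (hj : IsReach κ x j) : i = j := by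
  funext n
  have h := (hi.joinedIn n).symm.trans (hj.joinedIn n)
  rcases lt_trichotomy (i n) (j n) with h1 | h1 | h1
  · exact absurd h ((hj n).2.2 _ h1)
  · exact h1
  · exact absurd h.symm ((hi n).2.2 _ h1)

lemma exists_isReach {x : X} (hx : x ∈ reachable κ) : ∃ i, IsReach κ x i := by
  classical
  have h : ∀ n : ℕ, ∃ i, JoinedIn (Metric.ball x ((1 / 2) ^ n)) x (κ i) := fun n =>
    hx _ (Metric.ball_mem_nhds _ (by positivity))
  refine ⟨fun n => Nat.find (h n), fun n => ⟨(Nat.find_spec (h n)).target_mem, ?_, ?_⟩⟩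
  · exact (Nat.find_spec (h n)).symm.trans
      ((Nat.find_spec (h (n + 1))).mono (antitone_ball_pow x n.le_succ))
  · intro j hj hjoin
    exact Nat.find_min (h n) hj ((Nat.find_spec (h n)).trans hjoin.symm)

lemma IsReach.mem_reachable {x : X} {i : ℕ → ℕ} (hi : IsReach κ x i) : x ∈ reachable κ := by
  intro U hU
  obtain ⟨n, hn⟩ := exists_ball_pow_subset hU
  exact ⟨i n, (hi.joinedIn n).mono hn⟩

lemma range_subset_reachable (n : ℕ) : κ n ∈ reachable κ := fun _ hU =>
  ⟨n, JoinedIn.refl (mem_of_mem_nhds hU)⟩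

variable [MeasurableSpace X] [BorelSpace X] [PolishSpace X]

lemma measurableSet_isReach (T : Set ℕ) : MeasurableSet {x | ∃ i, IsReach κ x i ∧ i 0 ∈ T} := by
  let D : ℕ → ℕ → ℕ → Set X := fun n a b => {x | κ a ∈ Metric.ball x ((1 / 2) ^ n) ∧
    JoinedIn (Metric.ball x ((1 / 2) ^ n)) (κ a) (κ b) ∧
    ∀ j < a, ¬ JoinedIn (Metric.ball x ((1 / 2) ^ n)) (κ j) (κ a)}
  have hD : ∀ n a b, MeasurableSet (D n a b) := by
    intro n a b
    refine MeasurableSet.inter ?_ (MeasurableSet.inter ?_ ?_)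
    · exact (isOpen_lt (by fun_prop) continuous_const :
        IsOpen {x | dist (κ a) x < (1 / 2) ^ n}).measurableSet
    · exact (isOpen_joinedIn_ball _ _ _).measurableSet
    · have : {x | ∀ j < a, ¬ JoinedIn (Metric.ball x ((1 / 2) ^ n)) (κ j) (κ a)} =
          ⋂ j ∈ Iio a, {x | JoinedIn (Metric.ball x ((1 / 2) ^ n)) (κ j) (κ a)}ᶜ := by
        ext x; simp
      change MeasurableSet {x | ∀ j < a, ¬ JoinedIn (Metric.ball x ((1 / 2) ^ n)) (κ j) (κ a)}
      rw [this]
      exact MeasurableSet.biInter (to_countable _) fun j _ =>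
        (isOpen_joinedIn_ball _ _ _).measurableSet.compl
  have hW : MeasurableSet {p : X × (ℕ → ℕ) | IsReach κ p.1 p.2 ∧ p.2 0 ∈ T} := by
    have : {p : X × (ℕ → ℕ) | IsReach κ p.1 p.2 ∧ p.2 0 ∈ T} =
        (⋂ n, ⋃ a, ⋃ b, (Prod.fst ⁻¹' D n a b ∩
          {p : X × (ℕ → ℕ) | p.2 n = a} ∩ {p | p.2 (n + 1) = b})) ∩ {p | p.2 0 ∈ T} := by
      ext p
      simp only [IsReach, mem_ofPred_eq, mem_inter_iff, mem_iInter, mem_iUnion, mem_preimage, D]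
      refine and_congr_left fun _ => forall_congr' fun n => ?_
      constructor
      · intro h
        exact ⟨_, _, ⟨h, rfl⟩, rfl⟩
      · rintro ⟨a, b, ⟨h, rfl⟩, rfl⟩
        exact h
    rw [this]
    have hm : ∀ n, Measurable fun p : X × (ℕ → ℕ) => p.2 n := fun n => by fun_prop
    refine MeasurableSet.inter (MeasurableSet.iInter fun n => MeasurableSet.iUnion fun a =>
      MeasurableSet.iUnion fun b => ?_) (hm 0 (MeasurableSet.of_discrete (s := T)))
    refine ((measurable_fst (hD n a b)).inter ?_).inter ?_
    · exact hm n (measurableSet_singleton a)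
    · exact hm (n + 1) (measurableSet_singleton b)
  have := hW.image_of_measurable_injOn measurable_fst (by
    rintro ⟨x, i⟩ h ⟨y, j⟩ h' heq
    obtain rfl : x = y := heq
    exact Prod.ext rfl (IsReach.unique h.1 h'.1))
  convert this using 1
  ext x
  constructor
  · rintro ⟨i, h⟩; exact ⟨(x, i), h, rfl⟩
  · rintro ⟨⟨x, i⟩, h, rfl⟩; exact ⟨i, h⟩

lemma measurableSet_reachable : MeasurableSet (reachable κ) := by
  convert measurableSet_isReach (κ := κ) univ using 1
  ext x
  exact ⟨fun h => by simpa using exists_isReach h, fun ⟨i, h, _⟩ => h.mem_reachable⟩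

lemma measurableSet_reachable_inter_joined (m : ℕ) :
    MeasurableSet (reachable κ ∩ {x | Joined x (κ m)}) := by
  convert measurableSet_isReach (κ := κ) {j | Joined (κ j) (κ m)} using 1
  ext x
  constructor
  · rintro ⟨h, h'⟩
    obtain ⟨i, hi⟩ := exists_isReach h
    exact ⟨i, hi, (hi.joinedIn 0).joined.symm.trans h'⟩
  · rintro ⟨i, hi, h'⟩
    exact ⟨hi.mem_reachable, (hi.joinedIn 0).joined.trans h'⟩

local notation "I" => unitInterval

/-! ### Simple arcs with a canonical parametrisation -/

/-- Every nontrivial path can be thinned out to a path all of whose fibres are intervals. -/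
lemma exists_monotone_path {X : Type*} [MetricSpace X] {γ : I → X} (hγ : Continuous γ) :
    ∃ g : I → X, Continuous g ∧ g 0 = γ 0 ∧ g 1 = γ 1 ∧ range g ⊆ range γ ∧
      ∀ s t, s ≤ t → g s = g t → ∀ u ∈ Icc s t, g u = g s := by
  let 𝒮 : Set (Set I) := {A | IsClosed A ∧ 0 ∈ A ∧ 1 ∈ A ∧
    ∀ a ∈ A, ∀ b ∈ A, a < b → Ioo a b ∩ A = ∅ → γ a = γ b}
  have hmax : ∀ A ∈ 𝒮, ∀ t, ∃ p, IsGreatest (A ∩ Iic t) p := fun A hA t =>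
    ((hA.1.inter isClosed_Iic).isCompact).exists_isGreatest ⟨0, hA.2.1, unitInterval.nonneg'⟩
  have hmin : ∀ A ∈ 𝒮, ∀ t, ∃ n, IsLeast (A ∩ Ici t) n := fun A hA t =>
    ((hA.1.inter isClosed_Ici).isCompact).exists_isLeast ⟨1, hA.2.2.1, unitInterval.le_one'⟩
  have huc : UniformContinuous γ := CompactSpace.uniformContinuous_of_continuous hγ
  obtain ⟨A, hA⟩ : ∃ A, Minimal (· ∈ 𝒮) A := by
    refine zorn_superset 𝒮 fun c hc hchain => ?_
    rcases c.eq_empty_or_nonempty with rfl | hne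
    · refine ⟨univ, ⟨isClosed_univ, trivial, trivial, fun a _ b _ hab h => ?_⟩, by simp⟩
      obtain ⟨m, hm⟩ := exists_between hab
      rw [inter_univ] at h
      exact absurd h (Set.Nonempty.ne_empty ⟨m, hm⟩)
    · refine ⟨⋂₀ c, ⟨isClosed_sInter fun B hB => (hc hB).1, fun B hB => (hc hB).2.1,
        fun B hB => (hc hB).2.2.1, fun a ha b hb hab h => ?_⟩, fun B hB => sInter_subset_of_mem hB⟩
      refine eq_of_forall_dist_le fun ε hε => ?_
      obtain ⟨δ, hδ, hδε⟩ := Metric.uniformContinuous_iff.1 huc (ε / 2) (by linarith)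
      have hIooa : Ioo a b ∩ Metric.ball a δ ∈ 𝓝[>] a :=
        inter_mem (Ioo_mem_nhdsGT hab) (nhdsWithin_le_nhds (Metric.ball_mem_nhds a hδ))
      have hnea : (𝓝[>] a).NeBot := nhdsGT_neBot_of_exists_gt ⟨b, hab⟩
      obtain ⟨a', ha', had⟩ := hnea.nonempty_of_mem hIooa
      have hIoob : Ioo a' b ∩ Metric.ball b δ ∈ 𝓝[<] b :=
        inter_mem (Ioo_mem_nhdsLT ha'.2) (nhdsWithin_le_nhds (Metric.ball_mem_nhds b hδ))
      have hneb : (𝓝[<] b).NeBot := nhdsLT_neBot_of_exists_lt ⟨a', ha'.2⟩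
      obtain ⟨b', hb', hbd⟩ := hneb.nonempty_of_mem hIoob
      have : Nonempty c := hne.to_subtype
      obtain ⟨⟨B, hB⟩, hBe⟩ := (isCompact_Icc (a := a') (b := b')).elim_directed_family_closed
        (fun B : c => (B : Set I)) (fun B => (hc B.2).1) (by
          rw [← sInter_eq_iInter]
          refine eq_empty_of_forall_notMem fun e he => ?_
          exact (h ▸ (⟨⟨ha'.1.trans_le he.1.1, he.1.2.trans_lt hb'.2⟩, he.2⟩ :
            e ∈ Ioo a b ∩ ⋂₀ c) : e ∈ (∅ : Set I)))
        (fun B C => (hchain.total B.2 C.2).elim (fun h => ⟨B, le_rfl, h⟩) fun h => ⟨C, h, le_rfl⟩)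
      obtain ⟨p, hp⟩ := hmax B (hc hB) a'
      obtain ⟨n, hn⟩ := hmin B (hc hB) b'
      have hap : a ≤ p := hp.2 ⟨ha B hB, ha'.1.le⟩
      have hnb : n ≤ b := hn.2 ⟨hb B hB, hb'.2.le⟩
      have hpn : γ p = γ n := by
        refine (hc hB).2.2.2 p hp.1.1 n hn.1.1 (hp.1.2.trans_lt (hb'.1.trans_le hn.1.2)) ?_
        refine eq_empty_of_forall_notMem fun e he => ?_
        rcases le_or_gt e a' with h1 | h1
        · exact absurd (hp.2 ⟨he.2, h1⟩) (not_le.2 he.1.1)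
        · rcases le_or_gt b' e with h2 | h2
          · exact absurd (hn.2 ⟨he.2, h2⟩) (not_le.2 he.1.2)
          · exact (hBe ▸ (⟨⟨h1.le, h2.le⟩, he.2⟩ : e ∈ Icc a' b' ∩ B) : e ∈ (∅ : Set I))
      have h1 : dist (γ a) (γ p) < ε / 2 := by
        refine hδε ((Real.dist_left_le_of_mem_uIcc ?_).trans_lt (Metric.mem_ball'.1 had))
        exact mem_uIcc.2 (Or.inl ⟨hap, hp.1.2⟩)
      have h2 : dist (γ n) (γ b) < ε / 2 := by
        refine hδε ((Real.dist_right_le_of_mem_uIcc ?_).trans_lt (Metric.mem_ball.1 hbd))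
        exact mem_uIcc.2 (Or.inl ⟨hn.1.2, hnb⟩)
      rw [hpn] at h1
      linarith [dist_triangle (γ a) (γ n) (γ b)]
  have hAS := hA.prop
  choose p hp using hmax A hAS
  choose n hn using hmin A hAS
  have hpn : ∀ t, γ (p t) = γ (n t) := by
    intro t
    rcases ((mem_Iic.1 (hp t).1.2).trans (mem_Ici.1 (hn t).1.2)).eq_or_lt with h | h
    · rw [h]
    · refine hAS.2.2.2 _ (hp t).1.1 _ (hn t).1.1 h ?_
      refine eq_empty_of_forall_notMem fun e he => ?_
      rcases le_total e t with h1 | h1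
      · exact absurd ((hp t).2 ⟨he.2, h1⟩) (not_le.2 he.1.1)
      · exact absurd ((hn t).2 ⟨he.2, h1⟩) (not_le.2 he.1.2)
  have hpm : Monotone p := fun s t hst => (hp t).2 ⟨(hp s).1.1, (hp s).1.2.trans hst⟩
  refine ⟨fun t => γ (p t), ?_, ?_, ?_, ?_, ?_⟩
  · have key : ∀ s t, s ≤ t →
        γ (p s) = γ (p t) ∨ ∃ u ∈ Icc s t, ∃ v ∈ Icc s t, γ (p s) = γ u ∧ γ (p t) = γ v := by
      intro s t hst
      by_cases h : s ≤ p t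
      · exact Or.inr ⟨n s, ⟨(hn s).1.2, ((hn s).2 ⟨(hp t).1.1, h⟩).trans (hp t).1.2⟩, p t,
          ⟨h, (hp t).1.2⟩, hpn s, rfl⟩
      · exact Or.inl (congrArg γ (le_antisymm (hpm hst) ((hp s).2 ⟨(hp t).1.1, (not_le.1 h).le⟩)))
    refine UniformContinuous.continuous (Metric.uniformContinuous_iff.2 fun ε hε => ?_)
    obtain ⟨δ, hδ, hδε⟩ := Metric.uniformContinuous_iff.1 huc ε hε
    refine ⟨δ, hδ, ?_⟩
    have main : ∀ s t, s ≤ t → dist s t < δ → dist (γ (p s)) (γ (p t)) < ε := by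
      intro s t hst hd
      rcases key s t hst with h | ⟨u, hu, v, hv, h1, h2⟩
      · rwa [h, dist_self]
      · rw [h1, h2]
        exact hδε ((Real.dist_le_of_mem_uIcc (mem_uIcc.2 (Or.inl hu))
          (mem_uIcc.2 (Or.inl hv))).trans_lt hd)
    intro s t hd
    rcases le_total s t with h | h
    · exact main s t h hd
    · rw [dist_comm]; exact main t s h (by rwa [dist_comm])
  · have : p 0 = 0 := le_antisymm (hp 0).1.2 unitInterval.nonneg'
    simp only [this]
  · have : p 1 = 1 := le_antisymm unitInterval.le_one' ((hp 1).2 ⟨hAS.2.2.1, self_mem_Iic⟩)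
    simp only [this]
  · rintro _ ⟨t, rfl⟩; exact ⟨_, rfl⟩
  · intro s t hst heq u hu
    have hA' : A \ Ioo (p s) (p t) ∈ 𝒮 := by
      refine ⟨hAS.1.sdiff isOpen_Ioo, ⟨hAS.2.1, fun h => not_lt.2 unitInterval.nonneg' h.1⟩,
        ⟨hAS.2.2.1, fun h => not_lt.2 unitInterval.le_one' h.2⟩, fun c hc d hd hcd hgap => ?_⟩
      by_cases hE : Ioo c d ∩ A = ∅
      · exact hAS.2.2.2 c hc.1 d hd.1 hcd hE
      · obtain ⟨e, he, heA⟩ := nonempty_iff_ne_empty.2 hE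
        have heI : e ∈ Ioo (p s) (p t) := by
          by_contra hne
          exact (hgap ▸ (⟨he, heA, hne⟩ : e ∈ Ioo c d ∩ (A \ Ioo (p s) (p t))) :
            e ∈ (∅ : Set I))
        have hcs : c = p s := by
          refine le_antisymm ?_ ?_
          · by_contra h
            exact hc.2 ⟨not_le.1 h, he.1.trans heI.2⟩
          · by_contra h
            exact (hgap ▸ (⟨⟨not_le.1 h, heI.1.trans he.2⟩, (hp s).1.1, fun h => lt_irrefl _ h.1⟩ :
              p s ∈ Ioo c d ∩ (A \ Ioo (p s) (p t))) : p s ∈ (∅ : Set I))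
        have hdt : d = p t := by
          refine le_antisymm ?_ ?_
          · by_contra h
            exact (hgap ▸ (⟨⟨he.1.trans heI.2, not_le.1 h⟩, (hp t).1.1, fun h => lt_irrefl _ h.2⟩ :
              p t ∈ Ioo c d ∩ (A \ Ioo (p s) (p t))) : p t ∈ (∅ : Set I))
          · by_contra h
            exact hd.2 ⟨heI.1.trans he.2, not_le.1 h⟩
        rw [hcs, hdt]; exact heq
    have hsub := hA.le_of_le hA' sdiff_subset
    have h1 : p u ∉ Ioo (p s) (p t) := (hsub (hp u).1.1).2
    rcases (hpm hu.1).eq_or_lt with h2 | h2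
    · simp only [h2]
    · rcases (hpm hu.2).eq_or_lt with h3 | h3
      · simp only [h3, heq]
      · exact absurd ⟨h2, h3⟩ h1

section Arc

variable {X : Type*} [MetricSpace X] [SecondCountableTopology X] [Nonempty X]

/-- The distance from a point of a dense sequence to an initial segment of a path. -/
noncomputable def initialDist (γ : C(I, X)) (k : ℕ) (t : I) : ℝ :=
  Metric.infDist (TopologicalSpace.denseSeq X k) (γ '' Iic t)

/-- A strictly monotone gauge of the size of the initial segments of a path, depending only on the
image of the segment. -/
noncomputable def pathGauge (γ : C(I, X)) (t : I) : ℝ :=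
  ∑' k : ℕ, (1 / 2 : ℝ) ^ k * (1 / (1 + initialDist γ k t))

lemma initialDist_nonneg (γ : C(I, X)) (k : ℕ) (t : I) : 0 ≤ initialDist γ k t :=
  Metric.infDist_nonneg

lemma initialDist_eq (γ : C(I, X)) (k : ℕ) (t : I) : initialDist γ k t =
    sInf ((fun s : I => dist (TopologicalSpace.denseSeq X k) (γ (s * t))) '' univ) := by
  have : γ '' Iic t = range fun s : I => γ (s * t) := by
    ext z
    constructor
    · rintro ⟨r, hr, rfl⟩
      rcases eq_or_lt_of_le (unitInterval.nonneg' (t := t)) with h | h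
      · have : r = 0 := le_antisymm (h ▸ hr) unitInterval.nonneg'
        exact ⟨0, by simp [this]⟩
      · have h' : (0 : ℝ) < t := h
        refine ⟨⟨r / t, div_nonneg r.2.1 h'.le, (div_le_one h').2 hr⟩, ?_⟩
        refine congrArg γ (Subtype.ext ?_)
        simp [h'.ne']
    · rintro ⟨s, rfl⟩
      exact ⟨s * t, mul_le_of_le_one_left unitInterval.nonneg' unitInterval.le_one', rfl⟩
  rw [initialDist, Metric.infDist_eq_iInf, this, image_univ, iInf]
  congr 1
  ext r
  simp

lemma continuous_initialDist (k : ℕ) :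
    Continuous fun p : C(I, X) × I => initialDist p.1 k p.2 := by
  simp only [initialDist_eq]
  refine isCompact_univ.continuous_sInf (f := fun (p : C(I, X) × I) (s : I) =>
    dist (TopologicalSpace.denseSeq X k) (p.1 (s * p.2))) ?_
  refine continuous_const.dist ?_
  exact (continuous_eval (F := C(I, X))).comp (by fun_prop :
    Continuous fun a : (C(I, X) × I) × I => (a.1.1, a.2 * a.1.2))

lemma initialDist_antitone (γ : C(I, X)) (k : ℕ) {s t : I} (h : s ≤ t) :
    initialDist γ k t ≤ initialDist γ k s :=
  Metric.infDist_le_infDist_of_subset (image_mono (Iic_subset_Iic.2 h)) ⟨_, s, self_mem_Iic, rfl⟩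

lemma gauge_term_le (γ : C(I, X)) (k : ℕ) (t : I) :
    ‖(1 / 2 : ℝ) ^ k * (1 / (1 + initialDist γ k t))‖ ≤ (1 / 2 : ℝ) ^ k := by
  have := initialDist_nonneg γ k t
  rw [Real.norm_of_nonneg (by positivity)]
  refine mul_le_of_le_one_right (by positivity) ?_
  rw [div_le_one (by linarith)]
  linarith

lemma continuous_gauge : Continuous fun p : C(I, X) × I => pathGauge p.1 p.2 := by
  refine continuous_tsum (fun k => ?_) summable_geometric_two fun k p => gauge_term_le p.1 k p.2
  refine continuous_const.mul (continuous_const.div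
    (continuous_const.add (continuous_initialDist k)) fun p => ?_)
  have := initialDist_nonneg p.1 k p.2
  positivity

lemma gauge_congr {α β : C(I, X)} {s t : I} (h : α '' Iic s = β '' Iic t) :
    pathGauge α s = pathGauge β t := by
  simp only [pathGauge, initialDist, h]

lemma image_subset_of_gauge_le {γ : C(I, X)} {s t : I} (hst : s ≤ t)
    (h : pathGauge γ t ≤ pathGauge γ s) :
    γ '' Iic t ⊆ γ '' Iic s := by
  have hle : ∀ k, (1 / 2 : ℝ) ^ k * (1 / (1 + initialDist γ k s)) ≤
      (1 / 2 : ℝ) ^ k * (1 / (1 + initialDist γ k t)) := fun k => by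
    have := initialDist_nonneg γ k t
    have := initialDist_antitone γ k hst
    gcongr
  have hsum : ∀ r, Summable fun k => (1 / 2 : ℝ) ^ k * (1 / (1 + initialDist γ k r)) := fun r =>
    Summable.of_norm_bounded summable_geometric_two fun k => gauge_term_le γ k r
  have heq : ∀ k, initialDist γ k s = initialDist γ k t := by
    intro k
    refine le_antisymm (not_lt.1 fun hlt => not_lt.2 h ?_) (initialDist_antitone γ k hst)
    refine Summable.tsum_lt_tsum hle (i := k) ?_ (hsum s) (hsum t)
    have := initialDist_nonneg γ k t
    gcongr
  have hcl : ∀ r, IsClosed (γ '' Iic r) := fun r =>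
    (isClosed_Iic.isCompact.image γ.continuous).isClosed
  have hne : ∀ r, (γ '' Iic r).Nonempty := fun r => ⟨_, r, self_mem_Iic, rfl⟩
  intro z hz
  rw [(hcl s).mem_iff_infDist_zero (hne s)]
  rw [(hcl t).mem_iff_infDist_zero (hne t)] at hz
  rw [← hz]
  exact congrFun ((TopologicalSpace.denseRange_denseSeq X).equalizer
    (Metric.continuous_infDist_pt _) (Metric.continuous_infDist_pt _) (funext heq)) z

/-- An injective path parametrised proportionally to its gauge. -/
def IsArc (γ : C(I, X)) : Prop :=
  Function.Injective γ ∧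
    ∀ t : I, pathGauge γ t - pathGauge γ 0 = t * (pathGauge γ 1 - pathGauge γ 0)

omit [SecondCountableTopology X] [Nonempty X] in
lemma image_Iic_one (γ : C(I, X)) : γ '' Iic 1 = range γ := by
  rw [← image_univ]; congr 1; exact eq_univ_of_forall fun _ => unitInterval.le_one'

omit [SecondCountableTopology X] [Nonempty X] in
lemma image_Iic_zero (γ : C(I, X)) : γ '' Iic 0 = {γ 0} := by
  have : Iic (0 : I) = {0} := by
    ext t; simp
  rw [this, image_singleton]

lemma gauge_lt_of_ne {γ : C(I, X)} (h : γ 0 ≠ γ 1) : pathGauge γ 0 < pathGauge γ 1 := by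
  by_contra hle
  have := image_subset_of_gauge_le (unitInterval.nonneg' (t := 1)) (not_lt.1 hle)
    ⟨1, self_mem_Iic, rfl⟩
  rw [image_Iic_zero] at this
  exact h this.symm

lemma IsArc.ne {γ : C(I, X)} (h : IsArc γ) {s t : I} (hst : s ≠ t) : γ s ≠ γ t :=
  fun h' => hst (h.1 h')

lemma IsArc.eq_of_range_eq {α β : C(I, X)} (hα : IsArc α) (hβ : IsArc β) (h0 : α 0 = β 0)
    (hr : range α = range β) : α = β := by
  have hex : ∀ t, ∃ s, α s = β t := fun t => (hr ▸ mem_range_self t : β t ∈ range α)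
  choose h hh using hex
  have hemb : IsEmbedding α := (α.continuous.isClosedEmbedding hα.1).isEmbedding
  have hc : Continuous h := by
    rw [hemb.continuous_iff]
    have : (α ∘ h) = β := funext hh
    rw [this]; exact β.continuous
  have hi : Function.Injective h := fun s t hst => hβ.1 (by rw [← hh, ← hh, hst])
  have hs : Function.Surjective h := fun s => by
    obtain ⟨t, ht⟩ := (hr ▸ mem_range_self s : α s ∈ range β)
    exact ⟨t, hα.1 (by rw [hh, ht])⟩
  have hh0 : h 0 = 0 := hα.1 (by rw [hh, h0])
  have hm : StrictMono h := by
    rcases hc.strictMono_of_inj hi with h' | h'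
    · exact h'
    · have : h 1 < h 0 := h' (by simp)
      rw [hh0] at this
      exact absurd this (not_lt.2 unitInterval.nonneg')
  have himg : ∀ t, α '' Iic (h t) = β '' Iic t := by
    intro t
    ext z
    constructor
    · rintro ⟨s, hs', rfl⟩
      obtain ⟨r, rfl⟩ := hs s
      exact ⟨r, hm.le_iff_le.1 hs', (hh r).symm⟩
    · rintro ⟨s, hs', rfl⟩
      exact ⟨h s, hm.monotone hs', hh s⟩
  have hg : ∀ t, pathGauge α (h t) = pathGauge β t := fun t => gauge_congr (himg t)
  have hg0 : pathGauge α 0 = pathGauge β 0 := by rw [← hg, hh0]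
  have hg1 : pathGauge α 1 = pathGauge β 1 := gauge_congr (by rw [image_Iic_one, image_Iic_one, hr])
  have hid : ∀ t, h t = t := by
    intro t
    have h1 := hα.2 (h t)
    have h2 := hβ.2 t
    rw [hg, hg0, hg1, h2] at h1
    have hne : pathGauge β 1 - pathGauge β 0 ≠ 0 :=
      (sub_pos.2 (gauge_lt_of_ne (hβ.ne zero_ne_one))).ne'
    exact Subtype.ext (mul_right_cancel₀ hne h1).symm
  ext t
  rw [← hh t, hid]

omit [SecondCountableTopology X] [Nonempty X] [MetricSpace X] in
lemma exists_normalization {e : I → ℝ} (he : Continuous e) (hm : Monotone e) (h : e 0 < e 1) :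
    ∃ l : I → I, Continuous l ∧ ∀ t, e t - e 0 = (l t : ℝ) * (e 1 - e 0) := by
  have hL : 0 < e 1 - e 0 := sub_pos.2 h
  refine ⟨fun t => ⟨(e t - e 0) / (e 1 - e 0),
    div_nonneg (sub_nonneg.2 (hm unitInterval.nonneg')) hL.le,
    (div_le_one hL).2 (sub_le_sub_right (hm unitInterval.le_one') _)⟩,
    ((he.sub continuous_const).div_const _).subtype_mk _, fun t => ?_⟩
  exact (div_mul_cancel₀ _ hL.ne').symm

lemma continuous_gauge_path (γ : C(I, X)) : Continuous fun t => pathGauge γ t := by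
  have h : Continuous fun t : I => (γ, t) := Continuous.prodMk_right γ
  have h' := Continuous.comp (continuous_gauge (X := X)) h
  exact h'

lemma exists_isArc_of_monotone {g : C(I, X)} (h01 : g 0 ≠ g 1)
    (hg : ∀ s t, s ≤ t → g s = g t → ∀ u ∈ Icc s t, g u = g s) :
    ∃ γ : C(I, X), IsArc γ ∧ γ 0 = g 0 ∧ γ 1 = g 1 ∧ range γ = range g := by
  have hL : 0 < pathGauge g 1 - pathGauge g 0 := sub_pos.2 (gauge_lt_of_ne h01)
  have hmono : ∀ s t : I, s ≤ t → pathGauge g s ≤ pathGauge g t := by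
    intro s t hst
    by_contra hlt
    have h1 := image_subset_of_gauge_le hst (not_le.1 hlt).le
    have h2 : g '' Iic s ⊆ g '' Iic t := image_mono (Iic_subset_Iic.2 hst)
    exact hlt (gauge_congr (h2.antisymm h1)).le
  obtain ⟨l, hlc, hl⟩ := exists_normalization (continuous_gauge_path g) (fun s t => hmono s t)
    (sub_pos.1 hL)
  have hl0 : l 0 = 0 := Subtype.ext (mul_right_cancel₀ hL.ne' (by rw [← hl]; simp))
  have hl1 : l 1 = 1 := Subtype.ext (mul_right_cancel₀ hL.ne' (by rw [← hl]; simp))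
  have hlm : Monotone l := fun s t hst => by
    refine Subtype.coe_le_coe.1 (le_of_mul_le_mul_right ?_ hL)
    rw [← hl, ← hl]
    exact sub_le_sub_right (hmono s t hst) _
  have hls : Function.Surjective l := fun y => by
    have := intermediate_value_univ 0 1 hlc
    rw [hl0, hl1] at this
    exact this ⟨unitInterval.nonneg', unitInterval.le_one'⟩
  have hliff : ∀ s t, l s = l t ↔ g s = g t := by
    have main : ∀ s t, s ≤ t → (l s = l t ↔ g s = g t) := by
      intro s t hst
      constructor
      · intro h
        have h1 : pathGauge g t = pathGauge g s := by
          have := (hl s).trans (h ▸ (hl t).symm)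
          linarith
        obtain ⟨u, hu, hut⟩ := image_subset_of_gauge_le hst h1.le ⟨t, self_mem_Iic, rfl⟩
        rw [← hut]
        exact hg u t (le_trans hu hst) hut s ⟨hu, hst⟩
      · intro h
        have h1 : g '' Iic t = g '' Iic s := by
          refine Subset.antisymm ?_ (image_mono (Iic_subset_Iic.2 hst))
          rintro _ ⟨u, hu, rfl⟩
          rcases le_total u s with h' | h'
          · exact ⟨u, h', rfl⟩
          · exact ⟨s, self_mem_Iic, (hg s t hst h u ⟨h', hu⟩).symm⟩
        have h2 := gauge_congr h1
        exact Subtype.ext (mul_right_cancel₀ hL.ne' (by rw [← hl, ← hl, h2]))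
    intro s t
    rcases le_total s t with h | h
    · exact main s t h
    · rw [eq_comm, main t s h, eq_comm]
  choose r hr using hls
  have hgr : ∀ t, g (r (l t)) = g t := fun t => (hliff _ _).1 (hr _)
  have hc : Continuous (g ∘ r) := by
    rw [(IsQuotientMap.of_surjective_continuous (fun y => ⟨r y, hr y⟩) hlc).continuous_iff]
    have : (g ∘ r) ∘ l = g := funext hgr
    rw [this]; exact g.continuous
  let γ : C(I, X) := ⟨g ∘ r, hc⟩
  have hγ : ∀ t, γ (l t) = g t := hgr
  have himg : ∀ t, γ '' Iic (l t) = g '' Iic t := by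
    intro t
    ext z
    constructor
    · rintro ⟨s, hs, rfl⟩
      have hs' : l (r s) ≤ l t := by rw [hr]; exact hs
      rcases le_total (r s) t with h | h
      · exact ⟨r s, h, rfl⟩
      · exact ⟨t, self_mem_Iic, ((hliff _ _).1 (le_antisymm hs' (hlm h))).symm⟩
    · rintro ⟨s, hs, rfl⟩
      exact ⟨l s, hlm hs, hγ s⟩
  have hgg : ∀ t, pathGauge γ (l t) = pathGauge g t := fun t => gauge_congr (himg t)
  have hγ0 : γ 0 = g 0 := (congrArg γ hl0).symm.trans (hγ 0)
  have hγ1 : γ 1 = g 1 := (congrArg γ hl1).symm.trans (hγ 1)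
  refine ⟨γ, ⟨?_, ?_⟩, hγ0, hγ1, ?_⟩
  · intro a b hab
    rw [← hr a, ← hr b]
    exact (hliff _ _).2 hab
  · intro t
    have h0 := hgg 0
    have h1 := hgg 1
    rw [hl0] at h0
    rw [hl1] at h1
    rw [← hr t, hgg, h0, h1, hl]
  · have h := himg 1
    rwa [hl1, image_Iic_one, image_Iic_one] at h

lemma exists_isArc {γ : I → X} (hγ : Continuous γ) (hne : γ 0 ≠ γ 1) :
    ∃ α : C(I, X), IsArc α ∧ α 0 = γ 0 ∧ α 1 = γ 1 ∧ range α ⊆ range γ := by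
  obtain ⟨g, hg, h0, h1, hr, hm⟩ := exists_monotone_path hγ
  obtain ⟨α, hα, hα0, hα1, hαr⟩ := exists_isArc_of_monotone (g := ⟨g, hg⟩)
    (by simpa [h0, h1] using hne) hm
  exact ⟨α, hα, hα0.trans h0, hα1.trans h1, hαr.trans_subset hr⟩

lemma exists_isArc_of_joinedIn {S : Set X} {x y : X} (h : JoinedIn S x y) (hne : x ≠ y) :
    ∃ α : C(I, X), IsArc α ∧ α 0 = x ∧ α 1 = y ∧ range α ⊆ S := by
  obtain ⟨p, hp⟩ := h
  obtain ⟨α, hα, h0, h1, hr⟩ := exists_isArc p.continuous (by simpa using hne)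
  refine ⟨α, hα, by simpa using h0, by simpa using h1, hr.trans ?_⟩
  rintro _ ⟨t, rfl⟩
  exact hp t

/-- The affine path between two parameters. -/
noncomputable def affineParam (a b : I) : C(I, I) where
  toFun t := ⟨(1 - t) * a + t * b, convex_Icc (0 : ℝ) 1 a.2 b.2 (by linarith [t.2.2]) t.2.1
    (by ring)⟩
  continuous_toFun := by fun_prop

lemma affineParam_apply (a b t : I) : (affineParam a b t : ℝ) = (1 - t) * a + t * b := rfl

lemma affineParam_zero (a b : I) : affineParam a b 0 = a :=
  Subtype.ext (by simp [affineParam_apply])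

lemma affineParam_one (a b : I) : affineParam a b 1 = b :=
  Subtype.ext (by simp [affineParam_apply])

lemma affineParam_injective {a b : I} (h : a ≠ b) : Function.Injective (affineParam a b) := by
  intro s t hst
  have := congrArg Subtype.val hst
  rw [affineParam_apply, affineParam_apply] at this
  have hne : (b : ℝ) - a ≠ 0 := sub_ne_zero.2 fun h' => h (Subtype.ext h'.symm)
  refine Subtype.ext (mul_right_cancel₀ hne ?_)
  linarith

lemma range_affineParam (a b : I) : range (affineParam a b) = uIcc a b := by
  refine Subset.antisymm ?_ ?_
  · rintro _ ⟨t, rfl⟩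
    rw [mem_uIcc]
    have h0 := t.2.1
    have h1 := t.2.2
    rcases le_total a b with h | h
    · have h' : (a : ℝ) ≤ b := h
      refine Or.inl ⟨?_, ?_⟩ <;> rw [← Subtype.coe_le_coe, affineParam_apply] <;> nlinarith
    · have h' : (b : ℝ) ≤ a := h
      refine Or.inr ⟨?_, ?_⟩ <;> rw [← Subtype.coe_le_coe, affineParam_apply] <;> nlinarith
  · have := intermediate_value_uIcc (a := 0) (b := 1)
      (affineParam a b).continuous.continuousOn
    rw [affineParam_zero, affineParam_one] at this
    exact this.trans (image_subset_range _ _)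

lemma exists_isArc_subarc {α : C(I, X)} (hα : Function.Injective α) {a b : I} (hab : a ≠ b) :
    ∃ γ : C(I, X), IsArc γ ∧ γ 0 = α a ∧ γ 1 = α b ∧ range γ = α '' uIcc a b := by
  let g : C(I, X) := α.comp (affineParam a b)
  have hg : Function.Injective g := hα.comp (affineParam_injective hab)
  obtain ⟨γ, h1, h2, h3, h4⟩ := exists_isArc_of_monotone (g := g)
    (hg.ne zero_ne_one) (fun s t hst h u hu => by
      have := hg h
      subst this
      rw [le_antisymm hu.2 hu.1])
  refine ⟨γ, h1, h2.trans ?_, h3.trans ?_, h4.trans ?_⟩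
  · simp [g, affineParam_zero]
  · simp [g, affineParam_one]
  · rw [← range_affineParam, ← range_comp]; rfl

end Arc

section Triod

variable {X : Type*} [MetricSpace X]

lemma exists_isTriodPoint_of_branch {α β : C(I, X)} (hα : Function.Injective α) {u v : I}
    (hu : β u ∉ range α) (hv : β v ∈ range α) (h0 : α 0 ∉ β '' uIcc u v)
    (h1 : α 1 ∉ β '' uIcc u v) : ∃ w ∈ uIcc u v, β w ∈ range α ∧ IsTriodPoint (β w) := by
  have hcl : IsClosed (range α) := (isCompact_range α.continuous).isClosed
  have hb : Continuous fun t => β (affineParam u v t) := by fun_prop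
  obtain ⟨τ, hτ, hmin⟩ := exists_first_hit hb hcl ⟨1, by rwa [affineParam_one]⟩
  have hmem : ∀ t, affineParam u v t ∈ uIcc u v := fun t =>
    range_affineParam u v ▸ mem_range_self t
  obtain ⟨s, hs⟩ := id hτ
  have hs0 : 0 < s := by
    refine lt_of_le_of_ne unitInterval.nonneg' fun h => h0 ⟨_, hmem τ, ?_⟩
    rw [← hs, h]
  have hs1 : s < 1 := by
    refine lt_of_le_of_ne unitInterval.le_one' fun h => h1 ⟨_, hmem τ, ?_⟩
    rw [← hs, h]
  refine ⟨_, hmem τ, hτ, ![α '' Icc 0 s, α '' Icc s 1,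
    (fun t => β (affineParam u v t)) '' Icc 0 τ], ![α 0, α 1, β u], ?_, ?_⟩
  · intro i
    fin_cases i
    · refine ⟨fun h => hs0.ne (hα (h.trans hs.symm)), ?_⟩
      rw [← hs]
      refine joinedIn_of_continuous α.continuous s 0 fun t ht => ⟨t, ?_, rfl⟩
      rwa [uIcc_of_ge hs0.le] at ht
    · refine ⟨fun h => hs1.ne' (hα (h.trans hs.symm)), ?_⟩
      rw [← hs]
      refine joinedIn_of_continuous α.continuous s 1 fun t ht => ⟨t, ?_, rfl⟩
      rwa [uIcc_of_le hs1.le] at ht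
    · refine ⟨fun h => hu ?_, ?_⟩
      · change β u = _ at h
        rw [h]; exact hτ
      · have := joinedIn_of_continuous (F := (fun t => β (affineParam u v t)) '' Icc 0 τ) hb τ 0
          fun t ht => ⟨t, by rwa [uIcc_of_ge unitInterval.nonneg'] at ht, rfl⟩
        simp only [affineParam_zero] at this
        exact this
  · have h01 : α '' Icc 0 s ∩ α '' Icc s 1 ⊆ {α s} := by
      rintro _ ⟨⟨a, ha, rfl⟩, b, hb, hab⟩
      have := hα hab
      subst this
      exact congrArg α (le_antisymm ha.2 hb.1)
    have h2 : range α ∩ (fun t => β (affineParam u v t)) '' Icc 0 τ ⊆ {α s} := by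
      rintro _ ⟨ha, b, hb, rfl⟩
      rcases hb.2.eq_or_lt with h | h
      · rw [h]; exact hs.symm
      · exact absurd ha (hmin b h)
    have hsub : ∀ a b, α '' Icc a b ⊆ range α := fun a b => image_subset_range _ _
    rw [← hs]
    intro i j hij
    fin_cases i <;> fin_cases j <;> first | exact absurd rfl hij | skip
    · exact h01
    · exact (inter_subset_inter_left _ (hsub _ _)).trans h2
    · exact (inter_comm _ _).trans_subset h01
    · exact (inter_subset_inter_left _ (hsub _ _)).trans h2
    · exact (inter_comm _ _).trans_subset ((inter_subset_inter_left _ (hsub _ _)).trans h2)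
    · exact (inter_comm _ _).trans_subset ((inter_subset_inter_left _ (hsub _ _)).trans h2)

variable [SecondCountableTopology X] [Nonempty X] {P F : Set X} {x : X}

/-- The arcs from `x` to a first point of `F`, which avoid `P` before reaching `F`. -/
def firstHitArcs (P : Set X) (x : X) (F : Set X) : Set C(I, X) :=
  {γ | IsArc γ ∧ γ 0 = x ∧ (∀ t < 1, γ t ∉ F) ∧ γ 1 ∈ F ∧ ∀ t < 1, γ t ∉ P}

lemma firstHitArcs_inter (hP : ∀ y : X, IsTriodPoint y → y ∈ P) {α β : C(I, X)}
    (hα : α ∈ firstHitArcs P x F) (hβ : β ∈ firstHitArcs P x F) (hne : α ≠ β) {s t : I}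
    (hst : α s = β t) : s = 0 ∧ t = 0 ∨ s = 1 ∧ t = 1 := by
  have key : ∀ α ∈ firstHitArcs P x F, ∀ β ∈ firstHitArcs P x F, ∀ u, β u ∉ range α →
      ∀ s t, α s = β t → s = 0 ∧ t = 0 ∨ s = 1 ∧ t = 1 := by
    intro α hα β hβ u hu s t hst
    obtain ⟨hα1, hα2, hα3, hα4, hα5⟩ := hα
    obtain ⟨hβ1, hβ2, hβ3, hβ4, hβ5⟩ := hβ
    rcases (unitInterval.nonneg' (t := t)).eq_or_lt with h0 | h0
    · left
      refine ⟨hα1.1 ?_, h0.symm⟩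
      rw [hst, ← h0, hα2, hβ2]
    rcases (unitInterval.le_one' (t := t)).eq_or_lt with h1 | h1
    · right
      refine ⟨?_, h1⟩
      by_contra hs
      refine hα3 s (lt_of_le_of_ne unitInterval.le_one' hs) ?_
      rw [hst, h1]; exact hβ4
    exfalso
    have hu0 : 0 < u := lt_of_le_of_ne unitInterval.nonneg' fun h =>
      hu ⟨0, by rw [← h, hα2, hβ2]⟩
    have hlt : ∀ w ∈ uIcc u t, β w ∈ range α → 0 < w ∧ w < 1 := by
      intro w hw hwα
      have hwu : w ≠ u := fun h => hu (h ▸ hwα)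
      rcases mem_uIcc.1 hw with h | h
      · exact ⟨hu0.trans_le h.1, h.2.trans_lt h1⟩
      · exact ⟨h0.trans_le h.1, (lt_of_le_of_ne h.2 hwu).trans_le unitInterval.le_one'⟩
    obtain ⟨w, hw, hwα, htri⟩ := exists_isTriodPoint_of_branch (β := β) hα1.1 hu ⟨s, hst⟩
      (by
        rintro ⟨w, hw, hwα⟩
        have h := hlt w hw ⟨0, hwα.symm⟩
        exact h.1.ne (hβ1.1 (by rw [hwα, hα2, hβ2])))
      (by
        rintro ⟨w, hw, hwα⟩
        have h := hlt w hw ⟨1, hwα.symm⟩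
        exact hβ3 w h.2 (hwα ▸ hα4))
    exact hβ5 w (hlt w hw hwα).2 (hP _ htri)
  by_cases h1 : ∃ u, β u ∉ range α
  · obtain ⟨u, hu⟩ := h1
    exact key α hα β hβ u hu s t hst
  by_cases h2 : ∃ u, α u ∉ range β
  · obtain ⟨u, hu⟩ := h2
    simpa only [and_comm] using key β hβ α hα u hu t s hst.symm
  push Not at h1 h2
  refine absurd (hα.1.eq_of_range_eq hβ.1 (by rw [hα.2.1, hβ.2.1]) ?_) hne
  exact Subset.antisymm (range_subset_iff.2 h2) (range_subset_iff.2 h1)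

lemma eq_or_eq_of_mem_firstHitArcs (hP : ∀ y : X, IsTriodPoint y → y ∈ P) {α β γ : C(I, X)}
    (hα : α ∈ firstHitArcs P x F) (hβ : β ∈ firstHitArcs P x F) (hγ : γ ∈ firstHitArcs P x F)
    (hne : α ≠ β) : γ = α ∨ γ = β := by
  by_contra! hcon
  let h : I := ⟨1 / 2, by norm_num, by norm_num⟩
  have hh : 0 < h := by rw [← Subtype.coe_lt_coe]; norm_num [h]
  have hh1 : h < 1 := by rw [← Subtype.coe_lt_coe]; norm_num [h]
  have hinter : ∀ α ∈ firstHitArcs P x F, ∀ β ∈ firstHitArcs P x F, α ≠ β →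
      α '' Icc 0 h ∩ β '' Icc 0 h ⊆ {x} := by
    rintro α hα β hβ hne _ ⟨⟨a, ha, rfl⟩, b, hb, hab⟩
    rcases firstHitArcs_inter hP hα hβ hne hab.symm with h' | h'
    · rw [h'.1, hα.2.1]; rfl
    · exact absurd (h'.1 ▸ ha.2) (not_le.2 hh1)
  have hx : x ∉ P := hα.2.1 ▸ hα.2.2.2.2 0 (by simp)
  refine hx (hP x ⟨![α '' Icc 0 h, β '' Icc 0 h, γ '' Icc 0 h], ![α h, β h, γ h], ?_, ?_⟩)
  · have hleg : ∀ α ∈ firstHitArcs P x F, α h ≠ x ∧ JoinedIn (α '' Icc 0 h) x (α h) := by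
      intro α hα
      refine ⟨fun h' => hh.ne' (hα.1.1 (h'.trans hα.2.1.symm)), ?_⟩
      rw [← hα.2.1]
      refine joinedIn_of_continuous α.continuous 0 h fun t ht => ⟨t, ?_, rfl⟩
      rwa [uIcc_of_le hh.le] at ht
    intro i
    fin_cases i
    exacts [hleg α hα, hleg β hβ, hleg γ hγ]
  · intro i j hij
    fin_cases i <;> fin_cases j <;> first | exact absurd rfl hij | skip
    exacts [hinter α hα β hβ hne, hinter α hα γ hγ hcon.1.symm, hinter β hβ α hα hne.symm,
      hinter β hβ γ hγ hcon.2.symm, hinter γ hγ α hα hcon.1, hinter γ hγ β hβ hcon.2]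

lemma finite_firstHitArcs (hP : ∀ y : X, IsTriodPoint y → y ∈ P) (x : X) (F : Set X) :
    (firstHitArcs P x F).Finite := by
  by_cases h : ∃ α ∈ firstHitArcs P x F, ∃ β ∈ firstHitArcs P x F, α ≠ β
  · obtain ⟨α, hα, β, hβ, hne⟩ := h
    exact (Set.toFinite {α, β}).subset fun γ hγ => eq_or_eq_of_mem_firstHitArcs hP hα hβ hγ hne
  · push Not at h
    exact Set.Subsingleton.finite fun α hα β hβ => h α hα β hβ

lemma exists_firstHitArc {S : Set X} {y : X} {F : Set X} (hS : ∀ γ : C(I, X), range γ ⊆ S →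
    IsClosed (γ ⁻¹' F)) (h : JoinedIn S x y) (hy : y ∈ F) (hx : x ∉ F) :
    ∃ γ : C(I, X), IsArc γ ∧ γ 0 = x ∧ (∀ t < 1, γ t ∉ F) ∧ γ 1 ∈ F ∧ range γ ⊆ S := by
  obtain ⟨α, hα, h0, h1, hr⟩ := exists_isArc_of_joinedIn h fun h => hx (h ▸ hy)
  obtain ⟨t, ht, hmin⟩ := (hS α hr).isCompact.exists_isLeast ⟨1, by rw [mem_preimage, h1]; exact hy⟩
  have ht0 : 0 ≠ t := by
    rintro rfl
    exact hx (h0 ▸ ht)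
  obtain ⟨γ, hγ, hγ0, hγ1, hγr⟩ := exists_isArc_subarc hα.1 ht0
  refine ⟨γ, hγ, hγ0.trans h0, fun s hs hsF => ?_, hγ1 ▸ ht, hγr.trans_subset
    ((image_subset_range _ _).trans hr)⟩
  obtain ⟨r, hr, hrs⟩ := hγr.subset (mem_range_self s)
  rw [uIcc_of_le unitInterval.nonneg'] at hr
  have : r = t := le_antisymm hr.2 (hmin (hrs ▸ hsF : α r ∈ F))
  rw [this, ← hγ1] at hrs
  exact hs.ne (hγ.1 hrs.symm)

end Triod

section Measurable

variable {X : Type*} [MetricSpace X] [CompleteSpace X] [SecondCountableTopology X] [Nonempty X]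
  [MeasurableSpace X] [BorelSpace X]

instance : MeasurableSpace C(I, X) := borel _

instance : BorelSpace C(I, X) := ⟨rfl⟩

omit [CompleteSpace X] [SecondCountableTopology X] [Nonempty X] in
lemma measurable_eval_path (t : I) : Measurable fun γ : C(I, X) => γ t :=
  (continuous_eval_const t).measurable

omit [CompleteSpace X] [SecondCountableTopology X] [Nonempty X] in
lemma measurable_eval : Measurable fun p : C(I, X) × I => p.1 p.2 :=
  (continuous_eval (F := C(I, X))).measurable

lemma measurableSet_forall_notMem {Y : Type*} [MeasurableSpace Y] [StandardBorelSpace Y]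
    {W : Set (Y × I)} (hW : MeasurableSet W)
    (hc : ∀ γ, IsClosed {t | (γ, t) ∈ W}) {J : Set I} (hJ : IsOpen J) :
    MeasurableSet {γ | ∀ t ∈ J, (γ, t) ∉ W} := by
  obtain ⟨K, hK, -, hKJ, -⟩ := hJ.exists_iUnion_isClosed
  have : {γ | ∀ t ∈ J, (γ, t) ∉ W} = (⋃ n, {γ | ∃ t, (γ, t) ∈ W ∩ Prod.snd ⁻¹' K n})ᶜ := by
    ext γ
    simp only [← hKJ, mem_ofPred_eq, mem_compl_iff, mem_iUnion, mem_inter_iff, mem_preimage]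
    push Not
    exact ⟨fun h n t ht htK => h t ⟨n, htK⟩ ht, fun h t ⟨n, hn⟩ ht => h n t ht hn⟩
  rw [this]
  refine (MeasurableSet.iUnion fun n => measurableSet_proj_of_isClosed
    (hW.inter (measurable_snd (hK n).measurableSet)) fun γ => ?_).compl
  exact (hc γ).inter (hK n)

omit [MeasurableSpace X] [BorelSpace X] in
lemma measurableSet_isArc : MeasurableSet {γ : C(I, X) | IsArc γ} := by
  have h1 : MeasurableSet {γ : C(I, X) | Function.Injective γ} := by
    have : {γ : C(I, X) | Function.Injective γ} = (⋃ n : ℕ, {γ | ∃ p : I × I, (γ, p) ∈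
        {q : C(I, X) × (I × I) | q.1 q.2.1 = q.1 q.2.2} ∩
        Prod.snd ⁻¹' {p : I × I | (1 : ℝ) / (n + 1) ≤ dist p.1 p.2}})ᶜ := by
      ext γ
      simp only [mem_ofPred_eq, mem_compl_iff, mem_iUnion, mem_inter_iff, mem_preimage, not_exists,
        not_and, not_le, Prod.forall]
      constructor
      · intro h n s t hst
        rw [h hst, dist_self]
        positivity
      · intro h s t hst
        by_contra hne
        obtain ⟨n, hn⟩ := exists_nat_one_div_lt (dist_pos.2 hne)
        exact absurd (h n s t hst) (not_lt.2 hn.le)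
    rw [this]
    have hcl : IsClosed {q : C(I, X) × (I × I) | q.1 q.2.1 = q.1 q.2.2} := by
      refine isClosed_eq ?_ ?_
      · exact (continuous_eval (F := C(I, X))).comp (by fun_prop :
          Continuous fun q : C(I, X) × (I × I) => (q.1, q.2.1))
      · exact (continuous_eval (F := C(I, X))).comp (by fun_prop :
          Continuous fun q : C(I, X) × (I × I) => (q.1, q.2.2))
    have hcl2 : ∀ n : ℕ, IsClosed {p : I × I | (1 : ℝ) / (n + 1) ≤ dist p.1 p.2} := fun n =>
      isClosed_le continuous_const continuous_dist
    refine (MeasurableSet.iUnion fun n => measurableSet_proj_of_isClosed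
      (hcl.inter ((hcl2 n).preimage continuous_snd)).measurableSet fun γ => ?_).compl
    exact (hcl.inter ((hcl2 n).preimage continuous_snd)).preimage (Continuous.prodMk_right γ)
  have h2 : MeasurableSet {γ : C(I, X) | ∀ t : I,
      pathGauge γ t - pathGauge γ 0 = t * (pathGauge γ 1 - pathGauge γ 0)} := by
    have hg : ∀ t : I, Continuous fun γ : C(I, X) => pathGauge γ t := fun t => by
      have h : Continuous fun γ : C(I, X) => (γ, t) := Continuous.prodMk_left t
      have h' := Continuous.comp (continuous_gauge (X := X)) h
      exact h'
    have : {γ : C(I, X) | ∀ t : I,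
      pathGauge γ t - pathGauge γ 0 = t * (pathGauge γ 1 - pathGauge γ 0)} = ⋂ t : I, {γ |
      pathGauge γ t - pathGauge γ 0 = t * (pathGauge γ 1 - pathGauge γ 0)} := by
      ext; simp
    rw [this]
    exact (isClosed_iInter fun t => isClosed_eq ((hg t).sub (hg 0))
      (continuous_const.mul ((hg 1).sub (hg 0)))).measurableSet
  exact h1.inter h2

end Measurable

section Reach

variable {X : Type*} [MetricSpace X] {κ : ℕ → X}

lemma isClosed_preimage_reachable {γ : I → X} (hγ : Continuous γ) :
    IsClosed (γ ⁻¹' reachable κ) := by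
  refine isClosed_of_closure_subset fun t ht U hU => ?_
  have hV : γ ⁻¹' interior U ∈ 𝓝 t := (isOpen_interior.preimage hγ).mem_nhds
    (mem_interior_iff_mem_nhds.2 hU)
  obtain ⟨δ, hδ, hδU⟩ := Metric.mem_nhds_iff.1 hV
  obtain ⟨s, hs, hst⟩ := Metric.mem_closure_iff.1 ht δ hδ
  obtain ⟨i, hi⟩ := hs _ (isOpen_interior.mem_nhds (hδU (Metric.mem_ball'.2 hst)))
  refine ⟨i, JoinedIn.trans ?_ (hi.mono interior_subset)⟩
  refine joinedIn_of_continuous hγ t s fun r hr => interior_subset (hδU ?_)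
  exact Metric.mem_ball'.2 ((Real.dist_left_le_of_mem_uIcc (by
    rw [mem_uIcc] at hr ⊢; exact hr : (r : ℝ) ∈ uIcc (t : ℝ) s)).trans_lt hst)

lemma exists_joined_of_mem_reachable {x : X} (hx : x ∈ reachable κ) : ∃ i, Joined x (κ i) := by
  obtain ⟨i, hi⟩ := hx univ univ_mem
  exact ⟨i, hi.joined⟩

variable [CompleteSpace X] [SecondCountableTopology X] [Nonempty X] [MeasurableSpace X]
  [BorelSpace X]

omit [Nonempty X] in
lemma measurableSet_firstHit {P : Set X} (hP : MeasurableSet P)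
    (hPc : ∀ γ : C(I, X), IsClosed (γ ⁻¹' P)) :
    MeasurableSet {γ : C(I, X) | ∀ t < 1, γ t ∉ P} :=
  measurableSet_forall_notMem (W := {p : C(I, X) × I | p.1 p.2 ∈ P}) (measurable_eval hP) hPc
    isOpen_Iio

lemma measurableSet_joined_seq (hκ : ∀ x : X, IsTriodPoint x → x ∈ reachable κ) (m : ℕ) :
    MeasurableSet {x | Joined x (κ m)} := by
  have hP : MeasurableSet (reachable κ) := measurableSet_reachable
  have hA := measurableSet_reachable_inter_joined (κ := κ) m
  have hPc : ∀ γ : C(I, X), IsClosed (γ ⁻¹' reachable κ) := fun γ =>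
    isClosed_preimage_reachable γ.continuous
  let W : Set (X × C(I, X)) := {p | (IsArc p.2 ∧ (∀ t < 1, p.2 t ∉ reachable κ)) ∧
    p.2 0 = p.1 ∧ p.2 1 ∈ reachable κ ∩ {x | Joined x (κ m)}}
  have hW : MeasurableSet W := by
    refine (measurable_snd (measurableSet_isArc.inter (measurableSet_firstHit hP hPc))).inter
      ((measurableSet_eq_fun ((measurable_eval_path 0).comp measurable_snd) measurable_fst).inter
        (((measurable_eval_path 1).comp measurable_snd) hA))
  have hfin : ∀ x, {γ | (x, γ) ∈ W}.Finite := fun x =>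
    (finite_firstHitArcs hκ x (reachable κ)).subset fun γ hγ =>
      ⟨hγ.1.1, hγ.2.1, hγ.1.2, hγ.2.2.1, hγ.1.2⟩
  have : {x | Joined x (κ m)} =
      (reachable κ ∩ {x | Joined x (κ m)}) ∪ {x | ∃ γ, (x, γ) ∈ W} := by
    ext x
    constructor
    · intro hx
      by_cases hxP : x ∈ reachable κ
      · exact Or.inl ⟨hxP, hx⟩
      obtain ⟨γ, hγ, h0, hlt, h1, -⟩ := exists_firstHitArc (S := univ) (F := reachable κ)
        (fun γ _ => hPc γ) (joinedIn_univ.2 hx) (range_subset_reachable m) hxP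
      refine Or.inr ⟨γ, ⟨hγ, hlt⟩, h0, h1, ?_⟩
      have : Joined x (γ 1) := ⟨⟨γ, h0, rfl⟩⟩
      exact this.symm.trans hx
    · rintro (h | ⟨γ, -, h0, h1⟩)
      · exact h.2
      · have : Joined x (γ 1) := ⟨⟨γ, h0, rfl⟩⟩
        exact this.trans h1.2
  rw [this]
  exact hA.union (measurableSet_proj_of_finite hW hfin)

end Reach

section Least

/-- The least index satisfying a predicate, and `0` if there is none. -/
noncomputable def leastIndex (Q : ℕ → Prop) : ℕ := by
  classical
  exact Nat.find (p := fun i => Q i ∨ ∀ j, ¬Q j) (by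
    by_cases h : ∃ i, Q i
    · exact h.imp fun i => Or.inl
    · exact ⟨0, Or.inr (not_exists.1 h)⟩)

lemma leastIndex_spec {Q : ℕ → Prop} (h : ∃ i, Q i) : Q (leastIndex Q) := by
  classical
  have := Nat.find_spec (p := fun i => Q i ∨ ∀ j, ¬Q j) (h.imp fun i => Or.inl)
  exact this.resolve_right (not_forall_not.2 h)

lemma leastIndex_eq_zero {Q : ℕ → Prop} (h : ∀ i, ¬Q i) : leastIndex Q = 0 := by
  classical
  rw [leastIndex, Nat.find_eq_zero]
  exact Or.inr h

lemma measurable_leastIndex {X : Type*} [MeasurableSpace X] {Q : X → ℕ → Prop}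
    (hQ : ∀ i, MeasurableSet {x | Q x i}) : Measurable fun x => leastIndex (Q x) := by
  classical
  refine measurable_find _ fun k => ?_
  refine (hQ k).union ?_
  have : {x | ∀ j, ¬Q x j} = ⋂ j, {x | Q x j}ᶜ := by ext; simp
  exact (congrArg MeasurableSet this).mpr (MeasurableSet.iInter fun j =>
    (hQ j).compl : MeasurableSet (⋂ j, {x | Q x j}ᶜ))

end Least

section Invariant

variable {X : Type*} [MetricSpace X] [CompleteSpace X] [SecondCountableTopology X] [Nonempty X]
  [MeasurableSpace X] [BorelSpace X] {P M : Set X}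

/-- A measurable union of path components avoiding a set `P` which contains all triod points. -/
structure IsTame (P M : Set X) : Prop where
  triod : ∀ x : X, IsTriodPoint x → x ∈ P
  measurable : MeasurableSet M
  joined : ∀ x y, Joined x y → x ∈ M → y ∈ M
  disjoint : ∀ x ∈ M, x ∉ P

namespace IsTame

variable (hM : IsTame P M)

include hM

omit [CompleteSpace X] [SecondCountableTopology X] [Nonempty X] [BorelSpace X] in
lemma path_mem {γ : C(I, X)} (h : γ 0 ∈ M) (t : I) : γ t ∈ M := by
  refine hM.joined _ _ ?_ h
  exact (joinedIn_of_continuous (F := univ) γ.continuous 0 t fun _ _ => trivial).joined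

omit [CompleteSpace X] [BorelSpace X] in
lemma mem_firstHitArcs {γ : C(I, X)} (hγ : IsArc γ) (h0 : γ 0 ∈ M) {F : Set X}
    (hF : ∀ t < 1, γ t ∉ F) (h1 : γ 1 ∈ F) : γ ∈ firstHitArcs P (γ 0) F :=
  ⟨hγ, rfl, hF, h1, fun t _ => hM.disjoint _ (hM.path_mem h0 t)⟩

omit [BorelSpace X] in
lemma measurableSet_exists_arc {Y : Type*} [MeasurableSpace Y] [StandardBorelSpace Y]
    {W : Set (Y × C(I, X))} (hW : MeasurableSet W) (f : Y → X) (F : Y → Set X)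
    (h : ∀ y γ, (y, γ) ∈ W → IsArc γ ∧ γ 0 = f y ∧ f y ∈ M ∧ (∀ t < 1, γ t ∉ F y) ∧ γ 1 ∈ F y) :
    MeasurableSet {y | ∃ γ, (y, γ) ∈ W} := by
  refine measurableSet_proj_of_finite hW fun y =>
    (finite_firstHitArcs hM.triod (f y) (F y)).subset fun γ hγ => ?_
  obtain ⟨h1, h2, h3, h4, h5⟩ := h y γ hγ
  rw [← h2]
  exact hM.mem_firstHitArcs h1 (h2 ▸ h3) h4 h5

lemma measurableSet_arc_endpoints {G : Set C(I, X)} (hG : MeasurableSet G)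
    (h : ∀ γ ∈ G, IsArc γ ∧ γ 0 ∈ M) :
    MeasurableSet {p : X × X | ∃ γ ∈ G, γ 0 = p.1 ∧ γ 1 = p.2} := by
  have hW : MeasurableSet {q : (X × X) × C(I, X) | q.2 ∈ G ∧ q.2 0 = q.1.1 ∧ q.2 1 = q.1.2} :=
    (measurable_snd hG).inter ((measurableSet_eq_fun
      ((measurable_eval_path 0).comp measurable_snd) (measurable_fst.comp measurable_fst)).inter
      (measurableSet_eq_fun ((measurable_eval_path 1).comp measurable_snd)
        (measurable_snd.comp measurable_fst)))
  refine hM.measurableSet_exists_arc hW Prod.fst (fun p => {p.2}) ?_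
  rintro ⟨x, y⟩ γ ⟨hγ, h0, h1⟩
  dsimp only at h0 h1
  refine ⟨(h γ hγ).1, h0, h0 ▸ (h γ hγ).2, fun t ht h' => ?_, h1⟩
  exact ht.ne ((h γ hγ).1.1 (h'.trans h1.symm))

lemma measurableSet_hit {F : Set X} (hF : IsClosed F) :
    MeasurableSet {x | x ∈ M ∧ ∃ y ∈ F, Joined x y} := by
  have hc : ∀ γ : C(I, X), IsClosed (γ ⁻¹' F) := fun γ => hF.preimage γ.continuous
  have hW : MeasurableSet {q : X × C(I, X) | (IsArc q.2 ∧ (∀ t < 1, q.2 t ∉ F)) ∧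
      q.2 0 = q.1 ∧ q.1 ∈ M ∧ q.2 1 ∈ F} :=
    (measurable_snd (measurableSet_isArc.inter (measurableSet_firstHit hF.measurableSet hc))).inter
      ((measurableSet_eq_fun ((measurable_eval_path 0).comp measurable_snd) measurable_fst).inter
        ((measurable_fst hM.measurable).inter
          ((measurable_eval_path 1).comp measurable_snd hF.measurableSet)))
  have := hM.measurableSet_exists_arc hW id (fun _ => F) fun y γ h =>
    ⟨h.1.1, h.2.1, h.2.2.1, h.1.2, h.2.2.2⟩
  convert (hM.measurable.inter hF.measurableSet).union this using 1
  ext x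
  constructor
  · rintro ⟨hx, y, hy, hxy⟩
    by_cases hxF : x ∈ F
    · exact Or.inl ⟨hx, hxF⟩
    · obtain ⟨γ, hγ, h0, hlt, h1, -⟩ := exists_firstHitArc (S := univ) (F := F)
        (fun γ _ => hc γ) (joinedIn_univ.2 hxy) hy hxF
      exact Or.inr ⟨γ, ⟨hγ, hlt⟩, h0, hx, h1⟩
  · rintro (h | ⟨γ, -, h0, hx, h1⟩)
    · exact ⟨h.1, x, h.2, Joined.refl x⟩
    · exact ⟨hx, _, h1, ⟨⟨γ, h0, rfl⟩⟩⟩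

end IsTame

/-- The path component of `x` lies in `M` and meets the ball of radius `2⁻ⁿ` around the `i`-th
point of a dense sequence. -/
def HitsBall (M : Set X) (n i : ℕ) (x : X) : Prop :=
  x ∈ M ∧ ∃ y ∈ Metric.closedBall (TopologicalSpace.denseSeq X i) ((1 / 2 : ℝ) ^ n), Joined x y

/-- Indices of balls shrinking to a point in the closure of a path component. -/
noncomputable def ballIndex (M : Set X) : ℕ → X → ℕ
  | 0, x => leastIndex fun i => HitsBall M 0 i x
  | n + 1, x => leastIndex fun i => HitsBall M (n + 1) i x ∧
      dist (TopologicalSpace.denseSeq X (ballIndex M n x)) (TopologicalSpace.denseSeq X i) ≤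
        2 * (1 / 2 : ℝ) ^ n

omit [CompleteSpace X] [MeasurableSpace X] [BorelSpace X] in
lemma exists_dist_denseSeq_lt (y : X) {ε : ℝ} (hε : 0 < ε) :
    ∃ i, dist y (TopologicalSpace.denseSeq X i) < ε :=
  (TopologicalSpace.denseRange_denseSeq X).exists_dist_lt y hε

omit [CompleteSpace X] [MeasurableSpace X] [BorelSpace X] in
lemma HitsBall.succ {x : X} {n : ℕ} (h : HitsBall M n (ballIndex M n x) x) :
    HitsBall M (n + 1) (ballIndex M (n + 1) x) x ∧
      dist (TopologicalSpace.denseSeq X (ballIndex M n x))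
        (TopologicalSpace.denseSeq X (ballIndex M (n + 1) x)) ≤ 2 * (1 / 2 : ℝ) ^ n := by
  obtain ⟨hx, y, hy, hxy⟩ := h
  obtain ⟨i, hi⟩ := exists_dist_denseSeq_lt y (by positivity : (0 : ℝ) < (1 / 2 : ℝ) ^ (n + 1))
  refine leastIndex_spec (Q := fun i => HitsBall M (n + 1) i x ∧
    dist (TopologicalSpace.denseSeq X (ballIndex M n x)) (TopologicalSpace.denseSeq X i) ≤
      2 * (1 / 2 : ℝ) ^ n) ⟨i, ⟨hx, y, Metric.mem_closedBall.2 hi.le, hxy⟩, ?_⟩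
  have := dist_triangle_left (TopologicalSpace.denseSeq X (ballIndex M n x))
    (TopologicalSpace.denseSeq X i) y
  rw [Metric.mem_closedBall] at hy
  have h2 : (1 / 2 : ℝ) ^ (n + 1) ≤ (1 / 2 : ℝ) ^ n :=
    pow_le_pow_of_le_one (by norm_num) (by norm_num) n.le_succ
  linarith

omit [CompleteSpace X] [MeasurableSpace X] [BorelSpace X] in
lemma hitsBall_ballIndex {x : X} (hx : x ∈ M) (n : ℕ) : HitsBall M n (ballIndex M n x) x := by
  induction n with
  | zero =>
    obtain ⟨i, hi⟩ := exists_dist_denseSeq_lt x one_pos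
    exact leastIndex_spec (Q := fun i => HitsBall M 0 i x)
      ⟨i, hx, x, by simpa using hi.le, Joined.refl x⟩
  | succ n ih => exact ih.succ.1

omit [CompleteSpace X] [MeasurableSpace X] [BorelSpace X] in
lemma dist_ballIndex_succ (n : ℕ) (x : X) :
    dist (TopologicalSpace.denseSeq X (ballIndex M n x))
      (TopologicalSpace.denseSeq X (ballIndex M (n + 1) x)) ≤ 2 * (1 / 2 : ℝ) ^ n := by
  by_cases hx : x ∈ M
  · exact (hitsBall_ballIndex hx n).succ.2
  · have h : ∀ n, ballIndex M n x = 0 := by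
      intro n
      cases n with
      | zero => exact leastIndex_eq_zero fun i h => hx h.1
      | succ n => exact leastIndex_eq_zero fun i h => hx h.1.1
    rw [h, h, dist_self]
    positivity

lemma IsTame.exists_limit_point (hM : IsTame P M) : ∃ z : X → X, Measurable z ∧
    (∀ x ∈ M, ∀ y, Joined x y → z x = z y) ∧ ∀ x ∈ M, z x ∈ closure {y | Joined x y} := by
  let q := TopologicalSpace.denseSeq X
  have hcau : ∀ x, CauchySeq fun n => q (ballIndex M n x) := fun x =>
    cauchySeq_of_le_geometric (1 / 2) 2 (by norm_num) fun n => dist_ballIndex_succ n x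
  choose z hz using fun x => cauchySeq_tendsto_of_complete (hcau x)
  have hhit : ∀ n i, MeasurableSet {x | HitsBall M n i x} := fun n i =>
    hM.measurableSet_hit Metric.isClosed_closedBall
  have hmeas : ∀ n, Measurable (ballIndex M n) := by
    intro n
    induction n with
    | zero => exact measurable_leastIndex fun i => hhit 0 i
    | succ n ih =>
      refine measurable_leastIndex fun i => (hhit (n + 1) i).inter ?_
      exact ih (MeasurableSet.of_discrete (s := {j | dist (q j) (q i) ≤ 2 * (1 / 2 : ℝ) ^ n}))
  refine ⟨z, ?_, ?_, ?_⟩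
  · refine measurable_of_tendsto_metrizable (f := fun n x => q (ballIndex M n x)) (fun n => ?_)
      (tendsto_pi_nhds.2 hz)
    exact (measurable_of_countable q).comp (hmeas n)
  · intro x hx y hxy
    have hiff : ∀ n i, HitsBall M n i x ↔ HitsBall M n i y := fun n i =>
      ⟨fun ⟨_, w, hw, h⟩ => ⟨hM.joined x y hxy hx, w, hw, hxy.symm.trans h⟩,
        fun ⟨_, w, hw, h⟩ => ⟨hx, w, hw, hxy.trans h⟩⟩
    have heq : ∀ n, ballIndex M n x = ballIndex M n y := by
      intro n
      induction n with
      | zero => simp only [ballIndex, hiff]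
      | succ n ih => simp only [ballIndex, hiff, ih]
    refine tendsto_nhds_unique (hz x) ?_
    simp only [heq]
    exact hz y
  · intro x hx
    rw [Metric.mem_closure_iff]
    intro ε hε
    have h1 := (hz x).eventually (Metric.ball_mem_nhds (z x) (half_pos hε))
    have h2 : ∀ᶠ n in atTop, (1 / 2 : ℝ) ^ n < ε / 2 :=
      (tendsto_pow_atTop_nhds_zero_of_lt_one (by norm_num) (by norm_num)).eventually_lt_const
        (half_pos hε)
    obtain ⟨n, hn1, hn2⟩ := (h1.and h2).exists
    obtain ⟨-, y, hy, hxy⟩ := hitsBall_ballIndex hx n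
    refine ⟨y, hxy, ?_⟩
    rw [Metric.mem_closedBall'] at hy
    have hy' : dist (q (ballIndex M n x)) y ≤ (1 / 2 : ℝ) ^ n := hy
    rw [dist_comm] at hn1
    linarith [dist_triangle (z x) (q (ballIndex M n x)) y]

end Invariant

section Anchor

variable {X : Type*} [MetricSpace X]

/-- A measurable choice, for each path component in `M`, of a limit point outside of it. -/
structure IsAnchor [MeasurableSpace X] (M : Set X) (z : X → X) : Prop where
  measurable : Measurable z
  invariant : ∀ x ∈ M, ∀ y, Joined x y → z x = z y
  mem_closure : ∀ x ∈ M, z x ∈ closure {y | Joined x y}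
  not_joined : ∀ x ∈ M, ¬Joined x (z x)

/-- The distance to the chosen limit point. -/
def height (z : X → X) (x : X) : ℝ := dist x (z x)

/-- The points close to the chosen limit point. -/
def lowSet (z : X → X) (n : ℕ) : Set X := {x | height z x ≤ (1 / 2 : ℝ) ^ n}

lemma mem_lowSet {z : X → X} {n : ℕ} {x : X} : x ∈ lowSet z n ↔ height z x ≤ (1 / 2 : ℝ) ^ n :=
  Iff.rfl

lemma notMem_lowSet {z : X → X} {n : ℕ} {x : X} : x ∉ lowSet z n ↔ (1 / 2 : ℝ) ^ n < height z x :=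
  mem_lowSet.not.trans not_le

lemma path_joined {γ : I → X} (hγ : Continuous γ) (s t : I) : Joined (γ s) (γ t) :=
  (joinedIn_of_continuous (F := univ) hγ s t fun _ _ => trivial).joined

lemma lowSet_antitone (z : X → X) : Antitone (lowSet z) := fun m n hmn x hx =>
  le_trans (show height z x ≤ (1 / 2 : ℝ) ^ n from hx)
    (pow_le_pow_of_le_one (by norm_num) (by norm_num) hmn)

lemma finite_of_no_three {S W : Set I} (hW : IsOpen W) (hSW : closure S ⊆ W)
    (h : ∀ a ∈ S, ∀ b ∈ S, ∀ c ∈ S, a < b → b < c → ¬Icc a c ⊆ W) : S.Finite := by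
  by_contra hinf
  obtain ⟨p, -, hp⟩ := Set.Infinite.exists_accPt_of_subset_isCompact hinf isCompact_univ
    (subset_univ S)
  have hpW : p ∈ W := hSW (mem_closure_iff_clusterPt.2 hp.clusterPt)
  obtain ⟨δ, hδ, hδW⟩ := Metric.isOpen_iff.1 hW p hpW
  have hinf' : (S ∩ Metric.ball p δ).Infinite := by
    refine Set.Infinite.of_accPt (x := p) ?_
    rw [inter_comm]
    exact hp.nhds_inter (Metric.ball_mem_nhds p hδ)
  obtain ⟨t, ht, hcard⟩ := hinf'.exists_subset_card_eq 3
  have hmem : ∀ i, t.orderEmbOfFin hcard i ∈ S ∩ Metric.ball p δ := fun i =>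
    ht (Finset.orderEmbOfFin_mem t hcard i)
  have hlt : ∀ i j : Fin 3, i < j → t.orderEmbOfFin hcard i < t.orderEmbOfFin hcard j :=
    fun i j hij => (t.orderEmbOfFin hcard).lt_iff_lt.2 hij
  refine h _ (hmem 0).1 _ (hmem 1).1 _ (hmem 2).1 (hlt 0 1 (by decide)) (hlt 1 2 (by decide)) ?_
  intro s hs
  refine hδW ?_
  have h0 := (hmem 0).2
  have h2 := (hmem 2).2
  rw [Metric.mem_ball, Subtype.dist_eq, Real.dist_eq, abs_lt] at h0 h2 ⊢
  have hs1 : ((t.orderEmbOfFin hcard 0 : I) : ℝ) ≤ s := hs.1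
  have hs2 : (s : ℝ) ≤ (t.orderEmbOfFin hcard 2 : I) := hs.2
  constructor <;> linarith

variable [CompleteSpace X] [SecondCountableTopology X] [Nonempty X] [MeasurableSpace X]
  [BorelSpace X] {P M : Set X} {z : X → X}

namespace IsAnchor

variable (hM : IsTame P M) (hz : IsAnchor M z)

include hz

omit [CompleteSpace X] [SecondCountableTopology X] [Nonempty X] [BorelSpace X]

lemma height_path {γ : I → X} (hγ : Continuous γ) (h0 : γ 0 ∈ M) (t : I) :
    height z (γ t) = dist (γ t) (z (γ 0)) := by
  rw [height, hz.invariant _ h0 _ (path_joined hγ 0 t)]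

lemma continuous_height {γ : I → X} (hγ : Continuous γ) (h0 : γ 0 ∈ M) :
    Continuous fun t => height z (γ t) := by
  simp only [hz.height_path hγ h0]
  fun_prop

lemma height_pos {x : X} (hx : x ∈ M) : 0 < height z x :=
  dist_pos.2 fun h => hz.not_joined x hx (h ▸ Joined.refl x)

lemma exists_height_lt {x : X} (hx : x ∈ M) {c : ℝ} (hc : 0 < c) :
    ∃ w, Joined x w ∧ height z w < c := by
  obtain ⟨w, hw, hd⟩ := Metric.mem_closure_iff.1 (hz.mem_closure x hx) c hc
  refine ⟨w, hw, ?_⟩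
  rwa [height, ← hz.invariant x hx w hw, dist_comm]

include hM

lemma exists_height_ge {γ : C(I, X)} (h0 : γ 0 ∈ M) : ∃ c > 0, ∀ t, c ≤ height z (γ t) := by
  obtain ⟨t, -, ht⟩ := isCompact_univ.exists_isMinOn univ_nonempty
    (hz.continuous_height γ.continuous h0).continuousOn
  exact ⟨_, hz.height_pos (hM.path_mem h0 t), fun s => ht (mem_univ s)⟩

omit hM in
lemma isClosed_preimage_lowSet {γ : C(I, X)} (h0 : γ 0 ∈ M) (n : ℕ) :
    IsClosed (γ ⁻¹' lowSet z n) :=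
  isClosed_Iic.preimage (hz.continuous_height γ.continuous h0)

end IsAnchor

omit [CompleteSpace X] [SecondCountableTopology X] [Nonempty X] [BorelSpace X] in
lemma IsTame.joinedIn_inter (hM : IsTame P M) {S : Set X} {x y : X} (hx : x ∈ M)
    (h : JoinedIn S x y) : JoinedIn (S ∩ M) x y := by
  obtain ⟨p, hp⟩ := h
  refine ⟨p, fun t => ⟨hp t, hM.joined x _ ?_ hx⟩⟩
  have := path_joined p.continuous 0 t
  simpa using this

omit [CompleteSpace X] [BorelSpace X] in
lemma IsTame.exists_mem_firstHitArcs (hM : IsTame P M) (hz : IsAnchor M z) {S : Set X} {x y : X}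
    (hx : x ∈ M) {n : ℕ} (h : JoinedIn S x y) (hy : y ∈ lowSet z n) (hxn : x ∉ lowSet z n) :
    ∃ γ ∈ firstHitArcs P x (lowSet z n), range γ ⊆ S := by
  obtain ⟨γ, h1, h2, h3, h4, h5⟩ := exists_firstHitArc (fun γ hγ =>
    hz.isClosed_preimage_lowSet (hγ (mem_range_self 0)).2 n) (hM.joinedIn_inter hx h) hy hxn
  refine ⟨γ, ?_, h5.trans inter_subset_left⟩
  have := hM.mem_firstHitArcs h1 (h2 ▸ hx) h3 h4
  rwa [h2] at this

omit [CompleteSpace X] [BorelSpace X] in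
lemma IsTame.nontrivial_firstHitArcs (hM : IsTame P M) (hz : IsAnchor M z) {S T : Set X}
    {x a b : X} (hx : x ∈ M) {n : ℕ} (hxn : x ∉ lowSet z n) (ha : JoinedIn S x a)
    (han : a ∈ lowSet z n) (hb : JoinedIn T x b) (hbn : b ∈ lowSet z n)
    (hST : ∀ y ∈ S, y ∈ T → y ∉ lowSet z n) : (firstHitArcs P x (lowSet z n)).Nontrivial := by
  obtain ⟨α, hα, hαS⟩ := hM.exists_mem_firstHitArcs hz hx ha han hxn
  obtain ⟨β, hβ, hβT⟩ := hM.exists_mem_firstHitArcs hz hx hb hbn hxn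
  refine ⟨α, hα, β, hβ, fun h => ?_⟩
  subst h
  exact hST _ (hαS ⟨1, rfl⟩) (hβT ⟨1, rfl⟩) hα.2.2.2.1

omit [CompleteSpace X] [BorelSpace X] in
/-- Points of two path-connected pieces of the complement of `lowSet z n` in the same component
cannot both have a single arc leading into `lowSet z n`. -/
lemma IsTame.nontrivial_or_nontrivial (hM : IsTame P M) (hz : IsAnchor M z) {x y : X} {n : ℕ}
    (hx : x ∈ M) (hxn : x ∉ lowSet z n) (hyn : y ∉ lowSet z n) (hxy : Joined x y)
    (hnot : ¬JoinedIn (lowSet z n)ᶜ x y) : (firstHitArcs P x (lowSet z n)).Nontrivial ∨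
      (firstHitArcs P y (lowSet z n)).Nontrivial := by
  have hne : x ≠ y := by
    rintro rfl
    exact hnot (JoinedIn.refl hxn)
  obtain ⟨Γ, hΓ, hΓ0, hΓ1, -⟩ := exists_isArc_of_joinedIn (joinedIn_univ.2 hxy) hne
  have hΓM : Γ 0 ∈ M := hΓ0 ▸ hx
  obtain ⟨c, hc, hcΓ⟩ := hz.exists_height_ge hM hΓM
  obtain ⟨w, hw, hwc⟩ := hz.exists_height_lt hx hc
  have hwM : w ∈ M := hM.joined _ _ hw hx
  have hwΓ : w ∉ range Γ := by
    rintro ⟨t, rfl⟩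
    exact not_lt.2 (hcΓ t) hwc
  obtain ⟨q, hq⟩ : ∃ q, Γ q ∈ lowSet z n := by
    by_contra! h
    refine hnot ?_
    rw [← hΓ0, ← hΓ1]
    exact joinedIn_of_continuous Γ.continuous 0 1 fun t _ => h t
  have hwn : w ∈ lowSet z n := (hwc.le.trans (hcΓ q)).trans hq
  have hcl : IsClosed (range Γ) := (isCompact_range Γ.continuous).isClosed
  obtain ⟨ω, hω, hω0, hωlt, ⟨s, hs⟩, -⟩ := exists_firstHitArc (S := univ) (F := range Γ)
    (fun γ _ => hcl.preimage γ.continuous) (joinedIn_univ.2 (hw.symm.trans hxy))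
    ⟨1, hΓ1⟩ hwΓ
  have hωM : ω 0 ∈ M := hω0 ▸ hwM
  have hωΓ : ∀ t p, ω t = Γ p → p = s := by
    intro t p h
    rcases (unitInterval.le_one' (t := t)).eq_or_lt with h1 | h1
    · rw [h1, ← hs] at h
      exact hΓ.1 h.symm
    · exact absurd ⟨p, h.symm⟩ (hωlt t h1)
  have hend : s = 0 ∨ s = 1 := by
    by_contra! hcon
    obtain ⟨p, -, -, hp⟩ := exists_isTriodPoint_of_branch (α := Γ) (β := ω) (u := 0) (v := 1) hΓ.1
      (hω0 ▸ hwΓ) ⟨s, hs⟩ (fun ⟨t, _, ht⟩ => hcon.1 (hωΓ t 0 ht).symm)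
      (fun ⟨t, _, ht⟩ => hcon.2 (hωΓ t 1 ht).symm)
    exact hM.disjoint _ (hM.path_mem hωM p) (hM.triod _ hp)
  have hjω : JoinedIn (range ω) (Γ s) w := by
    rw [hs, ← hω0]
    exact joinedIn_of_continuous ω.continuous 1 0 fun t _ => ⟨t, rfl⟩
  have hjΓ : JoinedIn (range Γ) (Γ s) (Γ q) :=
    joinedIn_of_continuous Γ.continuous s q fun t _ => ⟨t, rfl⟩
  have main : Γ s ∉ lowSet z n → (firstHitArcs P (Γ s) (lowSet z n)).Nontrivial := by
    intro hsn
    refine hM.nontrivial_firstHitArcs hz (hM.path_mem hΓM s) hsn hjω hwn hjΓ hq ?_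
    rintro _ ⟨t, rfl⟩ ⟨p, hp⟩
    rw [← hp, hωΓ t p hp.symm]
    exact hsn
  rcases hend with rfl | rfl
  · rw [hΓ0] at main; exact Or.inl (main hxn)
  · rw [hΓ1] at main; exact Or.inr (main hyn)

omit [CompleteSpace X] [BorelSpace X] in
/-- If two arcs lead into `lowSet z n` from an inner point of an arc from `y` into it, then two
arcs lead into it from `y`. -/
lemma IsTame.nontrivial_of_nontrivial (hM : IsTame P M) (hz : IsAnchor M z) {y : X} {n : ℕ}
    (hy : y ∈ M) {α : C(I, X)} (hα : α ∈ firstHitArcs P y (lowSet z n)) {s : I} (hs0 : 0 < s)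
    (hs1 : s < 1) (h : (firstHitArcs P (α s) (lowSet z n)).Nontrivial) :
    (firstHitArcs P y (lowSet z n)).Nontrivial := by
  have hα0 : α 0 = y := hα.2.1
  have hyn : y ∉ lowSet z n := hα0 ▸ hα.2.2.1 0 (by simp)
  have hsM : α s ∈ M := hM.path_mem (hα0.symm ▸ hy) s
  obtain ⟨δ, hδ, hδ0, hδ1, hδr⟩ := exists_isArc_subarc hα.1.1 hs1.ne
  obtain ⟨η, hη, hη0, hη1, hηr⟩ := exists_isArc_subarc hα.1.1 hs0.ne'
  rw [uIcc_of_le hs1.le] at hδr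
  rw [uIcc_of_ge hs0.le] at hηr
  have hδF : ∀ t < 1, δ t ∉ lowSet z n := by
    intro t ht htn
    obtain ⟨r, hr, hrt⟩ := hδr.subset (mem_range_self t)
    rcases hr.2.eq_or_lt with h1 | h1
    · rw [h1, ← hδ1] at hrt
      exact ht.ne' (hδ.1 hrt)
    · exact hα.2.2.1 r h1 (hrt ▸ htn)
  have hδy : ∀ t, δ t ≠ y := by
    intro t ht
    obtain ⟨r, hr, hrt⟩ := hδr.subset (mem_range_self t)
    rw [ht, ← hα0] at hrt
    exact absurd hr.1 (not_le.2 ((hα.1.1 hrt).symm ▸ hs0))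
  have hδ' : δ ∈ firstHitArcs P (α s) (lowSet z n) := by
    have := hM.mem_firstHitArcs hδ (hδ0 ▸ hsM) hδF (hδ1 ▸ hα.2.2.2.1)
    rwa [hδ0] at this
  obtain ⟨β, hβ, hβδ⟩ : ∃ β ∈ firstHitArcs P (α s) (lowSet z n), β ≠ δ := h.exists_ne δ
  have hβ0 : β 0 = α s := hβ.2.1
  obtain ⟨t, ht⟩ : ∃ t, β t = y := by
    by_contra! hcon
    have hδ2 : δ ∈ firstHitArcs P (α s) (lowSet z n ∪ {y}) :=
      ⟨hδ, hδ0, fun t ht h => h.elim (hδF t ht) (hδy t), Or.inl hδ'.2.2.2.1, hδ'.2.2.2.2⟩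
    have hβ2 : β ∈ firstHitArcs P (α s) (lowSet z n ∪ {y}) :=
      ⟨hβ.1, hβ0, fun t ht h => h.elim (hβ.2.2.1 t ht) (hcon t), Or.inl hβ.2.2.2.1,
        hβ.2.2.2.2⟩
    have hη2 : η ∈ firstHitArcs P (α s) (lowSet z n ∪ {y}) := by
      have := hM.mem_firstHitArcs hη (F := lowSet z n ∪ {y}) (hη0 ▸ hsM) (fun t ht h => by
        rcases h with h | h
        · obtain ⟨r, hr, hrt⟩ := hηr.subset (mem_range_self t)
          exact hα.2.2.1 r (hr.2.trans_lt hs1) (hrt ▸ h)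
        · rw [mem_singleton_iff, ← hα0, ← hη1] at h
          exact ht.ne (hη.1 h)) (Or.inr (hη1.trans hα0))
      rwa [hη0] at this
    rcases eq_or_eq_of_mem_firstHitArcs hM.triod hδ2 hβ2 hη2 hβδ.symm with h | h
    · exact hδy 1 (by rw [← h, hη1, hα0])
    · exact hcon 1 (by rw [← h, hη1, hα0])
  have ht0 : t ≠ 0 := by
    rintro rfl
    rw [hβ0, ← hα0] at ht
    exact hs0.ne' (hα.1.1 ht)
  have hj : JoinedIn (β '' Icc t 1) y (β 1) := by
    rw [← ht]
    refine joinedIn_of_continuous β.continuous t 1 fun r hr => ⟨r, ?_, rfl⟩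
    rwa [uIcc_of_le unitInterval.le_one'] at hr
  obtain ⟨γ, hγ, hγr⟩ := hM.exists_mem_firstHitArcs hz hy hj hβ.2.2.2.1 hyn
  refine ⟨α, hα, γ, hγ, ?_⟩
  rintro rfl
  obtain ⟨r, hr, hrs⟩ := hγr ⟨s, rfl⟩
  rw [← hβ0] at hrs
  rw [hβ.1.1 hrs] at hr
  exact ht0 (le_antisymm hr.1 unitInterval.nonneg')

end Anchor

section Rise

variable {X : Type*} [MetricSpace X] [SecondCountableTopology X] [Nonempty X]

/-- The arcs in `M` along which the height rises from `a` to `b`, and takes intermediate values in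
between. -/
def riseArcs (M : Set X) (z : X → X) (a b : ℝ) : Set C(I, X) :=
  {γ | IsArc γ ∧ (γ 0 ∈ M ∧ ∀ t ∈ Ioo 0 1, height z (γ t) ∈ Ioo a b) ∧
    height z (γ 0) = a ∧ height z (γ 1) = b}

/-- The starting points of arcs rising from `a` to `b` which end in `T`. -/
def riseStart (M : Set X) (z : X → X) (a b : ℝ) (T : Set X) : Set X :=
  {e | ∃ γ ∈ riseArcs M z a b, γ 0 = e ∧ γ 1 ∈ T}

/-- The points of `M` outside of `lowSet z n` from which only one arc leads to `lowSet z n`. -/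
def singleSet (P M : Set X) (z : X → X) (n : ℕ) : Set X :=
  {x | (x ∈ M ∧ x ∉ lowSet z n) ∧ ¬(firstHitArcs P x (lowSet z n)).Nontrivial}

/-- The points of height `2⁻ⁿ` from which an arc rises to a point of `singleSet P M z n`. -/
def tipSet (P M : Set X) (z : X → X) (n : ℕ) : Set X :=
  ⋃ j : ℕ, riseStart M z ((1 / 2 : ℝ) ^ n) ((1 / 2 : ℝ) ^ n + (1 / 2 : ℝ) ^ j) (singleSet P M z n)

variable {P M : Set X} {z : X → X}

lemma riseArcs_eq_zero {γ : C(I, X)} {a b : ℝ} (hab : a < b)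
    (hγ : γ ∈ riseArcs M z a b) {t : I} (ht : height z (γ t) = a) : t = 0 := by
  by_contra h0
  rcases (unitInterval.le_one' (t := t)).eq_or_lt with h1 | h1
  · rw [h1, hγ.2.2.2] at ht
    exact hab.ne' ht
  · exact (hγ.2.1.2 t ⟨unitInterval.pos_iff_ne_zero.2 h0, h1⟩).1.ne' ht

lemma riseArcs_eq_one {γ : C(I, X)} {a b : ℝ} (hab : a < b)
    (hγ : γ ∈ riseArcs M z a b) {t : I} (ht : height z (γ t) = b) : t = 1 := by
  by_contra h1
  rcases (unitInterval.nonneg' (t := t)).eq_or_lt with h0 | h0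
  · rw [← h0, hγ.2.2.1] at ht
    exact hab.ne ht
  · exact (hγ.2.1.2 t ⟨h0, unitInterval.lt_one_iff_ne_one.2 h1⟩).2.ne ht

variable [MeasurableSpace X] [BorelSpace X]

omit [Nonempty X] in
lemma IsAnchor.measurable_height (hz : IsAnchor M z) : Measurable (height z) :=
  measurable_id.dist hz.measurable

omit [Nonempty X] in
lemma IsAnchor.measurableSet_lowSet (hz : IsAnchor M z) (n : ℕ) : MeasurableSet (lowSet z n) :=
  hz.measurable_height measurableSet_Iic

variable [CompleteSpace X]

omit [Nonempty X] in
lemma IsAnchor.measurableSet_height_path (hz : IsAnchor M z) (hM : MeasurableSet M) {J : Set I}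
    (hJ : IsOpen J) {O : Set ℝ} (hO : IsOpen O) :
    MeasurableSet {γ : C(I, X) | γ 0 ∈ M ∧ ∀ t ∈ J, height z (γ t) ∈ O} := by
  let W : Set (C(I, X) × I) := {p | dist (p.1 p.2) (z (p.1 0)) ∈ Oᶜ}
  have hW : MeasurableSet W := (measurable_eval.dist (hz.measurable.comp
    ((measurable_eval_path 0).comp measurable_fst))) hO.measurableSet.compl
  have hc : ∀ γ : C(I, X), IsClosed {t | (γ, t) ∈ W} := fun γ =>
    hO.isClosed_compl.preimage (by fun_prop : Continuous fun t => dist (γ t) (z (γ 0)))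
  convert (measurable_eval_path 0 hM).inter (measurableSet_forall_notMem hW hc hJ) using 1
  ext γ
  refine and_congr_right fun h0 => forall₂_congr fun t _ => ?_
  rw [hz.height_path γ.continuous h0]
  exact not_not.symm

lemma IsAnchor.measurableSet_riseArcs (hz : IsAnchor M z) (hM : MeasurableSet M) (a b : ℝ) :
    MeasurableSet (riseArcs M z a b) :=
  measurableSet_isArc.inter ((hz.measurableSet_height_path hM
    (J := Ioo 0 1) (O := Ioo a b) isOpen_Ioo isOpen_Ioo).inter
    ((measurableSet_eq_fun (hz.measurable_height.comp (measurable_eval_path 0))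
      measurable_const).inter (measurableSet_eq_fun
        (hz.measurable_height.comp (measurable_eval_path 1)) measurable_const)))

lemma IsTame.measurableSet_riseStart (hM : IsTame P M) (hz : IsAnchor M z) {a b : ℝ} (hab : a < b)
    {T : Set X} (hT : MeasurableSet T) : MeasurableSet (riseStart M z a b T) := by
  have hW : MeasurableSet {q : X × C(I, X) | q.2 ∈ riseArcs M z a b ∧ q.2 0 = q.1 ∧ q.2 1 ∈ T} :=
    (measurable_snd (hz.measurableSet_riseArcs hM.measurable a b)).inter ((measurableSet_eq_fun
      ((measurable_eval_path 0).comp measurable_snd) measurable_fst).inter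
      ((measurable_eval_path 1).comp measurable_snd hT))
  refine hM.measurableSet_exists_arc hW id (fun _ => {y | height z y = b}) ?_
  rintro e γ ⟨hγ, h0, -⟩
  dsimp only at h0
  exact ⟨hγ.1, h0, h0 ▸ hγ.2.1.1, fun t ht h => ht.ne (riseArcs_eq_one hab hγ h), hγ.2.2.2⟩

lemma IsTame.measurableSet_singleSet (hM : IsTame P M) (hz : IsAnchor M z) (n : ℕ) :
    MeasurableSet (singleSet P M z n) := by
  let G : Set C(I, X) := {γ | IsArc γ ∧ (γ 0 ∈ M ∧ ∀ t ∈ Iio 1, height z (γ t) ∈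
    Ioi ((1 / 2 : ℝ) ^ n)) ∧ γ 1 ∈ lowSet z n}
  have hG : MeasurableSet G := measurableSet_isArc.inter
    ((hz.measurableSet_height_path hM.measurable isOpen_Iio isOpen_Ioi).inter
      (measurable_eval_path 1 (hz.measurableSet_lowSet n)))
  let W : Set (X × (C(I, X) × C(I, X))) := {p | p.2.1 ∈ G ∧ p.2.2 ∈ G ∧ p.2.1 0 = p.1 ∧
    p.2.2 0 = p.1 ∧ p.2.1 ≠ p.2.2}
  have hW : MeasurableSet W :=
    (measurable_fst.comp measurable_snd hG).inter ((measurable_snd.comp measurable_snd hG).inter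
      ((measurableSet_eq_fun ((measurable_eval_path 0).comp (measurable_fst.comp measurable_snd))
        measurable_fst).inter ((measurableSet_eq_fun ((measurable_eval_path 0).comp
          (measurable_snd.comp measurable_snd)) measurable_fst).inter
          (measurableSet_eq_fun (measurable_fst.comp measurable_snd)
            (measurable_snd.comp measurable_snd)).compl)))
  have hGx : ∀ x γ, γ ∈ G → γ 0 = x → γ ∈ firstHitArcs P x (lowSet z n) := by
    rintro _ γ ⟨h1, ⟨h2, h3⟩, h4⟩ rfl
    exact hM.mem_firstHitArcs h1 h2 (fun t ht => notMem_lowSet.2 (h3 t ht)) h4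
  have hfin : ∀ x, {p | (x, p) ∈ W}.Finite := fun x =>
    ((finite_firstHitArcs hM.triod x (lowSet z n)).prod
      (finite_firstHitArcs hM.triod x (lowSet z n))).subset fun p hp =>
      ⟨hGx x _ hp.1 hp.2.2.1, hGx x _ hp.2.1 hp.2.2.2.1⟩
  convert (hM.measurable.inter (hz.measurableSet_lowSet n).compl).diff
    (measurableSet_proj_of_finite hW hfin) using 1
  ext x
  refine and_congr_right fun hx => not_congr ⟨?_, ?_⟩
  · rintro ⟨α, hα, β, hβ, hne⟩
    have key : ∀ γ ∈ firstHitArcs P x (lowSet z n), γ ∈ G := fun γ hγ =>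
      ⟨hγ.1, ⟨hγ.2.1 ▸ hx.1, fun t ht => notMem_lowSet.1 (hγ.2.2.1 t ht)⟩, hγ.2.2.2.1⟩
    exact ⟨(α, β), key α hα, key β hβ, hα.2.1, hβ.2.1, hne⟩
  · rintro ⟨⟨α, β⟩, hα, hβ, hα0, hβ0, hne⟩
    exact ⟨α, hGx x α hα hα0, β, hGx x β hβ hβ0, hne⟩

lemma IsTame.measurableSet_tipSet (hM : IsTame P M) (hz : IsAnchor M z) (n : ℕ) :
    MeasurableSet (tipSet P M z n) :=
  MeasurableSet.iUnion fun j => hM.measurableSet_riseStart hz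
    (lt_add_of_pos_right _ (by positivity)) (hM.measurableSet_singleSet hz n)

omit [CompleteSpace X] [BorelSpace X] in
lemma IsTame.exists_riseArc (hM : IsTame P M) (hz : IsAnchor M z) {α : C(I, X)}
    (hα : Function.Injective α) (h0 : α 0 ∈ M) {a b : ℝ} (hab : a < b) (hb : b < height z (α 0)) {p : I}
    (hp : height z (α p) = a) (hlt : ∀ t < p, a < height z (α t)) :
    ∃ s, 0 < s ∧ s < p ∧ ∃ ρ ∈ riseArcs M z a b, ρ 0 = α p ∧ ρ 1 = α s := by
  have hu := hz.continuous_height α.continuous h0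
  have ivt : ∀ t ≤ p, b ≤ height z (α t) → ∃ r, t ≤ r ∧ r ≤ p ∧ height z (α r) = b := by
    intro t ht hbt
    obtain ⟨r, hr, hrb⟩ := intermediate_value_Icc' ht hu.continuousOn ⟨hp.le.trans hab.le, hbt⟩
    exact ⟨r, hr.1, hr.2, hrb⟩
  have hcl : IsClosed {t : I | t ≤ p ∧ height z (α t) = b} :=
    isClosed_Iic.inter (isClosed_singleton.preimage hu)
  obtain ⟨s, ⟨hsp, hsb⟩, hmax⟩ := hcl.isCompact.exists_isGreatest (by
    obtain ⟨r, -, hr, hrb⟩ := ivt 0 unitInterval.nonneg' hb.le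
    exact ⟨r, hr, hrb⟩)
  have hsp' : s < p := hsp.lt_of_ne fun h => hab.ne' (by rw [← hsb, h, hp])
  have hs0 : 0 < s := unitInterval.pos_iff_ne_zero.2 fun h => hb.ne' (by rw [← hsb, h])
  obtain ⟨ρ, hρ, hρ0, hρ1, hρr⟩ := exists_isArc_subarc hα hsp'.ne'
  rw [uIcc_of_ge hsp] at hρr
  refine ⟨s, hs0, hsp', ρ, ⟨hρ, ⟨?_, fun t ht => ?_⟩, by rw [hρ0, hp], by rw [hρ1, hsb]⟩, hρ0, hρ1⟩
  · rw [hρ0]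
    exact hM.path_mem h0 p
  · obtain ⟨r, hr, hrt⟩ := hρr.subset (mem_range_self t)
    have hrs : s < r := hr.1.lt_of_ne fun h => ht.2.ne (hρ.1 (by rw [← hrt, hρ1, h]))
    have hrp : r < p := hr.2.lt_of_ne fun h => ht.1.ne' (hρ.1 (by rw [← hrt, hρ0, h]))
    rw [← hrt]
    refine ⟨hlt r hrp, lt_of_not_ge fun h => ?_⟩
    obtain ⟨r', h1, h2, h3⟩ := ivt r hr.2 h
    exact absurd (hmax ⟨h2, h3⟩) (not_le.2 (hrs.trans_le h1))

end Rise

section Mark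

variable {X : Type*} [MetricSpace X] [SecondCountableTopology X] [Nonempty X] {P M : Set X}
  {z : X → X}

lemma height_mem_Icc_of_mem_riseArcs {γ : C(I, X)} {a b : ℝ} (hab : a < b)
    (hγ : γ ∈ riseArcs M z a b) (t : I) : height z (γ t) ∈ Icc a b := by
  rcases (unitInterval.nonneg' (t := t)).eq_or_lt with h0 | h0
  · rw [← h0, hγ.2.2.1]
    exact ⟨le_rfl, hab.le⟩
  rcases (unitInterval.le_one' (t := t)).eq_or_lt with h1 | h1
  · rw [h1, hγ.2.2.2]
    exact ⟨hab.le, le_rfl⟩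
  · exact Ioo_subset_Icc_self (hγ.2.1.2 t ⟨h0, h1⟩)

/-- The points of height `2⁻⁽ⁱ⁺¹⁾` from which an arc rises to height `2⁻ⁱ`. -/
def markSet (M : Set X) (z : X → X) (i : ℕ) : Set X :=
  riseStart M z ((1 / 2 : ℝ) ^ (i + 1)) ((1 / 2 : ℝ) ^ i) univ

lemma half_pow_succ_lt (i : ℕ) : (1 / 2 : ℝ) ^ (i + 1) < (1 / 2 : ℝ) ^ i :=
  pow_lt_pow_right_of_lt_one₀ (by norm_num) (by norm_num) i.lt_succ_self

variable [MeasurableSpace X]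

lemma IsTame.tipSet_unique (hM : IsTame P M) (hz : IsAnchor M z) {n : ℕ} {e e' : X}
    (he : e ∈ tipSet P M z n) (he' : e' ∈ tipSet P M z n) (h : Joined e e') : e = e' := by
  have key : ∀ e ∈ tipSet P M z n, e ∈ lowSet z n ∧ ∃ y ∈ singleSet P M z n, Joined y e ∧
      JoinedIn ((lowSet z n)ᶜ ∪ {e}) y e := by
    intro e he
    obtain ⟨j, ρ, hρ, rfl, h1⟩ := mem_iUnion.1 he
    have hlt : (1 / 2 : ℝ) ^ n < (1 / 2 : ℝ) ^ n + (1 / 2 : ℝ) ^ j :=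
      lt_add_of_pos_right _ (by positivity)
    refine ⟨hρ.2.2.1.le, ρ 1, h1, path_joined ρ.continuous 1 0,
      joinedIn_of_continuous ρ.continuous 1 0 fun t _ => ?_⟩
    by_cases ht : t = 0
    · exact Or.inr (congrArg ρ ht)
    · exact Or.inl (notMem_lowSet.2 ((height_mem_Icc_of_mem_riseArcs hlt hρ t).1.lt_of_ne
        fun h => ht (riseArcs_eq_zero hlt hρ h.symm)))
  obtain ⟨hel, y, hy, hye, hyj⟩ := key e he
  obtain ⟨hel', y', hy', hye', hyj'⟩ := key e' he'
  by_contra hne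
  by_cases hj : JoinedIn (lowSet z n)ᶜ y y'
  · refine hy.2 (hM.nontrivial_firstHitArcs hz hy.1.1 hy.1.2 hyj hel
      ((hj.mono subset_union_left).trans hyj') hel' ?_)
    rintro p (hp | hp) (hp' | hp')
    · exact hp
    · exact hp
    · exact hp'
    · exact absurd (hp.symm.trans hp') hne
  · rcases hM.nontrivial_or_nontrivial hz hy.1.1 hy.1.2 hy'.1.2
      ((hye.trans h).trans hye'.symm) hj with h | h
    · exact hy.2 h
    · exact hy'.2 h

lemma IsTame.nontrivial_of_notMem_tipSet (hM : IsTame P M) (hz : IsAnchor M z) {n : ℕ} {x : X}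
    (hx : x ∈ M) (hxn : x ∉ lowSet z n) (h : ∀ e, Joined x e → e ∉ tipSet P M z n) :
    (firstHitArcs P x (lowSet z n)).Nontrivial := by
  by_contra hcon
  obtain ⟨w, hw, hwn⟩ := hz.exists_height_lt hx (by positivity : (0 : ℝ) < (1 / 2 : ℝ) ^ n)
  obtain ⟨α, hα, -⟩ := hM.exists_mem_firstHitArcs hz hx (joinedIn_univ.2 hw) hwn.le hxn
  obtain ⟨hα1, rfl, hα3, hα4, -⟩ := id hα
  have hu := hz.continuous_height α.continuous hx
  rw [notMem_lowSet] at hxn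
  have hlt : ∀ t < 1, (1 / 2 : ℝ) ^ n < height z (α t) := fun t ht => notMem_lowSet.1 (hα3 t ht)
  have hend : height z (α 1) = (1 / 2 : ℝ) ^ n := by
    obtain ⟨r, -, hr⟩ := intermediate_value_Icc' (unitInterval.nonneg' (t := 1)) hu.continuousOn
      ⟨hα4, hxn.le⟩
    rcases (unitInterval.le_one' (t := r)).eq_or_lt with h1 | h1
    · rwa [h1] at hr
    · exact absurd hr (hlt r h1).ne'
  obtain ⟨j, hj⟩ := exists_pow_lt_of_lt_one (sub_pos.2 hxn) (by norm_num : (1 / 2 : ℝ) < 1)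
  obtain ⟨s, hs0, hs1, ρ, hρ, hρ0, hρ1⟩ := hM.exists_riseArc hz hα1.1 hx
    (lt_add_of_pos_right ((1 / 2 : ℝ) ^ n) (by positivity : (0 : ℝ) < (1 / 2 : ℝ) ^ j))
    (by linarith) hend hlt
  refine h (α 1) (path_joined α.continuous 0 1) (mem_iUnion.2 ⟨j, ρ, hρ, hρ0, ?_⟩)
  rw [hρ1]
  exact ⟨⟨hM.path_mem hx s, hα3 s hs1⟩, fun hs =>
    hcon (hM.nontrivial_of_nontrivial hz hx hα hs0 hs1 hs)⟩

lemma IsTame.exists_eq_of_joinedIn (hM : IsTame P M) {n : ℕ} {x : X}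
    (hx : x ∈ M) {α β : C(I, X)} (hα : α ∈ firstHitArcs P x (lowSet z n))
    (hβ : β ∈ firstHitArcs P x (lowSet z n)) (hne : α ≠ β) {y : X}
    (hy : JoinedIn (lowSet z n)ᶜ x y) : y ∈ range α ∪ range β := by
  by_contra hcon
  rw [mem_union, not_or] at hcon
  have hxy : x ≠ y := fun h => hcon.1 ⟨0, hα.2.1.trans h⟩
  obtain ⟨γ, hγ, hγ0, hγ1, hγr⟩ := exists_isArc_of_joinedIn hy hxy
  have key : ∀ δ ∈ firstHitArcs P x (lowSet z n), y ∉ range δ →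
      δ ∈ firstHitArcs P x (lowSet z n ∪ {y}) := fun δ hδ hy =>
    ⟨hδ.1, hδ.2.1, fun t ht h => h.elim (hδ.2.2.1 t ht) fun h => hy ⟨t, h⟩, Or.inl hδ.2.2.2.1,
      hδ.2.2.2.2⟩
  have hγ' : γ ∈ firstHitArcs P x (lowSet z n ∪ {y}) := by
    have := hM.mem_firstHitArcs hγ (F := lowSet z n ∪ {y}) (hγ0 ▸ hx) (fun t ht h => h.elim
      (hγr (mem_range_self t)) fun h => ht.ne (hγ.1 (h.trans hγ1.symm))) (Or.inr hγ1)
    rwa [hγ0] at this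
  rcases eq_or_eq_of_mem_firstHitArcs hM.triod (key α hα hcon.1) (key β hβ hcon.2) hγ' hne with
    rfl | rfl
  · exact hcon.1 ⟨1, hγ1⟩
  · exact hcon.2 ⟨1, hγ1⟩

lemma IsTame.finite_mark_param (hM : IsTame P M) (hz : IsAnchor M z) {n : ℕ} {x : X}
    (hx : x ∈ M) {α β : C(I, X)} (hα : α ∈ firstHitArcs P x (lowSet z n))
    (hβ : β ∈ firstHitArcs P x (lowSet z n)) (hne : α ≠ β) (i : ℕ) :
    {s : I | α s ∈ markSet M z i ∧ JoinedIn (lowSet z n)ᶜ x (α s)}.Finite := by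
  have hu : Continuous fun t => height z (α t) :=
    hz.continuous_height α.continuous (hα.2.1.symm ▸ hx)
  have hmark : ∀ m ∈ markSet M z i, height z m = (1 / 2 : ℝ) ^ (i + 1) := by
    rintro _ ⟨γ, hγ, rfl, -⟩
    exact hγ.2.2.1
  refine finite_of_no_three (W := {t | height z (α t) < (1 / 2 : ℝ) ^ i})
    (isOpen_Iio.preimage hu) ?_ ?_
  · have hcl : IsClosed {t : I | height z (α t) = (1 / 2 : ℝ) ^ (i + 1)} :=
      isClosed_singleton.preimage hu
    refine (closure_minimal (fun t ht => hmark _ ht.1) hcl).trans fun t ht => ?_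
    exact (show height z (α t) = _ from ht).trans_lt (half_pow_succ_lt i)
  rintro a ⟨ha, -⟩ b ⟨hb, hbj⟩ c ⟨hc, -⟩ hab hbc hW
  obtain ⟨γ, hγ, hγ0, -⟩ := id hb
  have hhb := hmark _ hb
  have hbn := notMem_lowSet.1 hbj.target_mem
  have hrange : range γ ⊆ range α ∪ range β := by
    rintro _ ⟨t, rfl⟩
    refine hM.exists_eq_of_joinedIn hx hα hβ hne (hbj.trans ?_)
    rw [← hγ0]
    refine joinedIn_of_continuous γ.continuous 0 t fun r _ => notMem_lowSet.2 ?_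
    rw [hhb] at hbn
    exact hbn.trans_le (height_mem_Icc_of_mem_riseArcs (half_pow_succ_lt i) hγ r).1
  have hB₁ : IsClosed (α '' Icc a c) := (isCompact_Icc.image α.continuous).isClosed
  have hB₂ : IsClosed (α '' (Iic a ∪ Ici c) ∪ range β) :=
    (((isClosed_Iic.union isClosed_Ici).isCompact.image α.continuous).isClosed).union
      (isCompact_range β.continuous).isClosed
  have hcover : range γ ⊆ α '' Icc a c ∪ (α '' (Iic a ∪ Ici c) ∪ range β) := by
    intro p hp
    rcases hrange hp with ⟨r, rfl⟩ | h
    · by_cases h1 : a ≤ r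
      · by_cases h2 : r ≤ c
        · exact Or.inl ⟨r, ⟨h1, h2⟩, rfl⟩
        · exact Or.inr (Or.inl ⟨r, Or.inr (not_le.1 h2).le, rfl⟩)
      · exact Or.inr (Or.inl ⟨r, Or.inl (not_le.1 h1).le, rfl⟩)
    · exact Or.inr (Or.inr h)
  have hend : γ 1 ∉ α '' Icc a c := by
    rintro ⟨r, hr, hr1⟩
    have h1 : height z (α r) < (1 / 2 : ℝ) ^ i := hW hr
    rw [hr1, hγ.2.2.2] at h1
    exact h1.false
  obtain ⟨_, ⟨t, rfl⟩, ⟨r, hr, hrt⟩, h2⟩ := isPreconnected_closed_iff.1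
    (isPreconnected_range γ.continuous) _ _ hB₁ hB₂ hcover
    ⟨γ 0, ⟨0, rfl⟩, b, ⟨hab.le, hbc.le⟩, hγ0.symm⟩
    ⟨γ 1, ⟨1, rfl⟩, (hcover ⟨1, rfl⟩).resolve_left hend⟩
  have hrac : r = a ∨ r = c := by
    rcases h2 with ⟨r', hr', hrt'⟩ | ⟨q, hq⟩
    · obtain rfl := hα.1.1 (hrt'.trans hrt.symm)
      exact hr'.imp (fun h => le_antisymm h hr.1) fun h => le_antisymm hr.2 h
    · rcases firstHitArcs_inter hM.triod hα hβ hne (hrt.trans hq.symm) with h | h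
      · exact Or.inl (le_antisymm (h.1.trans_le unitInterval.nonneg') hr.1)
      · exact Or.inr (le_antisymm hr.2 (h.1.symm ▸ unitInterval.le_one'))
  have hht : height z (γ t) = (1 / 2 : ℝ) ^ (i + 1) := by
    rw [← hrt]
    rcases hrac with rfl | rfl
    · exact hmark _ ha
    · exact hmark _ hc
  obtain rfl := riseArcs_eq_zero (half_pow_succ_lt i) hγ hht
  obtain rfl := hα.1.1 (hrt.trans hγ0)
  rcases hrac with rfl | rfl
  · exact hab.false
  · exact hbc.false

lemma IsTame.finite_mark (hM : IsTame P M) (hz : IsAnchor M z) {n : ℕ} {x : X}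
    (hx : x ∈ M) (h : (firstHitArcs P x (lowSet z n)).Nontrivial) (i : ℕ) :
    {m | m ∈ markSet M z i ∧ JoinedIn (lowSet z n)ᶜ x m}.Finite := by
  obtain ⟨α, hα, β, hβ, hne⟩ := h
  refine (((hM.finite_mark_param hz hx hα hβ hne i).image α).union
    ((hM.finite_mark_param hz hx hβ hα hne.symm i).image β)).subset ?_
  rintro m ⟨hm, hj⟩
  rcases hM.exists_eq_of_joinedIn hx hα hβ hne hj with ⟨s, rfl⟩ | ⟨s, rfl⟩
  · exact Or.inl ⟨s, ⟨hm, hj⟩, rfl⟩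
  · exact Or.inr ⟨s, ⟨hm, hj⟩, rfl⟩

lemma IsTame.exists_mark (hM : IsTame P M) (hz : IsAnchor M z) {x : X} (hx : x ∈ M) :
    ∃ i n, i ≤ n ∧ ∃ m ∈ markSet M z i, JoinedIn (lowSet z n)ᶜ x m := by
  obtain ⟨i, hi⟩ := exists_pow_lt_of_lt_one (hz.height_pos hx) (by norm_num : (1 / 2 : ℝ) < 1)
  obtain ⟨w, hw, hwn⟩ := hz.exists_height_lt hx (by positivity : (0 : ℝ) < (1 / 2 : ℝ) ^ (i + 1))
  have hlt := half_pow_succ_lt i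
  have hxw : x ≠ w := by
    rintro rfl
    linarith
  obtain ⟨α, hα, rfl, rfl, -⟩ := exists_isArc_of_joinedIn (joinedIn_univ.2 hw) hxw
  have hu := hz.continuous_height α.continuous hx
  obtain ⟨p, hp0, hp, hplt⟩ := exists_first_eq (u := fun t => -height z (α t))
    (r := -(1 / 2 : ℝ) ^ (i + 1)) hu.neg (by linarith) ⟨1, by linarith⟩
  have hplt' : ∀ t < p, (1 / 2 : ℝ) ^ (i + 1) < height z (α t) := fun t ht =>
    neg_lt_neg_iff.1 (hplt t ht)
  obtain ⟨s, -, -, ρ, hρ, hρ0, -⟩ := hM.exists_riseArc hz hα.1 hx hlt hi (neg_injective hp) hplt'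
  refine ⟨i, i + 2, by omega, α p, ⟨ρ, hρ, hρ0, mem_univ _⟩, ?_⟩
  refine joinedIn_of_continuous α.continuous 0 p fun t ht => notMem_lowSet.2 ?_
  rw [uIcc_of_le unitInterval.nonneg'] at ht
  refine (half_pow_succ_lt (i + 1)).trans_le ?_
  rcases ht.2.eq_or_lt with h | h
  · rw [h]
    exact (neg_injective hp).ge
  · exact (hplt' t h).le

variable [CompleteSpace X] [BorelSpace X]

lemma IsTame.measurableSet_joinedIn (hM : IsTame P M) (hz : IsAnchor M z) {O : Set ℝ}
    (hO : IsOpen O) :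
    MeasurableSet {p : X × X | p.1 ∈ M ∧ JoinedIn (height z ⁻¹' O) p.1 p.2} := by
  have hG : MeasurableSet {γ : C(I, X) | IsArc γ ∧ γ 0 ∈ M ∧
      ∀ t ∈ (univ : Set I), height z (γ t) ∈ O} :=
    measurableSet_isArc.inter (hz.measurableSet_height_path hM.measurable isOpen_univ hO)
  have hd : MeasurableSet {p : X × X | p.1 ∈ M ∧ height z p.1 ∈ O ∧ p.1 = p.2} :=
    (measurable_fst hM.measurable).inter (((hz.measurable_height.comp measurable_fst)
      hO.measurableSet).inter (measurableSet_eq_fun measurable_fst measurable_snd))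
  convert hd.union (hM.measurableSet_arc_endpoints hG fun γ hγ => ⟨hγ.1, hγ.2.1⟩) using 1
  ext ⟨x, y⟩
  constructor
  · rintro ⟨hx, hj⟩
    by_cases hxy : x = y
    · exact Or.inl ⟨hx, hj.source_mem, hxy⟩
    · obtain ⟨γ, hγ, h0, h1, hr⟩ := exists_isArc_of_joinedIn hj hxy
      exact Or.inr ⟨γ, ⟨hγ, h0 ▸ hx, fun t _ => hr (mem_range_self t)⟩, h0, h1⟩
  · rintro (⟨hx, hO, hxy⟩ | ⟨γ, ⟨hγ, h0, hr⟩, rfl, rfl⟩)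
    · dsimp only at hxy
      subst hxy
      exact ⟨hx, JoinedIn.refl hO⟩
    · exact ⟨h0, joinedIn_of_continuous γ.continuous 0 1 fun t _ => hr t (mem_univ t)⟩

end Mark

section Selection

variable {X : Type*} [TopologicalSpace X] [MeasurableSpace X]

/-- An increasing sequence of Borel assignments of finite sets of points in the path component of
each point, such that points in the same component eventually get the same sets, and such that the
points of `D` eventually get nonempty sets. -/
def HasSelection (D : Set X) : Prop :=
  ∃ S : ℕ → Set (X × X), (∀ n, MeasurableSet (S n)) ∧ (∀ n x s, (x, s) ∈ S n → Joined x s) ∧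
    (∀ n x, {s | (x, s) ∈ S n}.Finite) ∧ (∀ n x s, (x, s) ∈ S n → (x, s) ∈ S (n + 1)) ∧
    (∀ x ∈ D, ∃ n s, (x, s) ∈ S n) ∧
    ∀ x y, Joined x y → ∃ N, ∀ n ≥ N, ∀ s, (x, s) ∈ S n ↔ (y, s) ∈ S n

lemma HasSelection.union {D D' : Set X} (h : HasSelection D) (h' : HasSelection D') :
    HasSelection (D ∪ D') := by
  obtain ⟨S, h1, h2, h3, h4, h5, h6⟩ := h
  obtain ⟨S', h1', h2', h3', h4', h5', h6'⟩ := h'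
  refine ⟨fun n => S n ∪ S' n, fun n => (h1 n).union (h1' n),
    fun n x s h => h.elim (h2 n x s) (h2' n x s), fun n x => (h3 n x).union (h3' n x),
    fun n x s h => h.imp (h4 n x s) (h4' n x s), ?_, fun x y hxy => ?_⟩
  · rintro x (hx | hx)
    · obtain ⟨n, s, h⟩ := h5 x hx
      exact ⟨n, s, Or.inl h⟩
    · obtain ⟨n, s, h⟩ := h5' x hx
      exact ⟨n, s, Or.inr h⟩
  · obtain ⟨N, hN⟩ := h6 x y hxy
    obtain ⟨N', hN'⟩ := h6' x y hxy
    exact ⟨max N N', fun n hn s => or_congr (hN n (le_of_max_le_left hn) s)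
      (hN' n (le_of_max_le_right hn) s)⟩

lemma HasSelection.of_function [MeasurableEq X] {D : Set X} (hD : MeasurableSet D) {f : X → X}
    (hf : Measurable f) (hj : ∀ x ∈ D, Joined x (f x))
    (hinv : ∀ x y, Joined x y → x ∈ D → y ∈ D ∧ f x = f y) : HasSelection D := by
  refine ⟨fun _ => {p | p.1 ∈ D ∧ p.2 = f p.1}, fun _ => (measurable_fst hD).inter
    (measurableSet_eq_fun measurable_snd (hf.comp measurable_fst)), ?_, fun _ x => ?_,
    fun _ _ _ h => h, fun x hx => ⟨0, f x, hx, rfl⟩, fun x y hxy => ⟨0, fun _ _ s => ?_⟩⟩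
  · rintro _ x s ⟨hx, hs⟩
    dsimp only at hx hs
    exact hs ▸ hj x hx
  · exact (finite_singleton (f x)).subset fun s hs => hs.2
  · constructor
    · rintro ⟨hx, hs⟩
      exact ⟨(hinv x y hxy hx).1, hs.trans (hinv x y hxy hx).2⟩
    · rintro ⟨hy, hs⟩
      exact ⟨(hinv y x hxy.symm hy).1, hs.trans (hinv y x hxy.symm hy).2⟩

lemma HasSelection.exists_reduction [StandardBorelSpace X] (h : HasSelection (univ : Set X)) :
    ∃ f : X → ℕ → Bool, Measurable f ∧ ∀ x y, Joined x y ↔ ∃ n, ∀ m ≥ n, f x m = f y m := by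
  obtain ⟨S, h1, h2, h3, h4, h5, h6⟩ := h
  exact exists_reduction_of_finite Joined S h1 h3 h4 (fun x => h5 x (mem_univ x)) h6
    fun n x y s hx hy => (h2 n x s hx).trans (h2 n y s hy).symm

end Selection

section Main

variable {X : Type*} [MetricSpace X] [SecondCountableTopology X] [Nonempty X] [CompleteSpace X]
  [MeasurableSpace X] [BorelSpace X] {P M : Set X} {z : X → X}

lemma IsTame.measurableSet_joined (hM : IsTame P M) :
    MeasurableSet {p : X × X | p.1 ∈ M ∧ Joined p.1 p.2} := by
  have hG : MeasurableSet {γ : C(I, X) | IsArc γ ∧ γ 0 ∈ M} :=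
    measurableSet_isArc.inter (measurable_eval_path 0 hM.measurable)
  have hd : MeasurableSet {p : X × X | p.1 ∈ M ∧ p.1 = p.2} :=
    (measurable_fst hM.measurable).inter (measurableSet_eq_fun measurable_fst measurable_snd)
  convert hd.union (hM.measurableSet_arc_endpoints hG fun γ hγ => hγ) using 1
  ext ⟨x, y⟩
  constructor
  · rintro ⟨hx, hj⟩
    by_cases hxy : x = y
    · exact Or.inl ⟨hx, hxy⟩
    · obtain ⟨γ, hγ, h0, h1, -⟩ := exists_isArc_of_joinedIn (joinedIn_univ.2 hj) hxy
      exact Or.inr ⟨γ, ⟨hγ, h0 ▸ hx⟩, h0, h1⟩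
  · rintro (⟨hx, hxy⟩ | ⟨γ, ⟨-, h0⟩, rfl, rfl⟩)
    · dsimp only at hxy
      subst hxy
      exact ⟨hx, Joined.refl x⟩
    · exact ⟨h0, path_joined γ.continuous 0 1⟩

lemma IsTame.measurableSet_joined_tipSet (hM : IsTame P M) (hz : IsAnchor M z) (n : ℕ) :
    MeasurableSet {p : X × X | (p.1 ∈ M ∧ Joined p.1 p.2) ∧ ∃ k ≤ n, p.2 ∈ tipSet P M z k} := by
  refine hM.measurableSet_joined.inter ?_
  have : {p : X × X | ∃ k ≤ n, p.2 ∈ tipSet P M z k} = Prod.snd ⁻¹' ⋃ k ≤ n, tipSet P M z k := by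
    ext; simp
  refine (congrArg MeasurableSet this).mpr ?_
  exact measurable_snd (MeasurableSet.biUnion (to_countable (Iic n)) fun k _ =>
    hM.measurableSet_tipSet hz k)

omit [CompleteSpace X] [BorelSpace X] in
lemma IsTame.finite_joined_tipSet (hM : IsTame P M) (hz : IsAnchor M z) (n : ℕ) (x : X) :
    {e | (x ∈ M ∧ Joined x e) ∧ ∃ k ≤ n, e ∈ tipSet P M z k}.Finite := by
  refine ((finite_Iic n).biUnion fun k _ => Set.Subsingleton.finite
    (s := {e | Joined x e ∧ e ∈ tipSet P M z k}) ?_).subset ?_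
  · rintro e ⟨h, he⟩ e' ⟨h', he'⟩
    exact hM.tipSet_unique hz he he' (h.symm.trans h')
  · rintro e ⟨⟨-, h⟩, k, hk, he⟩
    exact mem_biUnion hk ⟨h, he⟩

/-- The points of `M` whose path component contains no point of the sets `tipSet P M z n`. -/
def tiplessSet (P M : Set X) (z : X → X) : Set X :=
  {x | x ∈ M ∧ ∀ n, ∀ e ∈ tipSet P M z n, ¬Joined x e}

lemma IsTame.measurableSet_tiplessSet (hM : IsTame P M) (hz : IsAnchor M z) :
    MeasurableSet (tiplessSet P M z) := by
  have : tiplessSet P M z = M \ ⋃ n, {x | ∃ e, (x, e) ∈ {p : X × X |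
      (p.1 ∈ M ∧ Joined p.1 p.2) ∧ ∃ k ≤ n, p.2 ∈ tipSet P M z k}} := by
    ext x
    simp only [tiplessSet, mem_ofPred_eq, Set.mem_sdiff, mem_iUnion]
    refine and_congr_right fun hx => ⟨?_, fun h n e he hj => h ⟨n, e, ⟨hx, hj⟩, n, le_rfl, he⟩⟩
    rintro h ⟨n, e, ⟨-, hj⟩, k, -, he⟩
    exact h k e he hj
  rw [this]
  exact hM.measurable.diff (MeasurableSet.iUnion fun n =>
    measurableSet_proj_of_finite (hM.measurableSet_joined_tipSet hz n)
      (hM.finite_joined_tipSet hz n))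

lemma IsTame.hasSelection_tip (hM : IsTame P M) (hz : IsAnchor M z) :
    HasSelection (M \ tiplessSet P M z) := by
  refine ⟨fun n => {p | (p.1 ∈ M ∧ Joined p.1 p.2) ∧ ∃ k ≤ n, p.2 ∈ tipSet P M z k},
    hM.measurableSet_joined_tipSet hz, fun n x s h => h.1.2, hM.finite_joined_tipSet hz, ?_, ?_,
    fun x y hxy => ⟨0, fun n _ e => and_congr_left fun _ => ?_⟩⟩
  · rintro n x s ⟨h, k, hk, hs⟩
    exact ⟨h, k, hk.trans n.le_succ, hs⟩
  · rintro x ⟨hx, hx'⟩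
    by_contra! h
    exact hx' ⟨hx, fun n e he hj => h n e ⟨⟨hx, hj⟩, n, le_rfl, he⟩⟩
  · exact ⟨fun h => ⟨hM.joined x y hxy h.1, hxy.symm.trans h.2⟩,
      fun h => ⟨hM.joined y x hxy.symm h.1, hxy.trans h.2⟩⟩

lemma IsTame.hasSelection_tipless (hM : IsTame P M) (hz : IsAnchor M z) :
    HasSelection (tiplessSet P M z) := by
  have hinv : ∀ x y, Joined x y → x ∈ tiplessSet P M z → y ∈ tiplessSet P M z :=
    fun x y hxy hx => ⟨hM.joined x y hxy hx.1, fun n e he hj => hx.2 n e he (hxy.trans hj)⟩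
  have hlow : ∀ n, (lowSet z n)ᶜ = height z ⁻¹' Ioi ((1 / 2 : ℝ) ^ n) := fun n =>
    ext fun x => notMem_lowSet
  refine ⟨fun n => {p | (p.1 ∈ M ∧ JoinedIn (lowSet z n)ᶜ p.1 p.2) ∧ p.1 ∈ tiplessSet P M z ∧
    ∃ i ≤ n, p.2 ∈ markSet M z i}, fun n => ?_, fun n x s h => h.1.2.joined, fun n x => ?_, ?_, ?_,
    fun x y hxy => ?_⟩
  · refine MeasurableSet.inter ?_ ((measurable_fst (hM.measurableSet_tiplessSet hz)).inter ?_)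
    · rw [hlow]
      exact hM.measurableSet_joinedIn hz isOpen_Ioi
    · have : {p : X × X | ∃ i ≤ n, p.2 ∈ markSet M z i} = Prod.snd ⁻¹' ⋃ i ≤ n, markSet M z i := by
        ext; simp
      refine (congrArg MeasurableSet this).mpr ?_
      exact measurable_snd (MeasurableSet.biUnion (to_countable (Iic n)) fun i _ =>
        hM.measurableSet_riseStart hz (half_pow_succ_lt i) MeasurableSet.univ)
  · by_cases hx : x ∈ tiplessSet P M z ∧ x ∉ lowSet z n
    · have hnt := hM.nontrivial_of_notMem_tipSet hz hx.1.1 hx.2 fun e hj he => hx.1.2 n e he hj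
      refine ((finite_Iic n).biUnion fun i _ => hM.finite_mark hz hx.1.1 hnt i).subset ?_
      rintro m ⟨⟨-, hj⟩, -, i, hi, hm⟩
      exact mem_biUnion hi ⟨hm, hj⟩
    · refine finite_empty.subset fun m hm => hx ⟨hm.2.1, hm.1.2.source_mem⟩
  · rintro n x m ⟨⟨hx, hj⟩, hx', i, hi, hm⟩
    exact ⟨⟨hx, hj.mono (compl_subset_compl.2 (lowSet_antitone z n.le_succ))⟩, hx', i,
      hi.trans n.le_succ, hm⟩
  · intro x hx
    obtain ⟨i, n, hi, m, hm, hj⟩ := hM.exists_mark hz hx.1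
    exact ⟨n, m, ⟨hx.1, hj⟩, hx, i, hi, hm⟩
  · by_cases hx : x ∈ tiplessSet P M z
    · have hy := hinv x y hxy hx
      obtain ⟨p⟩ := id hxy
      obtain ⟨c, hc, hcp⟩ := hz.exists_height_ge hM (γ := p.toContinuousMap) (by simpa using hx.1)
      obtain ⟨N, hN⟩ := exists_pow_lt_of_lt_one hc (by norm_num : (1 / 2 : ℝ) < 1)
      refine ⟨N, fun n hn m => ?_⟩
      have hj : JoinedIn (lowSet z n)ᶜ x y := ⟨p, fun t => notMem_lowSet.2
        (((pow_le_pow_of_le_one (by norm_num) (by norm_num) hn).trans_lt hN).trans_le (hcp t))⟩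
      exact ⟨fun h => ⟨⟨hy.1, hj.symm.trans h.1.2⟩, hy, h.2.2⟩,
        fun h => ⟨⟨hx.1, hj.trans h.1.2⟩, hx, h.2.2⟩⟩
    · have hy : y ∉ tiplessSet P M z := fun hy => hx (hinv y x hxy.symm hy)
      exact ⟨0, fun n _ m => ⟨fun h => absurd h.2.1 hx, fun h => absurd h.2.1 hy⟩⟩

lemma IsTame.hasSelection (hM : IsTame P M) (hz : IsAnchor M z) : HasSelection M := by
  have := (hM.hasSelection_tip hz).union (hM.hasSelection_tipless hz)
  rwa [sdiff_union_of_subset fun x hx => hx.1] at this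

lemma IsTame.hasSelection_of_tame (hM : IsTame P M) : HasSelection M := by
  obtain ⟨z, hz, hinv, hcl⟩ := hM.exists_limit_point
  have hmeas : MeasurableSet {x | x ∈ M ∧ Joined x (z x)} :=
    (measurable_id.prodMk hz) hM.measurableSet_joined
  have h1 : HasSelection {x | x ∈ M ∧ Joined x (z x)} := by
    refine HasSelection.of_function hmeas hz (fun x hx => hx.2) fun x y hxy hx => ?_
    have := hinv x hx.1 y hxy
    exact ⟨⟨hM.joined x y hxy hx.1, this ▸ hxy.symm.trans hx.2⟩, this⟩
  have hM' : IsTame P (M \ {x | x ∈ M ∧ Joined x (z x)}) :=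
    { triod := hM.triod
      measurable := hM.measurable.diff hmeas
      joined := fun x y hxy hx => ⟨hM.joined x y hxy hx.1, fun hy =>
        hx.2 ⟨hx.1, by rw [hinv x hx.1 y hxy]; exact hxy.trans hy.2⟩⟩
      disjoint := fun x hx => hM.disjoint x hx.1 }
  have hz' : IsAnchor (M \ {x | x ∈ M ∧ Joined x (z x)}) z :=
    { measurable := hz
      invariant := fun x hx => hinv x hx.1
      mem_closure := fun x hx => hcl x hx.1
      not_joined := fun x hx h => hx.2 ⟨hx.1, h⟩ }
  have := (hM'.hasSelection hz').union h1
  rwa [sdiff_union_of_subset fun x hx => hx.1] at this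

lemma hasSelection_univ {κ : ℕ → X} (hκ : ∀ x : X, IsTriodPoint x → x ∈ reachable κ) :
    HasSelection (univ : Set X) := by
  have hmeas : MeasurableSet {x | ∃ k, Joined x (κ k)} := by
    rw [ofPred_exists]
    exact MeasurableSet.iUnion fun k => measurableSet_joined_seq hκ k
  have hM : IsTame (reachable κ) {x | ∃ k, Joined x (κ k)}ᶜ :=
    { triod := hκ
      measurable := hmeas.compl
      joined := fun x y hxy hx ⟨k, hk⟩ => hx ⟨k, hxy.trans hk⟩
      disjoint := fun x hx hP => hx (exists_joined_of_mem_reachable hP) }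
  have h1 : HasSelection {x | ∃ k, Joined x (κ k)} := by
    refine HasSelection.of_function hmeas (f := fun x => κ (leastIndex fun k => Joined x (κ k)))
      ((measurable_of_countable κ).comp
        (measurable_leastIndex fun k => measurableSet_joined_seq hκ k))
      (fun x hx => leastIndex_spec hx) fun x y hxy hx => ?_
    have : ∀ k, Joined x (κ k) ↔ Joined y (κ k) := fun k =>
      ⟨fun h => hxy.symm.trans h, fun h => hxy.trans h⟩
    exact ⟨hx.imp fun k => (this k).1, by simp only [this]⟩
  have := h1.union hM.hasSelection_of_tame
  rwa [union_compl_self] at this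

end Main

/-- The path-connectedness relation of a Polish space which embeds in the plane is Borel reducible
to eventual equality of binary sequences. -/
theorem exists_reduction_of_isEmbedding {X : Type*} [TopologicalSpace X] [PolishSpace X]
    [MeasurableSpace X] [BorelSpace X] {φ : X → ℂ} (hφ : IsEmbedding φ) :
    ∃ f : X → ℕ → Bool, Measurable f ∧ ∀ x y, Joined x y ↔ ∃ n, ∀ m ≥ n, f x m = f y m := by
  rcases isEmpty_or_nonempty X with hX | hX
  · exact ⟨isEmptyElim, measurable_of_empty _, isEmptyElim⟩
  let := TopologicalSpace.upgradeIsCompletelyMetrizable X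
  obtain ⟨K, hK, h⟩ := exists_countable_joinedIn_of_isTriodPoint hφ
  obtain ⟨κ, hκ⟩ := (hK.insert (Classical.arbitrary X)).exists_eq_range (insert_nonempty _ _)
  refine (hasSelection_univ (κ := κ) fun x hx U hU => ?_).exists_reduction
  obtain ⟨k, hk, hj⟩ := h x hx U hU
  obtain ⟨i, rfl⟩ := hκ.subset (mem_insert_of_mem _ hk)
  exact ⟨i, hj⟩

end PathRed

/-- For every Polish subspace `H` of the plane, the path-connectedness relation on `H`
is Borel reducible to the eventual equality relation `E₀` on `2^ℕ`: there is a Borel map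
`f : H → 2^ℕ` with `x ≈_H y` iff `f x` and `f y` agree from some index on. -/
theorem statement4 (H : Set (ℝ × ℝ)) (hH : PolishSpace H) :
    ∃ f : H → (ℕ → Bool), Measurable f ∧
      ∀ x y : H, JoinedIn H x.1 y.1 ↔ ∃ n : ℕ, ∀ m ≥ n, f x m = f y m := by
  have hφ : Topology.IsEmbedding fun x : H => Complex.equivRealProdCLM.symm (x : ℝ × ℝ) :=
    Complex.equivRealProdCLM.symm.toHomeomorph.isEmbedding.comp Topology.IsEmbedding.subtypeVal
  obtain ⟨f, hf, h⟩ := PathRed.exists_reduction_of_isEmbedding hφ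
  exact ⟨f, hf, fun x y => (joinedIn_iff_joined x.2 y.2).trans (h x y)⟩
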